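/- Let T be an exact measure preserving transformation of the standard probability space (X,𝓕,μ), and let f ∈ L_1^{sym}(μ^d) be a real-valued symmetric kernel with symmetric Hoeffding decomposition f = Σ_{m=0}^{d} Σ_{S ∈ 𝓢_d^m} (R_m f)∘π_S. Assume: (1) for every m = 1,…,d, R_m f ∈ L_{m,π}^{sym}(μ^m) and the series Σ_{𝐤 ∈ ℤ_+^m} V^{*𝐤} R_m f converges in L_{m,π}(μ^m); (2) |Σ_{k=0}^{n−1} V^k R_1 f|_1 = O(√n) as n → ∞. Then there exists σ²(f) ≥ 0 such that V_n^{(d)} f = n^{−(d−1/2)} Σ_{0 ≤ k_1,…,k_d ≤ n−1} D_d V^{(k_1,…,k_d)} (f − R_0 f) converges in distribution to N(0, d² σ²(f)) as n → ∞, and the first absolute moments converge: E |V_n^{(d)} f| → d √(2/π) σ(f). -/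

import Mathlib

open MeasureTheory Filter Topology ENNReal ProbabilityTheory

noncomputable section

namespace VonMises

variable {X : Type} [MeasurableSpace X]

/-- The `d`-fold product measure `μ^d` on the power space `X^d`. -/
abbrev pm (μ : Measure X) (d : ℕ) : Measure (Fin d → X) := Measure.pi fun _ => μ

/-- `(E, tp)` is (a realization of) the projective tensor product
`L_{p 0}(μ) ⊗̂_π ⋯ ⊗̂_π L_{p (d-1)}(μ)`: `tp` is a continuous multilinear map
satisfying the cross-norm identity, whose range spans a dense subspace, and which has
the (isometric) universal lifting property of the projective tensor norm. -/
structure IsPTP (μ : Measure X) {d : ℕ} (p : Fin d → ℝ≥0∞) [∀ i, Fact (1 ≤ p i)]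
    (E : Type) [NormedAddCommGroup E] [NormedSpace ℝ E] [CompleteSpace E]
    (tp : ContinuousMultilinearMap ℝ (fun i : Fin d => Lp ℝ (p i) μ) E) : Prop where
  crossNorm : ∀ f : ∀ i : Fin d, Lp ℝ (p i) μ, ‖tp f‖ = ∏ i, ‖f i‖
  denseSpan : Dense (Submodule.span ℝ (Set.range fun f : ∀ i : Fin d, Lp ℝ (p i) μ => tp f) : Set E)
  lift : ∀ (F : Type) [NormedAddCommGroup F] [NormedSpace ℝ F] [CompleteSpace F]
      (g : ContinuousMultilinearMap ℝ (fun i : Fin d => Lp ℝ (p i) μ) F),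
      ∃ L : E →L[ℝ] F, (∀ f, L (tp f) = g f) ∧ ‖L‖ = ‖g‖

/-- `J` realizes the canonical map from the projective tensor product into `L_q(μ^d)`,
determined by its values on elementary tensors. -/
def IsEmbed (μ : Measure X) {d : ℕ} (p : Fin d → ℝ≥0∞) [∀ i, Fact (1 ≤ p i)]
    (q : ℝ≥0∞) [Fact (1 ≤ q)]
    {E : Type} [NormedAddCommGroup E] [NormedSpace ℝ E] [CompleteSpace E]
    (tp : ContinuousMultilinearMap ℝ (fun i : Fin d => Lp ℝ (p i) μ) E)
    (J : E →L[ℝ] Lp ℝ q (pm μ d)) : Prop :=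
  ∀ f, (J (tp f) : (Fin d → X) → ℝ) =ᵐ[pm μ d] fun x => ∏ i, (f i : X → ℝ) (x i)

/-- `D` realizes the diagonal restriction operator: the norm-one linear map sending an
elementary tensor `f_1 ⊗ ⋯ ⊗ f_d` to the pointwise product `x ↦ f_1(x)⋯f_d(x)`. -/
def IsDiag (μ : Measure X) {d : ℕ} (p : Fin d → ℝ≥0∞) [∀ i, Fact (1 ≤ p i)]
    (r : ℝ≥0∞) [Fact (1 ≤ r)]
    {E : Type} [NormedAddCommGroup E] [NormedSpace ℝ E] [CompleteSpace E]
    (tp : ContinuousMultilinearMap ℝ (fun i : Fin d => Lp ℝ (p i) μ) E)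
    (D : E →L[ℝ] Lp ℝ r μ) : Prop :=
  ‖D‖ = 1 ∧ ∀ f, (D (tp f) : X → ℝ) =ᵐ[μ] fun x => ∏ i, (f i : X → ℝ) x

/-- `W` realizes the tensor Koopman operator `V^𝐤 = V_1^{k_1} ⊗_π ⋯ ⊗_π V_d^{k_d}`,
where `V_i g = g ∘ T_i`. -/
def IsTKoop (μ : Measure X) {d : ℕ} (p : Fin d → ℝ≥0∞) [∀ i, Fact (1 ≤ p i)]
    {E : Type} [NormedAddCommGroup E] [NormedSpace ℝ E] [CompleteSpace E]
    (tp : ContinuousMultilinearMap ℝ (fun i : Fin d => Lp ℝ (p i) μ) E)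
    (T : Fin d → X → X) (k : Fin d → ℕ) (W : E →L[ℝ] E) : Prop :=
  ∀ f g : ∀ i : Fin d, Lp ℝ (p i) μ,
    (∀ i, (g i : X → ℝ) =ᵐ[μ] fun x => (f i : X → ℝ) ((T i)^[k i] x)) → W (tp f) = tp g

/-- `g = V^{*k} f`: the adjoint (transfer) operator applied to `f`, characterized by
`∫_s g dμ = ∫_{T^{-k} s} f dμ` for all measurable `s`. -/
def IsTransfer (μ : Measure X) (T : X → X) (k : ℕ) {p : ℝ≥0∞} [Fact (1 ≤ p)]
    (f g : Lp ℝ p μ) : Prop :=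
  ∀ s : Set X, MeasurableSet s → ∫ x in s, g x ∂μ = ∫ x in T^[k] ⁻¹' s, f x ∂μ

/-- `W` realizes the tensor transfer operator `V^{*𝐤} = V_1^{*k_1} ⊗_π ⋯ ⊗_π V_d^{*k_d}`. -/
def IsTTrans (μ : Measure X) {d : ℕ} (p : Fin d → ℝ≥0∞) [∀ i, Fact (1 ≤ p i)]
    {E : Type} [NormedAddCommGroup E] [NormedSpace ℝ E] [CompleteSpace E]
    (tp : ContinuousMultilinearMap ℝ (fun i : Fin d => Lp ℝ (p i) μ) E)
    (T : Fin d → X → X) (k : Fin d → ℕ) (W : E →L[ℝ] E) : Prop :=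
  ∀ f g : ∀ i : Fin d, Lp ℝ (p i) μ,
    (∀ i, IsTransfer μ (T i) (k i) (f i) (g i)) → W (tp f) = tp g

/-- The σ-algebra of `T`-invariant measurable sets. -/
def invariants (T : X → X) : MeasurableSpace X where
  MeasurableSet' s := MeasurableSet s ∧ T ⁻¹' s = s
  measurableSet_empty := ⟨MeasurableSet.empty, rfl⟩
  measurableSet_compl s hs := ⟨hs.1.compl, by rw [Set.preimage_compl, hs.2]⟩
  measurableSet_iUnion s hs :=
    ⟨MeasurableSet.iUnion fun i => (hs i).1, by
      simp only [Set.preimage_iUnion]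
      exact Set.iUnion_congr fun i => (hs i).2⟩

/-- `W` realizes `E_{inv,1} ⊗_π ⋯ ⊗_π E_{inv,d}`, the projective tensor product of the
conditional expectations with respect to the invariant σ-fields. -/
def IsTCondexpInv (μ : Measure X) {d : ℕ} (p : Fin d → ℝ≥0∞) [∀ i, Fact (1 ≤ p i)]
    {E : Type} [NormedAddCommGroup E] [NormedSpace ℝ E] [CompleteSpace E]
    (tp : ContinuousMultilinearMap ℝ (fun i : Fin d => Lp ℝ (p i) μ) E)
    (T : Fin d → X → X) (W : E →L[ℝ] E) : Prop :=
  ∀ f g : ∀ i : Fin d, Lp ℝ (p i) μ,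
    (∀ i, (g i : X → ℝ) =ᵐ[μ] μ[(f i : X → ℝ) | invariants (T i)]) → W (tp f) = tp g

/-- Exactness of a measure preserving transformation: the tail σ-field
`⋂_n T^{-n}𝓕` is trivial mod `μ`. -/
def Exact (μ : Measure X) (T : X → X) : Prop :=
  ∀ s : Set X, (∀ n : ℕ, ∃ t : Set X, MeasurableSet t ∧ s = T^[n] ⁻¹' t) →
    μ s = 0 ∨ μ s = 1

/-- A kernel of `m` variables is canonical (totally degenerate) if integrating out any
one variable gives `0` almost everywhere. -/
def Canonical (μ : Measure X) (m : ℕ) (h : (Fin m → X) → ℝ) : Prop :=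
  ∀ l : Fin m, ∀ᵐ x ∂ pm μ m, ∫ y, h (Function.update x l y) ∂μ = 0

/-- A kernel of `d` variables is symmetric if it is a.e. invariant under permutations of
its variables. -/
def Symm (μ : Measure X) (d : ℕ) (h : (Fin d → X) → ℝ) : Prop :=
  ∀ σ : Equiv.Perm (Fin d), ∀ᵐ x ∂ pm μ d, h (x ∘ σ) = h x

end VonMises

namespace VonMises

instance instFactAddOne (m : ℕ) : Fact ((1 : ℝ≥0∞) ≤ (m + 1 : ℕ)) :=
  ⟨by exact_mod_cast Nat.one_le_iff_ne_zero.mpr (Nat.succ_ne_zero m)⟩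

section Part1
variable {X : Type} [MeasurableSpace X]

/-- `h` is a (reverse) martingale difference for `T`. -/
def MD (μ : Measure X) (T : X → X) (h : X → ℝ) : Prop :=
  ∀ H : X → ℂ, Measurable H → Integrable (fun x => (h x : ℂ) * H (T x)) μ →
    ∫ x, (h x : ℂ) * H (T x) ∂μ = 0

lemma md_real_of_condExp {μ : Measure X} [IsProbabilityMeasure μ] {T : X → X} (hT : Measurable T)
    {h : X → ℝ} (hi : Integrable h μ)
    (hc : μ[h | MeasurableSpace.comap T inferInstance] =ᵐ[μ] 0)
    (H : X → ℝ) (hH : Measurable H) (hInt : Integrable (fun x => h x * H (T x)) μ) :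
    ∫ x, h x * H (T x) ∂μ = 0 := by
  have hm : MeasurableSpace.comap T inferInstance ≤ (inferInstance : MeasurableSpace X) :=
    hT.comap_le
  have hg : StronglyMeasurable[MeasurableSpace.comap T inferInstance] (H ∘ T) :=
    (hH.comp (comap_measurable T)).stronglyMeasurable
  have := condExp_mul_of_stronglyMeasurable_right (μ := μ) hg (f := h) hInt hi
  have h2 : ∫ x, h x * H (T x) ∂μ
      = ∫ x, (μ[h * (H ∘ T) | MeasurableSpace.comap T inferInstance]) x ∂μ :=
    (integral_condExp hm).symm
  rw [h2, integral_congr_ae (this.trans (hc.mul (EventuallyEq.refl _ _)))]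
  simp

lemma md_of_condExp {μ : Measure X} [IsProbabilityMeasure μ] {T : X → X} (hT : Measurable T)
    {h : X → ℝ} (hi : Integrable h μ)
    (hc : μ[h | MeasurableSpace.comap T inferInstance] =ᵐ[μ] 0) : MD μ T h := by
  intro H hH hInt
  have h1 : ∀ x, ((h x : ℂ) * H (T x)).re = h x * (fun y => (H y).re) (T x) := by
    intro x; simp
  have h2 : ∀ x, ((h x : ℂ) * H (T x)).im = h x * (fun y => (H y).im) (T x) := by
    intro x; simp
  have e1 := md_real_of_condExp hT hi hc (fun y => (H y).re) (Complex.measurable_re.comp hH)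
    (hInt.re.congr (Eventually.of_forall h1))
  have e2 := md_real_of_condExp hT hi hc (fun y => (H y).im) (Complex.measurable_im.comp hH)
    (hInt.im.congr (Eventually.of_forall h2))
  rw [← integral_re_add_im hInt]
  have e1' : ∫ x, RCLike.re ((h x : ℂ) * H (T x)) ∂μ = 0 := by
    rw [← e1]; exact integral_congr_ae (Eventually.of_forall h1)
  have e2' : ∫ x, RCLike.im ((h x : ℂ) * H (T x)) ∂μ = 0 := by
    rw [← e2]; exact integral_congr_ae (Eventually.of_forall h2)
  rw [e1', e2']; simp

lemma exact_ergodic {μ : Measure X} [IsProbabilityMeasure μ] {T : X → X}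
    (hT : MeasurePreserving T μ μ) (hex : Exact μ T) : Ergodic T μ := by
  refine ⟨hT, ⟨fun s hs hTs => ?_⟩⟩
  have key : ∀ n : ℕ, s = T^[n] ⁻¹' s := by
    intro n
    induction n with
    | zero => rfl
    | succ n ih =>
      rw [Function.iterate_succ, Set.preimage_comp, ← ih, hTs]
  rcases hex s (fun n => ⟨s, hs, key n⟩) with h | h
  · exact eventuallyConst_set'.2 (Or.inl (ae_eq_empty.2 h))
  · exact eventuallyConst_set'.2 (Or.inr (ae_eq_univ_iff_measure_eq hs.nullMeasurableSet |>.2 (by simpa using h)))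

lemma sq_integral_abs_le {μ : Measure X} [IsProbabilityMeasure μ] {g : X → ℝ}
    (hg : MemLp g 2 μ) : (∫ x, |g x| ∂μ) ^ 2 ≤ ∫ x, g x ^ 2 ∂μ := by
  set a := ∫ x, |g x| ∂μ with ha
  have hi : Integrable g μ := hg.integrable (by norm_num)
  have h2 : Integrable (fun x => g x ^ 2) μ := hg.integrable_sq
  have h0 : 0 ≤ ∫ x, (|g x| - a) ^ 2 ∂μ := integral_nonneg fun x => sq_nonneg _
  have h1 : ∫ x, (|g x| - a) ^ 2 ∂μ = ∫ x, g x ^ 2 ∂μ - a ^ 2 := by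
    have : ∀ x, (|g x| - a) ^ 2 = g x ^ 2 - 2 * a * |g x| + a ^ 2 := by
      intro x; nlinarith [sq_abs (g x)]
    simp_rw [this]
    have h3 : Integrable (fun x => 2 * a * |g x|) μ := hi.abs.const_mul _
    have h4 : Integrable (fun x => g x ^ 2 - 2 * a * |g x|) μ := h2.sub h3
    rw [integral_add h4 (integrable_const _),
      integral_sub h2 h3, integral_const_mul, ← ha]
    simp; ring
  linarith

lemma integrable_birkhoffSum {μ : Measure X} {T : X → X} (hT : MeasurePreserving T μ μ)
    {ψ : X → ℝ} (hψ : Integrable ψ μ) (n : ℕ) : Integrable (birkhoffSum T ψ n) μ := by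
  unfold birkhoffSum
  exact integrable_finsetSum _ fun k _ => (hT.iterate k).integrable_comp_of_integrable hψ

lemma measurable_birkhoffSum {T : X → X} (hT : Measurable T)
    {ψ : X → ℝ} (hψ : Measurable ψ) (n : ℕ) : Measurable (birkhoffSum T ψ n) := by
  unfold birkhoffSum
  exact Finset.measurable_fun_sum _ fun k _ => hψ.comp (hT.iterate k)

lemma integral_birkhoffSum {μ : Measure X} {T : X → X} (hT : MeasurePreserving T μ μ)
    {ψ : X → ℝ} (hψ : Integrable ψ μ) (n : ℕ) :
    ∫ x, birkhoffSum T ψ n x ∂μ = n * ∫ x, ψ x ∂μ := by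
  unfold birkhoffSum
  have hk : ∀ k ∈ Finset.range n, Integrable (fun x => ψ (T^[k] x)) μ :=
    fun k _ => (hT.iterate k).integrable_comp_of_integrable hψ
  rw [integral_finsetSum _ hk]
  have : ∀ k ∈ Finset.range n, ∫ x, ψ (T^[k] x) ∂μ = ∫ x, ψ x ∂μ := by
    intro k _
    have hk := hT.iterate k
    have := integral_map (μ := μ) hk.aemeasurable (f := ψ) (by rw [hk.map_eq]; exact hψ.1)
    rw [hk.map_eq] at this
    exact this.symm
  rw [Finset.sum_congr rfl this]; simp

lemma integral_abs_birkhoffSum_le {μ : Measure X} {T : X → X} (hT : MeasurePreserving T μ μ)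
    {ψ : X → ℝ} (hψ : Integrable ψ μ) (n : ℕ) :
    ∫ x, |birkhoffSum T ψ n x| ∂μ ≤ n * ∫ x, |ψ x| ∂μ := by
  rw [← integral_birkhoffSum hT hψ.abs]
  refine integral_mono (integrable_birkhoffSum hT hψ n).abs (integrable_birkhoffSum hT hψ.abs n) ?_
  intro x
  exact Finset.abs_sum_le_sum_abs _ _

end Part1

section Part2
variable {X : Type} [MeasurableSpace X]

/-- Koopman operator on `L_p`. -/
def Koop {μ : Measure X} {T : X → X} (hT : MeasurePreserving T μ μ) (p : ℝ≥0∞) [Fact (1 ≤ p)] :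
    Lp ℝ p μ →L[ℝ] Lp ℝ p μ :=
  (Lp.compMeasurePreservingₗᵢ ℝ T hT).toContinuousLinearMap

lemma Koop_coe {μ : Measure X} {T : X → X} (hT : MeasurePreserving T μ μ) (p : ℝ≥0∞)
    [Fact (1 ≤ p)] (f : Lp ℝ p μ) : (Koop hT p f : X → ℝ) =ᵐ[μ] fun x => f (T x) :=
  Lp.coeFn_compMeasurePreserving f hT

lemma Koop_norm {μ : Measure X} {T : X → X} (hT : MeasurePreserving T μ μ) (p : ℝ≥0∞)
    [Fact (1 ≤ p)] (f : Lp ℝ p μ) : ‖Koop hT p f‖ = ‖f‖ :=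
  Lp.norm_compMeasurePreserving f hT

lemma Koop_pow_coe {μ : Measure X} {T : X → X} (hT : MeasurePreserving T μ μ) (p : ℝ≥0∞)
    [Fact (1 ≤ p)] (f : Lp ℝ p μ) (k : ℕ) :
    ((Koop hT p ^ k) f : X → ℝ) =ᵐ[μ] fun x => f (T^[k] x) := by
  induction k with
  | zero => rfl
  | succ k ih =>
    rw [pow_succ']
    refine (Koop_coe hT p ((Koop hT p ^ k) f)).trans ?_
    have := hT.quasiMeasurePreserving.ae_eq_comp ih
    refine this.trans (Eventually.of_forall fun x => ?_)
    simp [Function.iterate_succ_apply]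

lemma Koop_norm_le {μ : Measure X} {T : X → X} (hT : MeasurePreserving T μ μ) (p : ℝ≥0∞)
    [Fact (1 ≤ p)] : ‖Koop hT p‖ ≤ 1 :=
  ContinuousLinearMap.opNorm_le_bound _ zero_le_one fun f => by rw [Koop_norm, one_mul]

lemma L2_norm_sq {μ : Measure X} (f : Lp ℝ 2 μ) : ‖f‖ ^ 2 = ∫ x, f x ^ 2 ∂μ := by
  rw [← real_inner_self_eq_norm_sq, L2.inner_def]
  refine integral_congr_ae (Eventually.of_forall fun x => ?_)
  simp [sq]

lemma ergodic_L1_of_L2 {μ : Measure X} [IsProbabilityMeasure μ] {T : X → X}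
    (herg : Ergodic T μ) {ψ : X → ℝ} (hψ : MemLp ψ 2 μ) :
    Tendsto (fun n : ℕ => ∫ x, |birkhoffSum T ψ n x / n - ∫ y, ψ y ∂μ| ∂μ) atTop (𝓝 0) := by
  have hT := herg.toMeasurePreserving
  set F : Lp ℝ 2 μ := hψ.toLp ψ with hF
  have hlim := ContinuousLinearMap.tendsto_birkhoffAverage_orthogonalProjection
    (Koop hT 2) (Koop_norm_le hT 2) F
  set u' := ((Koop hT 2).eqLocus (1 : Lp ℝ 2 μ →L[ℝ] Lp ℝ 2 μ)).orthogonalProjectionOnto F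
  set u : Lp ℝ 2 μ := (u' : Lp ℝ 2 μ) with hu
  have hfix : Koop hT 2 u = u := by
    have := u'.2
    exact this
  obtain ⟨c, hc⟩ := herg.ae_eq_const_of_ae_eq_comp_ae (Lp.aestronglyMeasurable u)
    ((Koop_coe hT 2 u).symm.trans (by rw [hfix]))
  have hcoe : ∀ n : ℕ, (birkhoffAverage ℝ (Koop hT 2) _root_.id n F : Lp ℝ 2 μ)
      =ᵐ[μ] fun x => birkhoffSum T ψ n x / n := by
    intro n
    have h1 : birkhoffAverage ℝ (Koop hT 2) _root_.id n F
        = (n : ℝ)⁻¹ • ∑ k ∈ Finset.range n, (Koop hT 2 ^ k) F := by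
      simp [birkhoffAverage, birkhoffSum]
    rw [h1]
    refine (Lp.coeFn_smul _ _).trans ?_
    have h2 := Lp.coeFn_finsetSum (Finset.range n) (fun k => (Koop hT 2 ^ k) F)
    have h3 : ∀ k : ℕ, ((Koop hT 2 ^ k) F : X → ℝ) =ᵐ[μ] fun x => ψ (T^[k] x) := fun k =>
      (Koop_pow_coe hT 2 F k).trans
        ((hT.iterate k).quasiMeasurePreserving.ae_eq_comp hψ.coeFn_toLp)
    filter_upwards [h2, ae_all_iff.2 h3] with x hx hx3
    rw [Pi.smul_apply, hx]
    simp only [birkhoffSum, Finset.sum_apply, smul_eq_mul, hx3]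
    rw [div_eq_inv_mul]
  have hnorm : Tendsto (fun n : ℕ => ∫ x, |birkhoffSum T ψ n x / n - c| ∂μ) atTop (𝓝 0) := by
    have h0 : Tendsto (fun n : ℕ => ‖birkhoffAverage ℝ (Koop hT 2) _root_.id n F - u‖) atTop (𝓝 0) :=
      tendsto_iff_norm_sub_tendsto_zero.1 hlim
    refine squeeze_zero (fun n => integral_nonneg fun x => abs_nonneg _) (fun n => ?_) h0
    set w := birkhoffAverage ℝ (Koop hT 2) _root_.id n F - u with hw
    have e1 : ∫ x, |birkhoffSum T ψ n x / n - c| ∂μ = ∫ x, |w x| ∂μ := by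
      refine integral_congr_ae ?_
      filter_upwards [hcoe n, hc, Lp.coeFn_sub (birkhoffAverage ℝ (Koop hT 2) _root_.id n F) u]
        with x h1 h2 h3
      rw [h3, Pi.sub_apply, h1, h2]; rfl
    rw [e1]
    have := sq_integral_abs_le (Lp.memLp w)
    rw [← L2_norm_sq] at this
    exact (abs_le_of_sq_le_sq' this (norm_nonneg _)).2
  have hψi : Integrable ψ μ := hψ.integrable (by norm_num)
  have hcc : ∫ y, ψ y ∂μ = c := by
    have h1 : Tendsto (fun n : ℕ => |∫ y, ψ y ∂μ - c|) atTop (𝓝 0) := by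
      refine squeeze_zero' (Eventually.of_forall fun n => abs_nonneg _) ?_ hnorm
      filter_upwards [eventually_gt_atTop 0] with n hn
      have hi := integrable_birkhoffSum hT hψi n
      have h2 : ∫ x, (birkhoffSum T ψ n x / n - c) ∂μ = ∫ y, ψ y ∂μ - c := by
        rw [integral_sub (hi.div_const _) (integrable_const _), integral_div,
          integral_birkhoffSum hT hψi]
        have : (n : ℝ) ≠ 0 := by positivity
        field_simp
        simp
      rw [← h2]
      exact abs_integral_le_integral_abs
    have := tendsto_nhds_unique h1 tendsto_const_nhds
    have := abs_eq_zero.1 this.symm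
    linarith
  rw [hcc]; exact hnorm

lemma ergodic_L1 {μ : Measure X} [IsProbabilityMeasure μ] {T : X → X}
    (herg : Ergodic T μ) {ψ : X → ℝ} (hψ : Integrable ψ μ) :
    Tendsto (fun n : ℕ => ∫ x, |birkhoffSum T ψ n x / n - ∫ y, ψ y ∂μ| ∂μ) atTop (𝓝 0) := by
  have hT := herg.toMeasurePreserving
  rw [Metric.tendsto_atTop]
  intro ε hε
  obtain ⟨g₀, hg1, hg2⟩ := (memLp_one_iff_integrable.2 hψ).exists_simpleFunc_eLpNorm_sub_lt
    (by simp) (ε := ENNReal.ofReal (ε / 4)) (by simpa using by positivity)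
  have hgL2 : MemLp g₀ 2 μ := SimpleFunc.memLp_of_isFiniteMeasure g₀ 2 μ
  generalize (g₀ : X → ℝ) = g at hg1 hg2 hgL2
  have hgi : Integrable g μ := hgL2.integrable (by norm_num)
  have hdi : Integrable (ψ - g) μ := hψ.sub hgi
  have hd : ∫ x, |(ψ - g) x| ∂μ < ε / 4 := by
    rw [eLpNorm_one_eq_lintegral_enorm] at hg1
    have := integral_norm_eq_lintegral_enorm hdi.1
    simp only [Real.norm_eq_abs] at this
    rw [this]
    exact ENNReal.toReal_lt_of_lt_ofReal hg1
  obtain ⟨N, hN⟩ := (Metric.tendsto_atTop.1 (ergodic_L1_of_L2 herg hgL2)) (ε / 4) (by positivity)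
  refine ⟨max N 1, fun n hn => ?_⟩
  have hn1 : (0 : ℝ) < n := by
    have : 1 ≤ n := le_trans (le_max_right _ _) hn
    exact_mod_cast this
  have h1 := hN n (le_trans (le_max_left _ _) hn)
  rw [Real.dist_eq, sub_zero, abs_of_nonneg (integral_nonneg fun x => abs_nonneg _)] at h1 ⊢
  have hbi := integrable_birkhoffSum hT hdi n
  have hgbi := integrable_birkhoffSum hT hgi n
  have hψbi := integrable_birkhoffSum hT hψ n
  have hb : ∫ x, |birkhoffSum T (ψ - g) n x / n| ∂μ ≤ ∫ x, |(ψ - g) x| ∂μ := by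
    simp_rw [abs_div, Nat.abs_cast]
    rw [integral_div, div_le_iff₀ hn1, mul_comm]
    exact integral_abs_birkhoffSum_le hT hdi n
  have hc : |∫ y, ψ y ∂μ - ∫ y, g y ∂μ| ≤ ∫ x, |(ψ - g) x| ∂μ := by
    rw [← integral_sub hψ hgi]; exact abs_integral_le_integral_abs
  have hpt : ∀ x, |birkhoffSum T ψ n x / n - ∫ y, ψ y ∂μ| ≤
      (|birkhoffSum T (ψ - g) n x / n| + |birkhoffSum T g n x / n - ∫ y, g y ∂μ|)
        + |∫ y, ψ y ∂μ - ∫ y, g y ∂μ| := by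
    intro x
    have : birkhoffSum T (ψ - g) n x = birkhoffSum T ψ n x - birkhoffSum T g n x := by
      simp [birkhoffSum]
    rw [this, sub_div]
    have e : birkhoffSum T ψ n x / n - ∫ y, ψ y ∂μ =
      (birkhoffSum T ψ n x / n - birkhoffSum T g n x / n)
      + (birkhoffSum T g n x / n - ∫ y, g y ∂μ) - (∫ y, ψ y ∂μ - ∫ y, g y ∂μ) := by ring
    rw [e]
    exact (abs_sub _ _).trans (add_le_add (abs_add_le _ _) le_rfl)
  have i1 : Integrable (fun x => |birkhoffSum T (ψ - g) n x / n|) μ := (hbi.div_const _).abs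
  have i2 : Integrable (fun x => |birkhoffSum T g n x / n - ∫ y, g y ∂μ|) μ :=
    ((hgbi.div_const _).sub (integrable_const _)).abs
  have i3 : Integrable (fun x => |birkhoffSum T (ψ - g) n x / n|
      + |birkhoffSum T g n x / n - ∫ y, g y ∂μ|) μ := i1.add i2
  calc _ ≤ ∫ x, ((|birkhoffSum T (ψ - g) n x / n| + |birkhoffSum T g n x / n - ∫ y, g y ∂μ|)
        + |∫ y, ψ y ∂μ - ∫ y, g y ∂μ|) ∂μ :=
        integral_mono ((hψbi.div_const _).sub (integrable_const _)).abs
          (i3.add (integrable_const _)) hpt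
    _ = ∫ x, |birkhoffSum T (ψ - g) n x / n| ∂μ + ∫ x, |birkhoffSum T g n x / n - ∫ y, g y ∂μ| ∂μ
        + |∫ y, ψ y ∂μ - ∫ y, g y ∂μ| := by
        rw [integral_add i3 (integrable_const _), integral_add i1 i2]; simp
    _ < ε := by linarith

end Part2

section Part3
variable {X : Type} [MeasurableSpace X]

lemma norm_one_add_I_mul_sq (y : ℝ) : ‖(1 : ℂ) + Complex.I * (y : ℂ)‖ ^ 2 = 1 + y ^ 2 := by
  rw [← Complex.normSq_eq_norm_sq, Complex.normSq_apply]
  simp; ring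

lemma norm_one_add_I_mul_le (y : ℝ) : ‖(1 : ℂ) + Complex.I * (y : ℂ)‖ ≤ Real.exp (y ^ 2 / 2) := by
  have h := norm_one_add_I_mul_sq y
  have h1 : ‖(1 : ℂ) + Complex.I * (y : ℂ)‖ ^ 2 ≤ (Real.exp (y ^ 2 / 2)) ^ 2 := by
    rw [h, ← Real.exp_nat_mul]
    have := Real.add_one_le_exp (y ^ 2)
    have e : ((2 : ℕ) : ℝ) * (y ^ 2 / 2) = y ^ 2 := by push_cast; ring
    rw [e]; linarith
  exact (abs_le_of_sq_le_sq' h1 (Real.exp_pos _).le).2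

lemma cexp_cmp (y : ℝ) (hy : |y| ≤ 1) :
    ‖Complex.exp (Complex.I * (y : ℂ)) - (1 + Complex.I * (y : ℂ)) * (Real.exp (-(y ^ 2 / 2)) : ℝ)‖
      ≤ 4 * |y| ^ 3 := by
  have hn : ‖Complex.I * (y : ℂ)‖ = |y| := by simp
  have h1 := Complex.exp_bound (x := Complex.I * (y : ℂ)) (by rw [hn]; exact hy) (n := 3) (by norm_num)
  rw [hn] at h1
  have hy0 := abs_nonneg y
  have h2 := Complex.norm_exp_sub_one_sub_id_le (x := ((-(y ^ 2 / 2) : ℝ) : ℂ)) (by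
    rw [Complex.norm_real, Real.norm_eq_abs, abs_neg, abs_of_nonneg (by positivity)]
    nlinarith [sq_abs y])
  rw [Complex.norm_real, Real.norm_eq_abs, abs_neg, abs_of_nonneg (by positivity),
    ← Complex.ofReal_exp] at h2
  have hI2 : Complex.I ^ 2 = -1 := Complex.I_sq
  set E := (Real.exp (-(y ^ 2 / 2)) : ℝ)
  have e : Complex.exp (Complex.I * (y : ℂ)) - (1 + Complex.I * (y : ℂ)) * (E : ℂ)
      = (Complex.exp (Complex.I * (y : ℂ)) - ∑ m ∈ Finset.range 3, (Complex.I * (y : ℂ)) ^ m / (m.factorial : ℂ))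
        + Complex.I * (y : ℂ) ^ 3 / 2
        - (1 + Complex.I * (y : ℂ)) * ((E : ℂ) - 1 - ((-(y ^ 2 / 2) : ℝ) : ℂ)) := by
    simp [Finset.sum_range_succ, Nat.factorial]
    ring_nf
    rw [hI2]; ring
  rw [e]
  have h3 : ‖Complex.I * (y : ℂ) ^ 3 / 2‖ = |y| ^ 3 / 2 := by simp
  have h4 : ‖(1 : ℂ) + Complex.I * (y : ℂ)‖ ≤ 2 := by
    refine (norm_add_le _ _).trans ?_
    rw [hn]; simp; linarith
  have h5 : ‖(1 + Complex.I * (y : ℂ)) * ((E : ℂ) - 1 - ((-(y ^ 2 / 2) : ℝ) : ℂ))‖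
      ≤ 2 * (y ^ 2 / 2) ^ 2 := by
    rw [norm_mul]
    exact mul_le_mul h4 h2 (norm_nonneg _) (by norm_num)
  have h6 : (y ^ 2 / 2) ^ 2 ≤ |y| ^ 3 / 4 := by
    rw [← sq_abs y]
    have : |y| ^ 3 * |y| ≤ |y| ^ 3 * 1 := mul_le_mul_of_nonneg_left hy (by positivity)
    nlinarith
  have h7 : |y| ^ 3 * ((Nat.succ 3 : ℕ) * ((Nat.factorial 3 : ℕ) * (3 : ℕ) : ℝ)⁻¹) ≤ |y| ^ 3 := by
    refine mul_le_of_le_one_right (by positivity) ?_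
    norm_num [Nat.factorial]
  refine (norm_sub_le _ _).trans ?_
  refine (add_le_add (norm_add_le _ _) le_rfl).trans ?_
  rw [h3]
  have h8 := h1.trans h7
  have : 0 ≤ |y| ^ 3 := by positivity
  linarith

lemma norm_prod_sub_prod_le_range (a b : ℕ → ℂ) (ha : ∀ k, ‖a k‖ ≤ 1) (hb : ∀ k, ‖b k‖ ≤ 1)
    (δ : ℝ) (hab : ∀ k, ‖a k - b k‖ ≤ δ) (n : ℕ) :
    ‖∏ k ∈ Finset.range n, a k - ∏ k ∈ Finset.range n, b k‖ ≤ n * δ := by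
  induction n with
  | zero => simp
  | succ n ih =>
    rw [Finset.prod_range_succ, Finset.prod_range_succ]
    have e : (∏ k ∈ Finset.range n, a k) * a n - (∏ k ∈ Finset.range n, b k) * b n
      = (∏ k ∈ Finset.range n, a k - ∏ k ∈ Finset.range n, b k) * a n
        + (∏ k ∈ Finset.range n, b k) * (a n - b n) := by ring
    rw [e]
    have hB : ‖∏ k ∈ Finset.range n, b k‖ ≤ 1 := by
      rw [norm_prod]
      exact Finset.prod_le_one (fun _ _ => norm_nonneg _) fun k _ => hb k
    refine (norm_add_le _ _).trans ?_
    rw [norm_mul, norm_mul]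
    have h1 : ‖∏ k ∈ Finset.range n, a k - ∏ k ∈ Finset.range n, b k‖ * ‖a n‖ ≤ n * δ :=
      (mul_le_of_le_one_right (norm_nonneg _) (ha n)).trans ih
    have h2 : ‖∏ k ∈ Finset.range n, b k‖ * ‖a n - b n‖ ≤ δ :=
      (mul_le_of_le_one_left (norm_nonneg _) hB).trans (hab n)
    push_cast; linarith

lemma exp_neg_lip (a b : ℝ) (ha : 0 ≤ a) (hb : 0 ≤ b) :
    |Real.exp (-a) - Real.exp (-b)| ≤ |a - b| := by
  wlog hab : a ≤ b generalizing a b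
  · rw [abs_sub_comm, abs_sub_comm a b]; exact this b a hb ha (le_of_not_ge hab)
  have h1 : Real.exp (-b) ≤ Real.exp (-a) := Real.exp_le_exp.2 (by linarith)
  rw [abs_of_nonneg (by linarith), abs_sub_comm, abs_of_nonneg (by linarith)]
  have h2 : Real.exp (-b) = Real.exp (-a) * Real.exp (-(b - a)) := by
    rw [← Real.exp_add]; ring_nf
  have h3 := Real.add_one_le_exp (-(b - a))
  have h4 : Real.exp (-a) ≤ 1 := Real.exp_le_one_iff.2 (by linarith)
  have h5 := Real.exp_pos (-a)
  rw [h2]; nlinarith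

/-- the Riesz type product. -/
def RP (T : X → X) (φ : X → ℝ) (c : ℝ) (n : ℕ) (x : X) : ℂ :=
  ∏ k ∈ Finset.range n, (1 + Complex.I * ((c * φ (T^[k] x) : ℝ) : ℂ))

lemma RP_succ (T : X → X) (φ : X → ℝ) (c : ℝ) (n : ℕ) (x : X) :
    RP T φ c (n + 1) x = (1 + Complex.I * ((c * φ x : ℝ) : ℂ)) * RP T φ c n (T x) := by
  unfold RP
  rw [Finset.prod_range_succ', mul_comm]
  simp [Function.iterate_succ_apply]

lemma RP_measurable {T : X → X} (hT : Measurable T) {φ : X → ℝ} (hφ : Measurable φ) (c : ℝ) (n : ℕ) :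
    Measurable (RP T φ c n) := by
  unfold RP
  refine Finset.measurable_fun_prod _ fun k _ => ?_
  have := hφ.comp (hT.iterate k)
  simp only [Function.comp_def] at this
  fun_prop

lemma RP_bound {T : X → X} {φ : X → ℝ} {K : ℝ} (hK : ∀ x, |φ x| ≤ K) (c : ℝ) (n : ℕ) (x : X) :
    ‖RP T φ c n x‖ ≤ Real.exp (n * (c ^ 2 * K ^ 2) / 2) := by
  induction n generalizing x with
  | zero => simp [RP]
  | succ n ih =>
    rw [RP_succ, norm_mul]
    have h1 : ‖(1 : ℂ) + Complex.I * ((c * φ x : ℝ) : ℂ)‖ ≤ Real.exp (c ^ 2 * K ^ 2 / 2) := by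
      refine (norm_one_add_I_mul_le _).trans (Real.exp_le_exp.2 ?_)
      rw [mul_pow]
      have : φ x ^ 2 ≤ K ^ 2 := sq_le_sq' (abs_le.1 (hK x)).1 (abs_le.1 (hK x)).2
      have := mul_le_mul_of_nonneg_left this (sq_nonneg c)
      linarith
    refine (mul_le_mul h1 (ih (T x)) (norm_nonneg _) (Real.exp_pos _).le).trans ?_
    rw [← Real.exp_add]
    refine Real.exp_le_exp.2 (le_of_eq ?_)
    push_cast; ring

lemma RP_integral {μ : Measure X} [IsProbabilityMeasure μ] {T : X → X}
    (hT : MeasurePreserving T μ μ) {φ : X → ℝ} (hφ : Measurable φ) {K : ℝ} (hK : ∀ x, |φ x| ≤ K)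
    (hmd : MD μ T φ) (c : ℝ) (n : ℕ) : ∫ x, RP T φ c n x ∂μ = 1 := by
  induction n with
  | zero => simp [RP]
  | succ n ih =>
    have hm := RP_measurable hT.measurable hφ c n
    have hbd : ∀ x, ‖RP T φ c n (T x)‖ ≤ Real.exp (n * (c ^ 2 * K ^ 2) / 2) :=
      fun x => RP_bound hK c n (T x)
    have i1 : Integrable (fun x => RP T φ c n (T x)) μ :=
      Integrable.of_bound (hm.comp hT.measurable).aestronglyMeasurable _ (Eventually.of_forall hbd)
    have hH : Measurable (fun y => Complex.I * (c : ℂ) * RP T φ c n y) := by fun_prop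
    have i2 : Integrable (fun x => (φ x : ℂ) * (fun y => Complex.I * (c : ℂ) * RP T φ c n y) (T x)) μ := by
      have h1 : Integrable (fun x => (Complex.I * (c : ℂ)) * RP T φ c n (T x)) μ := i1.const_mul _
      refine h1.bdd_mul (c := K) (by fun_prop) ?_
      exact Eventually.of_forall fun x => by simpa using hK x
    have h0 := hmd _ hH i2
    have e : ∀ x, RP T φ c (n + 1) x = RP T φ c n (T x)
        + (φ x : ℂ) * (fun y => Complex.I * (c : ℂ) * RP T φ c n y) (T x) := by
      intro x; rw [RP_succ]; push_cast; ring
    simp_rw [e]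
    rw [integral_add i1 i2, h0, add_zero, ← ih]
    have := integral_map (μ := μ) hT.aemeasurable (f := RP T φ c n) (by fun_prop)
    rw [hT.map_eq] at this
    exact this.symm

lemma clt_bdd {μ : Measure X} [IsProbabilityMeasure μ] {T : X → X}
    (herg : Ergodic T μ) {φ : X → ℝ} (hφ : Measurable φ) {K : ℝ} (hK : ∀ x, |φ x| ≤ K)
    (hmd : MD μ T φ) (t : ℝ) :
    Tendsto (fun n : ℕ => ∫ x, Complex.exp (Complex.I *
        ((t * (birkhoffSum T φ n x / Real.sqrt n) : ℝ) : ℂ)) ∂μ) atTop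
      (𝓝 ((Real.exp (-(t ^ 2 * (∫ x, φ x ^ 2 ∂μ) / 2)) : ℝ) : ℂ)) := by
  have hT := herg.toMeasurePreserving
  have hK0 : 0 ≤ K := by
    obtain ⟨x⟩ := nonempty_of_isProbabilityMeasure μ
    exact (abs_nonneg _).trans (hK x)
  set s := ∫ x, φ x ^ 2 ∂μ with hs
  have hs0 : 0 ≤ s := integral_nonneg fun x => sq_nonneg _
  have hφ2i : Integrable (fun x => φ x ^ 2) μ :=
    Integrable.of_bound (by fun_prop) (K ^ 2) (Eventually.of_forall fun x => by
      rw [Real.norm_eq_abs, abs_pow]; exact pow_le_pow_left₀ (abs_nonneg _) (hK x) 2)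
  have herg1 := ergodic_L1 herg hφ2i
  rw [← hs] at herg1
  rw [tendsto_iff_norm_sub_tendsto_zero]
  set C := Real.exp (t ^ 2 * K ^ 2 / 2) with hC
  have hbound : Tendsto (fun n : ℕ => 4 * (|t| * K) ^ 3 / Real.sqrt n
      + C * (t ^ 2 / 2) * ∫ x, |birkhoffSum T (fun x => φ x ^ 2) n x / n - s| ∂μ) atTop (𝓝 0) := by
    have h1 : Tendsto (fun n : ℕ => 4 * (|t| * K) ^ 3 / Real.sqrt n) atTop (𝓝 0) :=
      Tendsto.div_atTop tendsto_const_nhds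
        (Real.tendsto_sqrt_atTop.comp tendsto_natCast_atTop_atTop)
    simpa using h1.add (herg1.const_mul (C * (t ^ 2 / 2)))
  refine squeeze_zero' (Eventually.of_forall fun n => norm_nonneg _) ?_ hbound
  have hev : ∀ᶠ n : ℕ in atTop, |t| * K ≤ Real.sqrt n :=
    (Real.tendsto_sqrt_atTop.comp tendsto_natCast_atTop_atTop).eventually_ge_atTop _
  filter_upwards [hev, eventually_gt_atTop 0] with n hn hn0
  have hnR : (0 : ℝ) < n := by exact_mod_cast hn0
  have hsq : 0 < Real.sqrt n := Real.sqrt_pos.2 hnR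
  have hsq2 : Real.sqrt n ^ 2 = n := Real.sq_sqrt hnR.le
  set c := t / Real.sqrt n with hc
  have hc2 : c ^ 2 = t ^ 2 / n := by rw [hc, div_pow, hsq2]
  have hcb : ∀ y, |c * φ y| ≤ |t| * K / Real.sqrt n := by
    intro y
    rw [abs_mul, hc, abs_div, abs_of_pos hsq, div_mul_eq_mul_div]
    exact div_le_div_of_nonneg_right (mul_le_mul_of_nonneg_left (hK y) (abs_nonneg _)) hsq.le
  have hcb1 : ∀ y, |c * φ y| ≤ 1 := fun y => (hcb y).trans ((div_le_one hsq).2 hn)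
  set G : X → ℂ := fun x => RP T φ c n x *
    (Real.exp (-(t ^ 2 / 2 * (birkhoffSum T (fun x => φ x ^ 2) n x / n))) : ℝ) with hG
  have hmS := measurable_birkhoffSum hT.measurable hφ n
  have hmQ := measurable_birkhoffSum hT.measurable (hφ.pow_const 2) n
  have hmR := RP_measurable hT.measurable hφ c n
  have hRb : ∀ x, ‖RP T φ c n x‖ ≤ C := by
    intro x
    refine (RP_bound hK c n x).trans (Real.exp_le_exp.2 (le_of_eq ?_))
    rw [hc2]; field_simp
  have hRi : Integrable (RP T φ c n) μ :=
    Integrable.of_bound hmR.aestronglyMeasurable C (Eventually.of_forall hRb)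
  have hpt : ∀ x, ‖Complex.exp (Complex.I * ((t * (birkhoffSum T φ n x / Real.sqrt n) : ℝ) : ℂ)) - G x‖
      ≤ 4 * (|t| * K) ^ 3 / Real.sqrt n := by
    intro x
    have ea : Complex.exp (Complex.I * ((t * (birkhoffSum T φ n x / Real.sqrt n) : ℝ) : ℂ))
        = ∏ k ∈ Finset.range n, Complex.exp (Complex.I * ((c * φ (T^[k] x) : ℝ) : ℂ)) := by
      rw [← Complex.exp_sum, ← Finset.mul_sum, ← Complex.ofReal_sum, ← Finset.mul_sum]
      congr 3
      rw [hc, birkhoffSum]; ring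
    have eb : G x = ∏ k ∈ Finset.range n, ((1 + Complex.I * ((c * φ (T^[k] x) : ℝ) : ℂ)) *
        (Real.exp (-((c * φ (T^[k] x)) ^ 2 / 2)) : ℝ)) := by
      rw [Finset.prod_mul_distrib, hG]
      simp only [RP]
      congr 1
      rw [← Complex.ofReal_prod, ← Real.exp_sum]
      congr 2
      rw [birkhoffSum, Finset.sum_neg_distrib, Finset.sum_div, Finset.mul_sum]
      congr 1
      refine Finset.sum_congr rfl fun k _ => ?_
      rw [mul_pow, hc2]; ring
    rw [ea, eb]
    have := norm_prod_sub_prod_le_range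
      (fun k => Complex.exp (Complex.I * ((c * φ (T^[k] x) : ℝ) : ℂ)))
      (fun k => (1 + Complex.I * ((c * φ (T^[k] x) : ℝ) : ℂ)) *
        (Real.exp (-((c * φ (T^[k] x)) ^ 2 / 2)) : ℝ))
      (fun k => by rw [mul_comm, Complex.norm_exp_ofReal_mul_I])
      (fun k => by
        rw [norm_mul, Complex.norm_real, Real.norm_eq_abs, Real.abs_exp]
        calc _ ≤ Real.exp ((c * φ (T^[k] x)) ^ 2 / 2) * Real.exp (-((c * φ (T^[k] x)) ^ 2 / 2)) :=
              mul_le_mul_of_nonneg_right (norm_one_add_I_mul_le _) (Real.exp_pos _).le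
          _ = 1 := by rw [← Real.exp_add]; simp)
      (4 * (|t| * K / Real.sqrt n) ^ 3)
      (fun k => (cexp_cmp _ (hcb1 _)).trans (by
        have := pow_le_pow_left₀ (abs_nonneg _) (hcb (T^[k] x)) 3
        linarith)) n
    refine this.trans (le_of_eq ?_)
    rw [div_pow]
    have e3 : Real.sqrt n ^ 3 = n * Real.sqrt n := by rw [pow_succ, hsq2]
    rw [e3]; field_simp
  have hexpi : Integrable (fun x => Complex.exp (Complex.I *
      ((t * (birkhoffSum T φ n x / Real.sqrt n) : ℝ) : ℂ))) μ :=
    Integrable.of_bound (by fun_prop) 1 (Eventually.of_forall fun x => by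
      rw [mul_comm, Complex.norm_exp_ofReal_mul_I])
  have hQ0 : ∀ x, 0 ≤ birkhoffSum T (fun x => φ x ^ 2) n x / n := fun x =>
    div_nonneg (Finset.sum_nonneg fun k _ => sq_nonneg _) hnR.le
  have hGi : Integrable G μ := by
    refine Integrable.of_bound (by fun_prop) C (Eventually.of_forall fun x => ?_)
    rw [hG]
    simp only [norm_mul, Complex.norm_real, Real.norm_eq_abs, Real.abs_exp]
    refine (mul_le_of_le_one_right (norm_nonneg _) (Real.exp_le_one_iff.2 ?_)).trans (hRb x)
    have := hQ0 x
    nlinarith [sq_nonneg t, mul_nonneg (sq_nonneg t) this]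
  have hGdiff : ‖∫ x, G x ∂μ - ((Real.exp (-(t ^ 2 * s / 2)) : ℝ) : ℂ)‖ ≤
      C * (t ^ 2 / 2) * ∫ x, |birkhoffSum T (fun x => φ x ^ 2) n x / n - s| ∂μ := by
    have e1 : ((Real.exp (-(t ^ 2 * s / 2)) : ℝ) : ℂ)
        = ∫ x, RP T φ c n x * ((Real.exp (-(t ^ 2 * s / 2)) : ℝ) : ℂ) ∂μ := by
      rw [integral_mul_const, RP_integral hT hφ hK hmd, one_mul]
    clear_value s
    rw [e1, ← integral_sub hGi (hRi.mul_const _), ← integral_const_mul]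
    refine norm_integral_le_of_norm_le ?_ (Eventually.of_forall fun x => ?_)
    · exact ((((integrable_birkhoffSum hT hφ2i n).div_const _).sub (integrable_const _)).abs).const_mul _
    · rw [hG]
      simp only
      rw [← mul_sub, norm_mul, ← Complex.ofReal_sub, Complex.norm_real, Real.norm_eq_abs, mul_assoc]
      refine mul_le_mul (hRb x) ?_ (abs_nonneg _) (Real.exp_pos _).le
      have h1 := exp_neg_lip (t ^ 2 / 2 * (birkhoffSum T (fun x => φ x ^ 2) n x / n)) (t ^ 2 * s / 2)
        (mul_nonneg (by positivity) (hQ0 x)) (by positivity)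
      refine h1.trans (le_of_eq ?_)
      rw [← abs_of_nonneg (show (0 : ℝ) ≤ t ^ 2 / 2 by positivity), ← abs_mul,
        abs_of_nonneg (show (0 : ℝ) ≤ t ^ 2 / 2 by positivity)]
      congr 1; ring
  have hfirst : ‖∫ x, Complex.exp (Complex.I *
      ((t * (birkhoffSum T φ n x / Real.sqrt n) : ℝ) : ℂ)) ∂μ - ∫ x, G x ∂μ‖
        ≤ 4 * (|t| * K) ^ 3 / Real.sqrt n := by
    rw [← integral_sub hexpi hGi]
    have := norm_integral_le_of_norm_le_const (μ := μ) (Eventually.of_forall hpt)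
    simpa using this
  calc _ = ‖(∫ x, Complex.exp (Complex.I *
      ((t * (birkhoffSum T φ n x / Real.sqrt n) : ℝ) : ℂ)) ∂μ - ∫ x, G x ∂μ)
        + (∫ x, G x ∂μ - ((Real.exp (-(t ^ 2 * s / 2)) : ℝ) : ℂ))‖ := by
        congr 1; ring
    _ ≤ _ := (norm_add_le _ _).trans (add_le_add hfirst hGdiff)

end Part3

section Part4
variable {X : Type} [MeasurableSpace X]

/-- indicator of the event that the quadratic variation has not exceeded one. -/
def chi (T : X → X) (φ : X → ℝ) (c : ℝ) (n : ℕ) (x : X) : ℝ :=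
  if c ^ 2 * birkhoffSum T (fun y => φ y ^ 2) n x ≤ 1 then 1 else 0

/-- stopped Riesz product. -/
def SP (T : X → X) (φ : X → ℝ) (c : ℝ) : ℕ → X → ℂ
  | 0, _ => 1
  | n + 1, x => (1 + Complex.I * ((c * (chi T φ c n (T x) * φ x) : ℝ) : ℂ)) * SP T φ c n (T x)

lemma chi_measurable {T : X → X} (hT : Measurable T) {φ : X → ℝ} (hφ : Measurable φ) (c : ℝ) (n : ℕ) :
    Measurable (chi T φ c n) := by
  unfold chi
  refine Measurable.ite ?_ measurable_const measurable_const
  have := measurable_birkhoffSum hT (hφ.pow_const 2) n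
  exact measurableSet_le (by fun_prop) measurable_const

lemma chi_nonneg (T : X → X) (φ : X → ℝ) (c : ℝ) (n : ℕ) (x : X) : 0 ≤ chi T φ c n x := by
  unfold chi; split_ifs <;> norm_num

lemma chi_le_one (T : X → X) (φ : X → ℝ) (c : ℝ) (n : ℕ) (x : X) : chi T φ c n x ≤ 1 := by
  unfold chi; split_ifs <;> norm_num

lemma chi_succ_le (T : X → X) (φ : X → ℝ) (c : ℝ) (n : ℕ) (x : X) :
    chi T φ c (n + 1) x ≤ chi T φ c n (T x) := by
  unfold chi
  rw [birkhoffSum_succ']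
  have : 0 ≤ c ^ 2 * φ x ^ 2 := by positivity
  split_ifs with h1 h2 h2
  · norm_num
  · exfalso; apply h2; nlinarith
  · norm_num
  · norm_num

lemma SP_measurable {T : X → X} (hT : Measurable T) {φ : X → ℝ} (hφ : Measurable φ) (c : ℝ) (n : ℕ) :
    Measurable (SP T φ c n) := by
  induction n with
  | zero => exact measurable_const
  | succ n ih =>
    have h1 : Measurable (fun x => SP T φ c n (T x)) := ih.comp hT
    have h2 : Measurable (fun x => chi T φ c n (T x)) := (chi_measurable hT hφ c n).comp hT
    show Measurable (fun x => (1 + Complex.I * ((c * (chi T φ c n (T x) * φ x) : ℝ) : ℂ)) *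
      SP T φ c n (T x))
    fun_prop

lemma SP_bound {T : X → X} {φ : X → ℝ} {K : ℝ} (hK : ∀ x, |φ x| ≤ K) (c : ℝ) (n : ℕ) (x : X) :
    ‖SP T φ c n x‖ ≤ Real.exp (min (c ^ 2 * birkhoffSum T (fun y => φ y ^ 2) n x)
      (1 + c ^ 2 * K ^ 2) / 2) := by
  induction n generalizing x with
  | zero =>
    have h : (0 : ℝ) ≤ 1 + c ^ 2 * K ^ 2 := by positivity
    simp [SP, h]
  | succ n ih =>
    have hx := ih (T x)
    rw [birkhoffSum_succ']
    set q := birkhoffSum T (fun y => φ y ^ 2) n (T x) with hq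
    have hsp : SP T φ c (n + 1) x = (1 + Complex.I * ((c * (chi T φ c n (T x) * φ x) : ℝ) : ℂ)) *
      SP T φ c n (T x) := rfl
    have hφ2 : φ x ^ 2 ≤ K ^ 2 := sq_le_sq' (abs_le.1 (hK x)).1 (abs_le.1 (hK x)).2
    have hc := mul_le_mul_of_nonneg_left hφ2 (sq_nonneg c)
    have hp : 0 ≤ c ^ 2 * φ x ^ 2 := by positivity
    rw [hsp, norm_mul]
    by_cases hl : c ^ 2 * q ≤ 1
    · have e : chi T φ c n (T x) = 1 := by unfold chi; rw [if_pos hl]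
      rw [e, one_mul]
      refine (mul_le_mul (norm_one_add_I_mul_le _) hx (norm_nonneg _) (Real.exp_pos _).le).trans ?_
      rw [← Real.exp_add]
      refine Real.exp_le_exp.2 ?_
      have h1 := min_le_left (c ^ 2 * q) (1 + c ^ 2 * K ^ 2)
      have h2 : c ^ 2 * φ x ^ 2 + c ^ 2 * q ≤ min (c ^ 2 * (φ x ^ 2 + q)) (1 + c ^ 2 * K ^ 2) :=
        le_min (by linarith) (by linarith)
      rw [mul_pow]; linarith
    · have e : chi T φ c n (T x) = 0 := by unfold chi; rw [if_neg hl]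
      rw [e]
      simp only [zero_mul, mul_zero, Complex.ofReal_zero, add_zero, norm_one, one_mul]
      refine hx.trans (Real.exp_le_exp.2 ?_)
      have := min_le_min (show c ^ 2 * q ≤ c ^ 2 * (φ x ^ 2 + q) by linarith)
        (le_refl (1 + c ^ 2 * K ^ 2))
      linarith

lemma SP_bound' {T : X → X} {φ : X → ℝ} {K : ℝ} (hK : ∀ x, |φ x| ≤ K) (c : ℝ) (n : ℕ) (x : X) :
    ‖SP T φ c n x‖ ≤ Real.exp ((1 + c ^ 2 * K ^ 2) / 2) :=
  (SP_bound hK c n x).trans (Real.exp_le_exp.2 (by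
    have := min_le_right (c ^ 2 * birkhoffSum T (fun y => φ y ^ 2) n x) (1 + c ^ 2 * K ^ 2)
    linarith))

lemma integral_comp_pres {μ : Measure X} {T : X → X} (hT : MeasurePreserving T μ μ)
    {E : Type*} [NormedAddCommGroup E] [NormedSpace ℝ E] {g : X → E}
    (hg : AEStronglyMeasurable g μ) : ∫ x, g (T x) ∂μ = ∫ x, g x ∂μ := by
  have := integral_map (μ := μ) hT.aemeasurable (f := g) (by rw [hT.map_eq]; exact hg)
  rw [hT.map_eq] at this
  exact this.symm

lemma integral_add4 {μ : Measure X} {f1 f2 f3 f4 : X → ℂ} (h1 : Integrable f1 μ)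
    (h2 : Integrable f2 μ) (h3 : Integrable f3 μ) (h4 : Integrable f4 μ) :
    ∫ x, (f1 x + f2 x + f3 x + f4 x) ∂μ
      = ∫ x, f1 x ∂μ + ∫ x, f2 x ∂μ + ∫ x, f3 x ∂μ + ∫ x, f4 x ∂μ := by
  have h12 : Integrable (fun x => f1 x + f2 x) μ := h1.add h2
  have h123 : Integrable (fun x => f1 x + f2 x + f3 x) μ := h12.add h3
  rw [integral_add h123 h4, integral_add h12 h3, integral_add h1 h2]

section main

/-- integrability of an integrable real function times a stopped product. -/
lemma int_mul_SP {μ : Measure X} [IsProbabilityMeasure μ] {T : X → X}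
    (hT : MeasurePreserving T μ μ) {φ : X → ℝ} (hφ : Measurable φ) {K : ℝ} (hK : ∀ x, |φ x| ≤ K)
    (c : ℝ) {g : X → ℝ} (hg : Integrable g μ) (n : ℕ) :
    Integrable (fun x => (g x : ℂ) * SP T φ c n x) μ := by
  have hm := SP_measurable hT.measurable hφ c n
  exact hg.ofReal.mul_bdd (c := Real.exp ((1 + c ^ 2 * K ^ 2) / 2)) hm.aestronglyMeasurable
    (Eventually.of_forall fun x => SP_bound' hK c n x)

lemma int_mul_SPT {μ : Measure X} [IsProbabilityMeasure μ] {T : X → X}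
    (hT : MeasurePreserving T μ μ) {φ : X → ℝ} (hφ : Measurable φ) {K : ℝ} (hK : ∀ x, |φ x| ≤ K)
    (c : ℝ) {g : X → ℝ} (hg : Integrable g μ) (n : ℕ) :
    Integrable (fun x => (g x : ℂ) * SP T φ c n (T x)) μ := by
  have hm := (SP_measurable hT.measurable hφ c n).comp hT.measurable
  exact hg.ofReal.mul_bdd (c := Real.exp ((1 + c ^ 2 * K ^ 2) / 2)) hm.aestronglyMeasurable
    (Eventually.of_forall fun x => SP_bound' hK c n (T x))

lemma int_mul_chiSPT {μ : Measure X} [IsProbabilityMeasure μ] {T : X → X}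
    (hT : MeasurePreserving T μ μ) {φ : X → ℝ} (hφ : Measurable φ) {K : ℝ} (hK : ∀ x, |φ x| ≤ K)
    (c : ℝ) {g : X → ℝ} (hg : Integrable g μ) (n : ℕ) :
    Integrable (fun x => (g x : ℂ) * ((chi T φ c n (T x) : ℂ) * SP T φ c n (T x))) μ := by
  have hm : Measurable fun x => SP T φ c n (T x) :=
    (SP_measurable hT.measurable hφ c n).comp hT.measurable
  have hm2 : Measurable fun x => chi T φ c n (T x) :=
    (chi_measurable hT.measurable hφ c n).comp hT.measurable
  refine hg.ofReal.mul_bdd (c := Real.exp ((1 + c ^ 2 * K ^ 2) / 2)) (by fun_prop)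
    (Eventually.of_forall fun x => ?_)
  rw [norm_mul, Complex.norm_real, Real.norm_eq_abs, abs_of_nonneg (chi_nonneg _ _ _ _ _)]
  exact (mul_le_of_le_one_left (norm_nonneg _) (chi_le_one _ _ _ _ _)).trans (SP_bound' hK c n _)

/-- one-step expansion. -/
lemma SP_step {μ : Measure X} [IsProbabilityMeasure μ] {T : X → X}
    (hT : MeasurePreserving T μ μ) {φ : X → ℝ} (hφ : Measurable φ) {K : ℝ} (hK : ∀ x, |φ x| ≤ K)
    (hmd : MD μ T φ) (c : ℝ) {g : X → ℝ} (hgm : Measurable g) (hg : Integrable g μ) (n : ℕ) :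
    ∫ x, ((birkhoffSum T g (n + 1) x : ℝ) : ℂ) * SP T φ c (n + 1) x ∂μ
      = ∫ x, ((birkhoffSum T g n x : ℝ) : ℂ) * SP T φ c n x ∂μ
        + ∫ x, (g x : ℂ) * SP T φ c n (T x) ∂μ
        + Complex.I * c * ∫ x, ((g x * φ x : ℝ) : ℂ) * ((chi T φ c n (T x) : ℂ) * SP T φ c n (T x)) ∂μ := by
  have hm := SP_measurable hT.measurable hφ c n
  have hm2 := chi_measurable hT.measurable hφ c n
  have hB := integrable_birkhoffSum hT hg n
  have hBm := measurable_birkhoffSum hT.measurable hgm n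
  have hBT : Integrable (fun x => birkhoffSum T g n (T x)) μ := hT.integrable_comp_of_integrable hB
  have hgφ : Integrable (fun x => g x * φ x) μ :=
    hg.mul_bdd (c := K) hφ.aestronglyMeasurable (Eventually.of_forall hK)
  have hBφ : Integrable (fun x => birkhoffSum T g n (T x) * φ x) μ :=
    hBT.mul_bdd (c := K) hφ.aestronglyMeasurable (Eventually.of_forall hK)
  have j1 := int_mul_SPT hT hφ hK c hBT n
  have j2 := int_mul_SPT hT hφ hK c hg n
  have j3 := (int_mul_chiSPT hT hφ hK c hBφ n).const_mul (Complex.I * c)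
  have j4 := (int_mul_chiSPT hT hφ hK c hgφ n).const_mul (Complex.I * c)
  have z : ∫ x, (Complex.I * c) * (((birkhoffSum T g n (T x) * φ x : ℝ) : ℂ) *
      ((chi T φ c n (T x) : ℂ) * SP T φ c n (T x))) ∂μ = 0 := by
    have := hmd (fun y => (Complex.I * c) * (((birkhoffSum T g n y : ℝ) : ℂ) *
      ((chi T φ c n y : ℂ) * SP T φ c n y))) (by fun_prop) (by
        refine j3.congr (Eventually.of_forall fun x => ?_)
        simp only []; push_cast; ring)
    rw [← this]
    refine integral_congr_ae (Eventually.of_forall fun x => ?_)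
    simp only []; push_cast; ring
  have e : ∀ x, ((birkhoffSum T g (n + 1) x : ℝ) : ℂ) * SP T φ c (n + 1) x
      = ((birkhoffSum T g n (T x) : ℝ) : ℂ) * SP T φ c n (T x) + (g x : ℂ) * SP T φ c n (T x)
      + (Complex.I * c) * (((birkhoffSum T g n (T x) * φ x : ℝ) : ℂ) *
      ((chi T φ c n (T x) : ℂ) * SP T φ c n (T x)))
      + (Complex.I * c) * (((g x * φ x : ℝ) : ℂ) * ((chi T φ c n (T x) : ℂ) * SP T φ c n (T x))) := by
    intro x
    have hsp : SP T φ c (n + 1) x = (1 + Complex.I * ((c * (chi T φ c n (T x) * φ x) : ℝ) : ℂ)) *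
      SP T φ c n (T x) := rfl
    rw [hsp, birkhoffSum_succ']
    push_cast; ring
  simp_rw [e]
  rw [integral_add4 j1 j2 j3 j4, z,
    integral_const_mul, add_zero]
  congr 2
  exact integral_comp_pres hT (g := fun x => ((birkhoffSum T g n x : ℝ) : ℂ) * SP T φ c n x)
    (by fun_prop)

lemma SP_integral {μ : Measure X} [IsProbabilityMeasure μ] {T : X → X}
    (hT : MeasurePreserving T μ μ) {φ : X → ℝ} (hφ : Measurable φ) {K : ℝ} (hK : ∀ x, |φ x| ≤ K)
    (hmd : MD μ T φ) (c : ℝ) (n : ℕ) : ∫ x, SP T φ c n x ∂μ = 1 := by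
  induction n with
  | zero => simp [SP]
  | succ n ih =>
    have hm := SP_measurable hT.measurable hφ c n
    have hm2 := chi_measurable hT.measurable hφ c n
    have hφi : Integrable φ μ := Integrable.of_bound hφ.aestronglyMeasurable K (Eventually.of_forall hK)
    have j3 := (int_mul_chiSPT hT hφ hK c hφi n).const_mul (Complex.I * c)
    have j1 : Integrable (fun x => SP T φ c n (T x)) μ := by
      simpa using int_mul_SPT hT hφ hK c (integrable_const (1 : ℝ)) n
    have z : ∫ x, (Complex.I * c) * ((φ x : ℂ) *
        ((chi T φ c n (T x) : ℂ) * SP T φ c n (T x))) ∂μ = 0 := by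
      have := hmd (fun y => (Complex.I * c) * ((chi T φ c n y : ℂ) * SP T φ c n y)) (by fun_prop) (by
          refine j3.congr (Eventually.of_forall fun x => ?_)
          simp only []; ring)
      rw [← this]
      refine integral_congr_ae (Eventually.of_forall fun x => ?_)
      simp only []; ring
    have e : ∀ x, SP T φ c (n + 1) x = SP T φ c n (T x) + (Complex.I * c) * ((φ x : ℂ) *
        ((chi T φ c n (T x) : ℂ) * SP T φ c n (T x))) := by
      intro x
      have hsp : SP T φ c (n + 1) x = (1 + Complex.I * ((c * (chi T φ c n (T x) * φ x) : ℝ) : ℂ)) *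
        SP T φ c n (T x) := rfl
      rw [hsp]; push_cast; ring
    simp_rw [e]
    rw [integral_add j1 j3, z, add_zero, ← ih]
    exact integral_comp_pres hT hm.aestronglyMeasurable

lemma norm_int_chi_le {μ : Measure X} [IsProbabilityMeasure μ] {T : X → X}
    (hT : MeasurePreserving T μ μ) {φ : X → ℝ} (hφ : Measurable φ) {K : ℝ} (hK : ∀ x, |φ x| ≤ K)
    (c : ℝ) {g : X → ℝ} (hg : Integrable g μ) (n : ℕ) :
    ‖∫ x, (g x : ℂ) * ((chi T φ c n (T x) : ℂ) * SP T φ c n (T x)) ∂μ‖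
      ≤ Real.exp ((1 + c ^ 2 * K ^ 2) / 2) * ∫ x, |g x| ∂μ := by
  rw [← integral_const_mul]
  refine norm_integral_le_of_norm_le (hg.abs.const_mul _) (Eventually.of_forall fun x => ?_)
  rw [norm_mul, norm_mul, Complex.norm_real, Complex.norm_real, Real.norm_eq_abs, Real.norm_eq_abs,
    abs_of_nonneg (chi_nonneg _ _ _ _ _), mul_comm]
  refine mul_le_mul_of_nonneg_right ?_ (abs_nonneg _)
  exact (mul_le_of_le_one_left (norm_nonneg _) (chi_le_one _ _ _ _ _)).trans (SP_bound' hK c n _)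

lemma int_chic {μ : Measure X} [IsProbabilityMeasure μ] {T : X → X}
    (hT : MeasurePreserving T μ μ) {φ : X → ℝ} (hφ : Measurable φ) {K : ℝ} (hK : ∀ x, |φ x| ≤ K)
    (c : ℝ) {g : X → ℝ} (hg : Integrable g μ) (n : ℕ) :
    Integrable (fun x => g x * (1 - chi T φ c n x)) μ := by
  have hm2 := chi_measurable hT.measurable hφ c n
  refine hg.mul_bdd (c := 1) (by fun_prop) (Eventually.of_forall fun x => ?_)
  have h1 := chi_nonneg T φ c n x
  have h2 := chi_le_one T φ c n x
  rw [Real.norm_eq_abs, abs_le]; constructor <;> linarith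

lemma int_chicT {μ : Measure X} [IsProbabilityMeasure μ] {T : X → X}
    (hT : MeasurePreserving T μ μ) {φ : X → ℝ} (hφ : Measurable φ) {K : ℝ} (hK : ∀ x, |φ x| ≤ K)
    (c : ℝ) {g : X → ℝ} (hg : Integrable g μ) (n : ℕ) :
    Integrable (fun x => g x * (1 - chi T φ c n (T x))) μ := by
  have hm2 : Measurable fun x => chi T φ c n (T x) :=
    (chi_measurable hT.measurable hφ c n).comp hT.measurable
  refine hg.mul_bdd (c := 1) (measurable_const.sub hm2).aestronglyMeasurable (Eventually.of_forall fun x => ?_)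
  have h1 := chi_nonneg T φ c n (T x)
  have h2 := chi_le_one T φ c n (T x)
  rw [Real.norm_eq_abs, abs_le]; constructor <;> linarith

lemma b_step {μ : Measure X} [IsProbabilityMeasure μ] {T : X → X}
    (hT : MeasurePreserving T μ μ) {φ : X → ℝ} (hφ : Measurable φ) {K : ℝ} (hK : ∀ x, |φ x| ≤ K)
    (c : ℝ) {g : X → ℝ} (hgm : Measurable g) (hg : Integrable g μ) (n : ℕ) :
    ∫ x, birkhoffSum T (fun y => |g y|) n x * (1 - chi T φ c n x) ∂μ
      + ∫ x, |g x| * (1 - chi T φ c n (T x)) ∂μ ≤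
    ∫ x, birkhoffSum T (fun y => |g y|) (n + 1) x * (1 - chi T φ c (n + 1) x) ∂μ := by
  have hB := integrable_birkhoffSum hT hg.abs n
  have hBm := measurable_birkhoffSum hT.measurable (hgm.abs) n
  have hm2 := chi_measurable hT.measurable hφ c n
  have hBT : Integrable (fun x => birkhoffSum T (fun y => |g y|) n (T x)) μ :=
    hT.integrable_comp_of_integrable hB
  rw [← integral_comp_pres hT (g := fun x => birkhoffSum T (fun y => |g y|) n x * (1 - chi T φ c n x))
    (by fun_prop), ← integral_add (int_chicT hT hφ hK c hBT n) (int_chicT hT hφ hK c hg.abs n)]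
  refine integral_mono ((int_chicT hT hφ hK c hBT n).add (int_chicT hT hφ hK c hg.abs n))
    (int_chic hT hφ hK c (integrable_birkhoffSum hT hg.abs (n+1)) (n+1)) fun x => ?_
  simp only [Pi.add_apply]
  rw [birkhoffSum_succ']
  have h1 := chi_succ_le T φ c n x
  have h0 : 0 ≤ birkhoffSum T (fun y => |g y|) n (T x) := Finset.sum_nonneg fun k _ => abs_nonneg _
  have h2 := abs_nonneg (g x)
  nlinarith

lemma key_ineq {μ : Measure X} [IsProbabilityMeasure μ] {T : X → X}
    (hT : MeasurePreserving T μ μ) {φ : X → ℝ} (hφ : Measurable φ) {K : ℝ} (hK : ∀ x, |φ x| ≤ K)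
    (hmd : MD μ T φ) (c : ℝ) {h : X → ℝ} (hhm : Measurable h) (hh : Integrable h μ) (hhmd : MD μ T h)
    (hc : 0 ≤ c) (n : ℕ) :
    ‖∫ x, ((birkhoffSum T h n x : ℝ) : ℂ) * SP T φ c n x ∂μ
      - Complex.I * c * ∫ x, ((birkhoffSum T (fun y => h y * φ y) n x : ℝ) : ℂ) * SP T φ c n x ∂μ‖
    ≤ c * Real.exp ((1 + c ^ 2 * K ^ 2) / 2) * (n * (c * K * ∫ x, |h x * φ x| ∂μ)
      + ∫ x, birkhoffSum T (fun y => |h y * φ y|) n x * (1 - chi T φ c n x) ∂μ) := by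
  set A := Real.exp ((1 + c ^ 2 * K ^ 2) / 2) with hA
  induction n with
  | zero => simp
  | succ n ih =>
    set ψ : X → ℝ := fun y => h y * φ y with hψ
    have hψm : Measurable ψ := by fun_prop
    have hψi : Integrable ψ μ :=
      hh.mul_bdd (c := K) hφ.aestronglyMeasurable (Eventually.of_forall hK)
    have hψφ : Integrable (fun x => ψ x * φ x) μ :=
      hψi.mul_bdd (c := K) hφ.aestronglyMeasurable (Eventually.of_forall hK)
    have s1 := SP_step hT hφ hK hmd c hhm hh n
    have s2 := SP_step hT hφ hK hmd c hψm hψi n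
    have s3 := b_step hT hφ hK c hψm hψi n
    have z : ∫ x, (h x : ℂ) * SP T φ c n (T x) ∂μ = 0 :=
      hhmd (SP T φ c n) (SP_measurable hT.measurable hφ c n) (int_mul_SPT hT hφ hK c hh n)
    rw [z, add_zero] at s1
    rw [s1, s2]
    have r1 := norm_int_chi_le hT hφ hK c hψφ n
    have r1' : ∫ x, |ψ x * φ x| ∂μ ≤ K * ∫ x, |ψ x| ∂μ := by
      rw [← integral_const_mul]
      refine integral_mono hψφ.abs (hψi.abs.const_mul _) fun x => ?_
      simp only [abs_mul (ψ x), mul_comm K]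
      exact mul_le_mul_of_nonneg_left (hK x) (abs_nonneg _)
    have k1 := int_mul_chiSPT hT hφ hK c hψi n
    have k2 := int_mul_SPT hT hφ hK c hψi n
    have r2 : ‖∫ x, (ψ x : ℂ) * ((chi T φ c n (T x) : ℂ) * SP T φ c n (T x)) ∂μ
        - ∫ x, (ψ x : ℂ) * SP T φ c n (T x) ∂μ‖ ≤ A * ∫ x, |ψ x| * (1 - chi T φ c n (T x)) ∂μ := by
      rw [← integral_sub k1 k2, ← integral_const_mul]
      refine norm_integral_le_of_norm_le ((int_chicT hT hφ hK c hψi.abs n).const_mul _)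
        (Eventually.of_forall fun x => ?_)
      have e : (ψ x : ℂ) * ((chi T φ c n (T x) : ℂ) * SP T φ c n (T x)) - (ψ x : ℂ) * SP T φ c n (T x)
        = ((ψ x * (chi T φ c n (T x) - 1) : ℝ) : ℂ) * SP T φ c n (T x) := by push_cast; ring
      have e2 : |chi T φ c n (T x) - 1| = 1 - chi T φ c n (T x) := by
        rw [abs_sub_comm, abs_of_nonneg]; linarith [chi_le_one T φ c n (T x)]
      rw [e, norm_mul, Complex.norm_real, Real.norm_eq_abs, abs_mul, e2, mul_comm A]
      refine mul_le_mul_of_nonneg_left (SP_bound' hK c n _) ?_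
      exact mul_nonneg (abs_nonneg _) (by linarith [chi_le_one T φ c n (T x)])
    change ‖(_ + Complex.I * c * ∫ x, ((ψ x : ℝ) : ℂ) * ((chi T φ c n (T x) : ℂ) * SP T φ c n (T x)) ∂μ) - _‖ ≤ _
    set e0 := ∫ x, ((birkhoffSum T h n x : ℝ) : ℂ) * SP T φ c n x ∂μ
    set a0 := ∫ x, ((birkhoffSum T ψ n x : ℝ) : ℂ) * SP T φ c n x ∂μ
    set p1 := ∫ x, (ψ x : ℂ) * ((chi T φ c n (T x) : ℂ) * SP T φ c n (T x)) ∂μ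
    set p2 := ∫ x, (ψ x : ℂ) * SP T φ c n (T x) ∂μ
    set p3 := ∫ x, ((ψ x * φ x : ℝ) : ℂ) * ((chi T φ c n (T x) : ℂ) * SP T φ c n (T x)) ∂μ
    have e : e0 + Complex.I * c * p1 - Complex.I * c * (a0 + p2 + Complex.I * c * p3)
      = (e0 - Complex.I * c * a0) + (Complex.I * c * (p1 - p2) - Complex.I * c * (Complex.I * c * p3)) := by
      ring
    rw [e]
    refine (norm_add_le _ _).trans ?_
    refine (add_le_add ih (norm_sub_le _ _)).trans ?_
    simp only [norm_mul, Complex.norm_I, one_mul, Complex.norm_real, Real.norm_eq_abs, abs_of_nonneg hc]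
    have hA0 : 0 < A := Real.exp_pos _
    have q1 : c * ‖p1 - p2‖ ≤ c * (A * ∫ x, |ψ x| * (1 - chi T φ c n (T x)) ∂μ) :=
      mul_le_mul_of_nonneg_left r2 hc
    have q2 : c * (c * ‖p3‖) ≤ c * (c * (A * (K * ∫ x, |ψ x| ∂μ))) :=
      mul_le_mul_of_nonneg_left (mul_le_mul_of_nonneg_left
        (r1.trans (mul_le_mul_of_nonneg_left r1' hA0.le)) hc) hc
    have q3 := mul_le_mul_of_nonneg_left s3 (mul_nonneg hc hA0.le)
    push_cast
    change _ ≤ c * A * ((n + 1) * (c * K * ∫ x, |ψ x| ∂μ) + _)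
    change c * A * (n * (c * K * ∫ x, |ψ x| ∂μ) + _) + _ ≤ _
    linarith

end main

end Part4

section Part5
variable {X : Type} [MeasurableSpace X]

lemma dual_bound {μ : Measure X} [IsProbabilityMeasure μ] {T : X → X}
    (herg : Ergodic T μ) {φ : X → ℝ} (hφ : Measurable φ) {K : ℝ} (hK : ∀ x, |φ x| ≤ K)
    (hmd : MD μ T φ) (hs1 : ∫ x, φ x ^ 2 ∂μ < 1)
    {h : X → ℝ} (hhm : Measurable h) (hh : Integrable h μ) (hhmd : MD μ T h)
    {B : ℝ} (hB : ∀ n : ℕ, ∫ x, |birkhoffSum T h n x| ∂μ ≤ B * Real.sqrt n) :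
    |∫ x, h x * φ x ∂μ| ≤ Real.exp 1 * B := by
  have hT := herg.toMeasurePreserving
  have hK0 : 0 ≤ K := by
    obtain ⟨x⟩ := nonempty_of_isProbabilityMeasure μ
    exact (abs_nonneg _).trans (hK x)
  set ψ : X → ℝ := fun y => h y * φ y with hψ
  have hψm : Measurable ψ := by fun_prop
  have hψi : Integrable ψ μ :=
    hh.mul_bdd (c := K) hφ.aestronglyMeasurable (Eventually.of_forall hK)
  have hφ2i : Integrable (fun x => φ x ^ 2) μ :=
    Integrable.of_bound (by fun_prop) (K ^ 2) (Eventually.of_forall fun x => by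
      rw [Real.norm_eq_abs, abs_pow]; exact pow_le_pow_left₀ (abs_nonneg _) (hK x) 2)
  have t1 := ergodic_L1 herg hψi
  have t2 := ergodic_L1 herg hψi.abs
  have t3 := ergodic_L1 herg hφ2i
  set s := ∫ x, φ x ^ 2 ∂μ with hs
  set p := ∫ x, |ψ x| ∂μ with hp
  set q := ∫ x, ψ x ∂μ with hq
  have hp0 : 0 ≤ p := integral_nonneg fun x => abs_nonneg _
  have hB0 : 0 ≤ B := by
    have := hB 1
    simp only [Nat.cast_one, Real.sqrt_one, mul_one] at this
    exact le_trans (integral_nonneg fun x => abs_nonneg _) this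
  set δ1 := fun n : ℕ => ∫ x, |birkhoffSum T ψ n x / n - q| ∂μ with hδ1
  set δ2 := fun n : ℕ => ∫ x, |birkhoffSum T (fun x => |ψ x|) n x / n - p| ∂μ with hδ2
  set δ3 := fun n : ℕ => ∫ x, |birkhoffSum T (fun x => φ x ^ 2) n x / n - s| ∂μ with hδ3
  have tc : Tendsto (fun n : ℕ => 1 / Real.sqrt n) atTop (𝓝 0) :=
    Tendsto.div_atTop tendsto_const_nhds
        (Real.tendsto_sqrt_atTop.comp tendsto_natCast_atTop_atTop)
  have hlim : Tendsto (fun n : ℕ => Real.exp 1 * δ1 n + Real.exp 1 * B +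
      Real.exp 1 * (1 / Real.sqrt n * K * p + (δ2 n + p * ((1 - s)⁻¹ * δ3 n)))) atTop
      (𝓝 (Real.exp 1 * 0 + Real.exp 1 * B + Real.exp 1 * (0 * K * p + (0 + p * ((1 - s)⁻¹ * 0))))) :=
    ((t1.const_mul _).add tendsto_const_nhds).add
      ((((tc.mul_const K).mul_const p).add (t2.add ((t3.const_mul _).const_mul _))).const_mul _)
  have e0 : Real.exp 1 * 0 + Real.exp 1 * B + Real.exp 1 * (0 * K * p + (0 + p * ((1 - s)⁻¹ * 0)))
    = Real.exp 1 * B := by ring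
  rw [e0] at hlim
  refine ge_of_tendsto hlim ?_
  have hev : ∀ᶠ n : ℕ in atTop, K ^ 2 ≤ (n : ℝ) :=
    tendsto_natCast_atTop_atTop.eventually_ge_atTop _
  filter_upwards [hev, eventually_gt_atTop 0] with n hn hn0
  have hnR : (0 : ℝ) < n := by exact_mod_cast hn0
  have hsq : 0 < Real.sqrt n := Real.sqrt_pos.2 hnR
  have hsq2 : Real.sqrt n ^ 2 = n := Real.sq_sqrt hnR.le
  set c := 1 / Real.sqrt n with hc
  have hc0 : 0 < c := by positivity
  have hc2 : c ^ 2 = 1 / n := by rw [hc, div_pow, hsq2, one_pow]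
  have hcs : c * Real.sqrt n = 1 := by rw [hc]; field_simp
  set A := Real.exp ((1 + c ^ 2 * K ^ 2) / 2) with hA
  have hAe : A ≤ Real.exp 1 := by
    refine Real.exp_le_exp.2 ?_
    have : c ^ 2 * K ^ 2 ≤ 1 := by
      rw [hc2, div_mul_eq_mul_div, one_mul, div_le_one hnR]; exact hn
    linarith
  have hA0 : 0 < A := Real.exp_pos _
  have key := key_ineq hT hφ hK hmd c hhm hh hhmd hc0.le n
  have hBi := integrable_birkhoffSum hT hh n
  have hΨi := integrable_birkhoffSum hT hψi n
  have hΨm := measurable_birkhoffSum hT.measurable hψm n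
  have hSm := SP_measurable hT.measurable hφ c n
  set e1 := ∫ x, ((birkhoffSum T h n x : ℝ) : ℂ) * SP T φ c n x ∂μ with he1
  set a1 := ∫ x, ((birkhoffSum T ψ n x : ℝ) : ℂ) * SP T φ c n x ∂μ with ha1
  set b1 := ∫ x, birkhoffSum T (fun y => |ψ y|) n x * (1 - chi T φ c n x) ∂μ with hb1
  have he : ‖e1‖ ≤ A * (B * Real.sqrt n) := by
    refine le_trans ?_ (mul_le_mul_of_nonneg_left (hB n) hA0.le)
    rw [← integral_const_mul]
    refine norm_integral_le_of_norm_le (hBi.abs.const_mul _) (Eventually.of_forall fun x => ?_)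
    rw [norm_mul, Complex.norm_real, Real.norm_eq_abs, mul_comm]
    exact mul_le_mul_of_nonneg_right (SP_bound' hK c n x) (abs_nonneg _)
  have ha : ‖a1 / n - q‖ ≤ A * δ1 n := by
    have e : a1 / n - q = ∫ x, ((birkhoffSum T ψ n x / n - q : ℝ) : ℂ) * SP T φ c n x ∂μ := by
      have i1 := (int_mul_SP hT hφ hK c hΨi n).div_const (n : ℂ)
      have i2 := (int_mul_SP hT hφ hK c (integrable_const q) n)
      have : ∀ x, ((birkhoffSum T ψ n x / n - q : ℝ) : ℂ) * SP T φ c n x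
        = ((birkhoffSum T ψ n x : ℝ) : ℂ) * SP T φ c n x / n - (q : ℂ) * SP T φ c n x := by
        intro x; push_cast; ring
      simp_rw [this]
      rw [integral_sub i1 i2, integral_div, integral_const_mul, SP_integral hT hφ hK hmd, mul_one]
    rw [e, hδ1]
    simp only
    clear_value q
    rw [← integral_const_mul]
    refine norm_integral_le_of_norm_le (((hΨi.div_const _).sub (integrable_const _)).abs.const_mul _)
      (Eventually.of_forall fun x => ?_)
    rw [norm_mul, Complex.norm_real, Real.norm_eq_abs, mul_comm]
    exact mul_le_mul_of_nonneg_right (SP_bound' hK c n x) (abs_nonneg _)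
  have hb : b1 / n ≤ δ2 n + p * ((1 - s)⁻¹ * δ3 n) := by
    have hs' : 0 < 1 - s := by linarith
    have j1 : Integrable (fun x => birkhoffSum T (fun y => |ψ y|) n x / n - p) μ :=
      ((integrable_birkhoffSum hT hψi.abs n).div_const (n : ℝ)).sub (integrable_const p)
    have j2 : Integrable (fun x => birkhoffSum T (fun y => φ y ^ 2) n x / n - s) μ :=
      ((integrable_birkhoffSum hT hφ2i n).div_const (n : ℝ)).sub (integrable_const s)
    have j3 := int_chic hT hφ hK c (integrable_birkhoffSum hT hψi.abs n) n
    rw [hb1, hδ2, hδ3]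
    simp only
    clear_value p s
    rw [← integral_div, ← integral_const_mul (1 - s)⁻¹, ← integral_const_mul p,
      ← integral_add j1.abs ((j2.abs.const_mul _).const_mul _)]
    refine integral_mono (j3.div_const _) (j1.abs.add ((j2.abs.const_mul _).const_mul _)) fun x => ?_
    simp only [Pi.add_apply, Pi.sub_apply]
    set u := birkhoffSum T (fun y => |ψ y|) n x with hu
    set v := birkhoffSum T (fun y => φ y ^ 2) n x with hv
    have hχ : 1 - chi T φ c n x ≤ (1 - s)⁻¹ * |v / n - s| := by
      unfold chi
      split_ifs with hi
      · rw [sub_self]; positivity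
      · rw [sub_zero, ← div_eq_inv_mul, one_le_div hs']
        refine le_trans ?_ (le_abs_self _)
        rw [hc2, div_mul_eq_mul_div, one_mul, not_le] at hi
        linarith
    have h1 := chi_nonneg T φ c n x
    have h2 := chi_le_one T φ c n x
    have h3 : u * (1 - chi T φ c n x) / n = (u / n - p) * (1 - chi T φ c n x) + p * (1 - chi T φ c n x) := by
      ring
    rw [h3]
    refine add_le_add ?_ (mul_le_mul_of_nonneg_left hχ hp0)
    calc _ ≤ |u / n - p| * (1 - chi T φ c n x) :=
          mul_le_mul_of_nonneg_right (le_abs_self _) (by linarith)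
      _ ≤ _ := mul_le_of_le_one_right (abs_nonneg _) (by linarith)
  have hca : c * ‖a1‖ ≤ A * (B * Real.sqrt n) + c * A * (n * (c * K * p) + b1) := by
    have e : Complex.I * c * a1 = e1 - (e1 - Complex.I * c * a1) := by ring
    have h1 : ‖Complex.I * c * a1‖ ≤ A * (B * Real.sqrt n) + c * A * (n * (c * K * p) + b1) := by
      rw [e]; exact (norm_sub_le _ _).trans (add_le_add he key)
    simpa only [norm_mul, Complex.norm_I, one_mul, Complex.norm_real, Real.norm_eq_abs,
      abs_of_pos hc0] using h1
  have hna : ‖a1‖ / n ≤ A * B + A * (c * K * p + b1 / n) := by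
    have h1 := mul_le_mul_of_nonneg_left hca hc0.le
    have e1 : c * (c * ‖a1‖) = ‖a1‖ / n := by
      rw [← mul_assoc, ← pow_two, hc2]; ring
    have e2 : c * (A * (B * Real.sqrt n) + c * A * (n * (c * K * p) + b1))
      = A * B * (c * Real.sqrt n) + A * (c ^ 2 * n * (c * K * p) + c ^ 2 * b1) := by ring
    rw [e1, e2, hcs, hc2] at h1
    refine h1.trans (le_of_eq ?_)
    field_simp
  have hqn : |q| ≤ ‖a1 / n - q‖ + ‖a1‖ / n := by
    have : ((q : ℝ) : ℂ) = a1 / n - (a1 / n - q) := by ring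
    have h1 : |q| = ‖((q : ℝ) : ℂ)‖ := by rw [Complex.norm_real, Real.norm_eq_abs]
    rw [h1]
    nth_rewrite 1 [this]
    refine (norm_sub_le _ _).trans ?_
    rw [norm_div, Complex.norm_natCast, add_comm]
  have hδ10 : 0 ≤ δ1 n := integral_nonneg fun x => abs_nonneg _
  have hδ20 : 0 ≤ δ2 n := integral_nonneg fun x => abs_nonneg _
  have hδ30 : 0 ≤ δ3 n := integral_nonneg fun x => abs_nonneg _
  have hs' : 0 < 1 - s := by linarith
  have w1 : A * δ1 n ≤ Real.exp 1 * δ1 n := mul_le_mul_of_nonneg_right hAe hδ10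
  have w2 : A * B ≤ Real.exp 1 * B := mul_le_mul_of_nonneg_right hAe hB0
  have w3 : A * (c * K * p + b1 / n) ≤ Real.exp 1 * (c * K * p + (δ2 n + p * ((1 - s)⁻¹ * δ3 n))) := by
    refine (mul_le_mul_of_nonneg_left (add_le_add le_rfl hb) hA0.le).trans ?_
    exact mul_le_mul_of_nonneg_right hAe (by positivity)
  linarith

lemma MD.real {μ : Measure X} {T : X → X} {h : X → ℝ} (hmd : MD μ T h) {H : X → ℝ}
    (hH : Measurable H) (hi : Integrable (fun x => h x * H (T x)) μ) :
    ∫ x, h x * H (T x) ∂μ = 0 := by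
  have := hmd (fun y => (H y : ℂ)) (by fun_prop) (by simpa using hi.ofReal (𝕜 := ℂ))
  have e : ∀ x, (h x : ℂ) * (H (T x) : ℂ) = ((h x * H (T x) : ℝ) : ℂ) := by intro x; push_cast; ring
  simp only [e] at this
  rw [integral_complex_ofReal] at this
  exact_mod_cast this

lemma exists_proj {μ : Measure X} [IsProbabilityMeasure μ] {T : X → X} (hT : MeasurePreserving T μ μ)
    {b : X → ℝ} (hb : Measurable b) {M : ℝ} (hM0 : 0 ≤ M) (hM : ∀ x, |b x| ≤ M) :
    ∃ G : X → ℝ, Measurable G ∧ (∀ x, |G x| ≤ M) ∧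
      μ[fun x => b x - G (T x) | MeasurableSpace.comap T inferInstance] =ᵐ[μ] 0 := by
  have hle : MeasurableSpace.comap T inferInstance ≤ (inferInstance : MeasurableSpace X) := hT.measurable.comap_le
  have hbi : Integrable b μ := Integrable.of_bound hb.aestronglyMeasurable M (Eventually.of_forall hM)
  have hsm : StronglyMeasurable[MeasurableSpace.comap T inferInstance] (μ[b | MeasurableSpace.comap T inferInstance]) := stronglyMeasurable_condExp
  obtain ⟨H, hH, hHe⟩ := hsm.measurable.exists_eq_measurable_comp
  have hbd : ∀ᵐ x ∂μ, |μ[b | MeasurableSpace.comap T inferInstance] x| ≤ M := by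
    have := ae_bdd_abs_condExp_of_ae_bdd_abs (m := MeasurableSpace.comap T inferInstance) (μ := μ) (R := M) (f := b) (Eventually.of_forall hM)
    exact this
  refine ⟨fun y => max (-M) (min (H y) M), by fun_prop, fun y => ?_, ?_⟩
  · rw [abs_le]
    exact ⟨le_max_left _ _, max_le (by linarith) (min_le_right _ _)⟩
  · have hG : (fun x => b x - max (-M) (min (H (T x)) M)) =ᵐ[μ] b - μ[b | MeasurableSpace.comap T inferInstance] := by
      filter_upwards [hbd] with x hx
      rw [hHe] at hx ⊢
      simp only [Function.comp_apply, Pi.sub_apply] at hx ⊢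
      rw [abs_le] at hx
      rw [min_eq_left hx.2, max_eq_right hx.1]
    refine (condExp_congr_ae hG).trans ?_
    refine (condExp_sub hbi integrable_condExp _).trans ?_
    rw [condExp_of_stronglyMeasurable hle hsm integrable_condExp, sub_self]

/-- contraction by orthogonality. -/
lemma proj_contr {μ : Measure X} [IsProbabilityMeasure μ] {T : X → X} {a G : X → ℝ}
    (ha : MemLp a 2 μ) (hGm : Measurable G) (hG : MemLp (fun x => G (T x)) 2 μ)
    (hmd : MD μ T (fun x => a x - G (T x))) :
    ∫ x, (a x - G (T x)) ^ 2 ∂μ ≤ ∫ x, a x ^ 2 ∂μ := by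
  have hr : MemLp (fun x => a x - G (T x)) 2 μ := ha.sub hG
  have i1 : Integrable (fun x => (a x - G (T x)) * G (T x)) μ := hr.integrable_mul hG
  have z := hmd.real hGm i1
  have i2 := hr.integrable_sq
  have i3 := ha.integrable_sq
  have h1 : ∫ x, ((a x - G (T x)) ^ 2 + 2 * ((a x - G (T x)) * G (T x))) ∂μ ≤ ∫ x, a x ^ 2 ∂μ := by
    refine integral_mono (i2.add (i1.const_mul 2)) i3 fun x => ?_
    simp only
    nlinarith [sq_nonneg (G (T x))]
  rw [integral_add i2 (i1.const_mul 2), integral_const_mul, z] at h1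
  linarith

/-- truncation -/
def trunc (h : X → ℝ) (M : ℝ) (x : X) : ℝ := if |h x| ≤ M then h x else 0

lemma trunc_measurable {h : X → ℝ} (hh : Measurable h) (M : ℝ) : Measurable (trunc h M) :=
  Measurable.ite (measurableSet_le hh.abs measurable_const) hh measurable_const

lemma trunc_le {h : X → ℝ} {M : ℝ} (hM : 0 ≤ M) (x : X) : |trunc h M x| ≤ M := by
  unfold trunc; split_ifs with hi
  · exact hi
  · simpa using hM

lemma mul_trunc {h : X → ℝ} {M : ℝ} (x : X) : h x * trunc h M x = trunc h M x ^ 2 := by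
  unfold trunc; split_ifs with hi
  · ring
  · simp

lemma memLp_bdd {μ : Measure X} [IsProbabilityMeasure μ] {b : X → ℝ} (hb : Measurable b) {M : ℝ}
    (hM : ∀ x, |b x| ≤ M) (p : ℝ≥0∞) : MemLp b p μ :=
  MemLp.of_bound hb.aestronglyMeasurable M (Eventually.of_forall hM)

lemma md_memL2 {μ : Measure X} [IsProbabilityMeasure μ] {T : X → X}
    (herg : Ergodic T μ) {h : X → ℝ} (hhm : Measurable h) (hh : Integrable h μ)
    (hc : μ[h | MeasurableSpace.comap T inferInstance] =ᵐ[μ] 0)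
    {B : ℝ} (hB : ∀ n : ℕ, ∫ x, |birkhoffSum T h n x| ∂μ ≤ B * Real.sqrt n) : MemLp h 2 μ := by
  have hT := herg.toMeasurePreserving
  have hhmd := md_of_condExp hT.measurable hh hc
  have hB0 : 0 ≤ B := by
    have := hB 1
    simp only [Nat.cast_one, Real.sqrt_one, mul_one] at this
    exact le_trans (integral_nonneg fun x => abs_nonneg _) this
  have main : ∀ M : ℕ, ∫ x, trunc h M x ^ 2 ∂μ ≤ (2 * (Real.exp 1 * B)) ^ 2 := by
    intro M
    have hM0 : (0 : ℝ) ≤ M := Nat.cast_nonneg M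
    have hbm := trunc_measurable hhm (M : ℝ)
    have hbM := fun x => trunc_le (h := h) hM0 x
    obtain ⟨G, hGm, hGM, hGc⟩ := exists_proj hT hbm hM0 hbM
    have hGTm : Measurable (fun x => G (T x)) := hGm.comp hT.measurable
    set b := trunc h (M : ℝ) with hb
    have hφm : Measurable (fun x => b x - G (T x)) := hbm.sub hGTm
    have hφK : ∀ x, |b x - G (T x)| ≤ 2 * M := fun x => by
      have h1 := abs_sub (b x) (G (T x))
      have h2 := hbM x
      have h3 := hGM (T x)
      linarith
    have hφi : Integrable (fun x => b x - G (T x)) μ :=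
      Integrable.of_bound hφm.aestronglyMeasurable _ (Eventually.of_forall hφK)
    have hφmd := md_of_condExp hT.measurable hφi hGc
    have hctr := proj_contr (memLp_bdd hbm hbM 2) hGm (memLp_bdd hGTm (fun x => hGM (T x)) 2) hφmd
    set V := ∫ x, b x ^ 2 ∂μ with hV
    have hV0 : 0 ≤ V := integral_nonneg fun x => sq_nonneg _
    rcases hV0.eq_or_lt with h0 | hpos
    · rw [← h0]; positivity
    set s := Real.sqrt V with hs
    have hs0 : 0 < s := Real.sqrt_pos.2 hpos
    have hs2 : s ^ 2 = V := Real.sq_sqrt hV0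
    set a := 1 / (2 * s) with ha
    have ha0 : 0 < a := by positivity
    have hmd' : MD μ T (fun x => a * (b x - G (T x))) := by
      intro H hH hi
      have := hφmd (fun y => (a : ℂ) * H y) (by fun_prop) (by
        refine hi.congr (Eventually.of_forall fun x => ?_)
        simp only; push_cast; ring)
      rw [← this]
      refine integral_congr_ae (Eventually.of_forall fun x => ?_)
      simp only; push_cast; ring
    have hb1 := dual_bound herg (φ := fun x => a * (b x - G (T x))) (by fun_prop) (K := a * (2 * M))
      (fun x => by rw [abs_mul, abs_of_pos ha0]; exact mul_le_mul_of_nonneg_left (hφK x) ha0.le)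
      hmd' (by
        have : ∀ x, (a * (b x - G (T x))) ^ 2 = a ^ 2 * (b x - G (T x)) ^ 2 := fun x => by ring
        simp_rw [this]
        rw [integral_const_mul]
        have h1 := mul_le_mul_of_nonneg_left hctr (sq_nonneg a)
        have h2 : a ^ 2 * V = 1 / 4 := by
          rw [ha, ← hs2]; field_simp; norm_num
        linarith) hhm hh hhmd hB
    have e : ∫ x, h x * (a * (b x - G (T x))) ∂μ = a * V := by
      have i1 : Integrable (fun x => b x ^ 2) μ := (memLp_bdd hbm hbM 2).integrable_sq
      have i2 : Integrable (fun x => h x * G (T x)) μ :=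
        hh.mul_bdd (c := M) hGTm.aestronglyMeasurable (Eventually.of_forall fun x => hGM (T x))
      have z := hhmd.real hGm i2
      have : ∀ x, h x * (a * (b x - G (T x))) = a * (b x ^ 2 - h x * G (T x)) := by
        intro x
        have := mul_trunc (h := h) (M := (M : ℝ)) x
        rw [← hb] at this
        rw [← this]; ring
      simp_rw [this]
      rw [integral_const_mul, integral_sub i1 i2, z, sub_zero]
    rw [e, abs_of_nonneg (by positivity)] at hb1
    have e2 : a * V = s / 2 := by rw [ha, ← hs2]; field_simp
    rw [e2] at hb1
    rw [← hs2]
    exact pow_le_pow_left₀ hs0.le (by linarith) 2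
  rw [memLp_two_iff_integrable_sq hhm.aestronglyMeasurable]
  refine ⟨by fun_prop, ?_⟩
  rw [hasFiniteIntegral_iff_ofReal (Eventually.of_forall fun x => sq_nonneg _)]
  have hfat := lintegral_liminf_le (μ := μ) (u := atTop) (f := fun M : ℕ => fun x => ENNReal.ofReal (trunc h M x ^ 2))
    (fun M => by have := trunc_measurable hhm (M : ℝ); fun_prop)
  have hle : ∫⁻ x, ENNReal.ofReal (h x ^ 2) ∂μ ≤ ENNReal.ofReal ((2 * (Real.exp 1 * B)) ^ 2) := by
    calc _ = ∫⁻ x, liminf (fun M : ℕ => ENNReal.ofReal (trunc h M x ^ 2)) atTop ∂μ := by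
          refine lintegral_congr fun x => ?_
          refine (Tendsto.liminf_eq ?_).symm
          refine tendsto_const_nhds.congr' ?_
          filter_upwards [tendsto_natCast_atTop_atTop.eventually_ge_atTop (|h x|)] with M hM
          unfold trunc; rw [if_pos hM]
      _ ≤ _ := hfat
      _ ≤ _ := by
          refine liminf_le_of_le ?_ ?_
          · isBoundedDefault
          · intro a ha
            obtain ⟨M, hM⟩ := ha.exists
            refine hM.trans ?_
            have hbm := trunc_measurable hhm (M : ℝ)
            have hbM := fun x => trunc_le (h := h) (M := (M : ℝ)) (Nat.cast_nonneg M) x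
            rw [← ofReal_integral_eq_lintegral_ofReal (memLp_bdd hbm hbM 2).integrable_sq
              (Eventually.of_forall fun x => sq_nonneg _)]
            exact ENNReal.ofReal_le_ofReal (main M)
  exact hle.trans_lt ENNReal.ofReal_lt_top

end Part5

section Part6
variable {X : Type} [MeasurableSpace X]

lemma memLp_birkhoffSum {μ : Measure X} {T : X → X} (hT : MeasurePreserving T μ μ)
    {r : X → ℝ} {p : ℝ≥0∞} (hr : MemLp r p μ) (n : ℕ) : MemLp (birkhoffSum T r n) p μ := by
  have : birkhoffSum T r n = fun x => ∑ k ∈ Finset.range n, (r ∘ T^[k]) x := by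
    funext x; simp [birkhoffSum]
  rw [this]
  exact memLp_finsetSum _ fun k _ => hr.comp_measurePreserving (hT.iterate k)

lemma sq_birkhoffSum {μ : Measure X} [IsProbabilityMeasure μ] {T : X → X}
    (hT : MeasurePreserving T μ μ) {r : X → ℝ} (hrm : Measurable r) (hr : MemLp r 2 μ)
    (hmd : MD μ T r) (n : ℕ) :
    ∫ x, birkhoffSum T r n x ^ 2 ∂μ = n * ∫ x, r x ^ 2 ∂μ := by
  induction n with
  | zero => simp
  | succ n ih =>
    have hS := memLp_birkhoffSum hT hr n
    have hSm := measurable_birkhoffSum hT.measurable hrm n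
    have hST : MemLp (fun x => birkhoffSum T r n (T x)) 2 μ := hS.comp_measurePreserving hT
    have i1 : Integrable (fun x => r x * birkhoffSum T r n (T x)) μ := hr.integrable_mul hST
    have z := hmd.real hSm i1
    have e : ∀ x, birkhoffSum T r (n + 1) x ^ 2 = r x ^ 2 + 2 * (r x * birkhoffSum T r n (T x))
        + birkhoffSum T r n (T x) ^ 2 := by
      intro x; rw [birkhoffSum_succ']; ring
    simp_rw [e]
    have i12 : Integrable (fun x => r x ^ 2 + 2 * (r x * birkhoffSum T r n (T x))) μ :=
      hr.integrable_sq.add (i1.const_mul 2)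
    rw [integral_add i12 hST.integrable_sq,
      integral_add hr.integrable_sq (i1.const_mul 2), integral_const_mul, z,
      integral_comp_pres hT (g := fun x => birkhoffSum T r n x ^ 2) (by fun_prop), ih]
    push_cast; ring

lemma cexp_lip (a b : ℝ) : ‖Complex.exp (Complex.I * (a : ℂ)) - Complex.exp (Complex.I * (b : ℂ))‖
    ≤ |a - b| := by
  have h := Real.norm_exp_I_mul_ofReal_sub_one_le (x := a - b)
  have e : Complex.exp (Complex.I * (a : ℂ)) - Complex.exp (Complex.I * (b : ℂ))
    = Complex.exp (Complex.I * (b : ℂ)) * (Complex.exp (Complex.I * ((a - b : ℝ) : ℂ)) - 1) := by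
    rw [mul_sub, ← Complex.exp_add]; push_cast; ring_nf
  rw [e, norm_mul, mul_comm Complex.I, Complex.norm_exp_ofReal_mul_I, one_mul]
  exact h

lemma approx_L2 {μ : Measure X} [IsProbabilityMeasure μ] {T : X → X}
    (hT : MeasurePreserving T μ μ) {h : X → ℝ} (hhm : Measurable h) (hh : MemLp h 2 μ)
    (hc : μ[h | MeasurableSpace.comap T inferInstance] =ᵐ[μ] 0) {δ : ℝ} (hδ : 0 < δ) :
    ∃ φ : X → ℝ, Measurable φ ∧ (∃ K, ∀ x, |φ x| ≤ K) ∧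
      μ[φ | MeasurableSpace.comap T inferInstance] =ᵐ[μ] 0 ∧
      ∫ x, (h x - φ x) ^ 2 ∂μ < δ := by
  have hhi : Integrable h μ := hh.integrable (by norm_num)
  have hlim : Tendsto (fun M : ℕ => ∫ x, (h x - trunc h M x) ^ 2 ∂μ) atTop (𝓝 (∫ x, (0 : ℝ) ∂μ)) := by
    refine tendsto_integral_of_dominated_convergence (fun x => h x ^ 2) (fun M => ?_)
      hh.integrable_sq (fun M => Eventually.of_forall fun x => ?_) (Eventually.of_forall fun x => ?_)
    · have := trunc_measurable hhm (M : ℝ)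
      fun_prop
    · rw [Real.norm_eq_abs, abs_of_nonneg (sq_nonneg _)]
      unfold trunc; split_ifs
      · rw [sub_self, zero_pow two_ne_zero]; exact sq_nonneg _
      · rw [sub_zero]
    · refine tendsto_const_nhds.congr' ?_
      filter_upwards [tendsto_natCast_atTop_atTop.eventually_ge_atTop (|h x|)] with M hM
      unfold trunc; rw [if_pos hM]; simp
  rw [integral_zero] at hlim
  obtain ⟨M, hM⟩ := (hlim.eventually_lt_const hδ).exists
  have hM0 : (0 : ℝ) ≤ M := Nat.cast_nonneg M
  have hbm := trunc_measurable hhm (M : ℝ)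
  have hbM := fun x => trunc_le (h := h) hM0 x
  obtain ⟨G, hGm, hGM, hGc⟩ := exists_proj hT hbm hM0 hbM
  have hGTm : Measurable (fun x => G (T x)) := hGm.comp hT.measurable
  have hφi : Integrable (fun x => trunc h M x - G (T x)) μ :=
    ((memLp_bdd hbm hbM 1).integrable le_rfl).sub
      ((memLp_bdd hGTm (fun x => hGM (T x)) 1).integrable le_rfl)
  refine ⟨fun x => trunc h M x - G (T x), hbm.sub hGTm, ⟨2 * M, fun x => ?_⟩, hGc, ?_⟩
  · have h1 := abs_sub (trunc h M x) (G (T x))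
    have h2 := hbM x
    have h3 := hGM (T x)
    linarith
  · have hc2 : μ[fun x => h x - trunc h M x - (fun y => - G y) (T x) |
        MeasurableSpace.comap T inferInstance] =ᵐ[μ] 0 := by
      have e : (fun x => h x - trunc h M x - (fun y => - G y) (T x))
        = h - fun x => trunc h M x - G (T x) := by
        funext x; simp only [Pi.sub_apply]; ring
      rw [e]
      refine (condExp_sub hhi hφi _).trans ?_
      filter_upwards [hc, hGc] with x h1 h2
      simp only [Pi.sub_apply, Pi.zero_apply] at *
      rw [h1, h2, sub_zero]
    have ha : MemLp (fun x => h x - trunc h M x) 2 μ := hh.sub (memLp_bdd hbm hbM 2)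
    have hG2 : MemLp (fun x => (fun y => - G y) (T x)) 2 μ :=
      (memLp_bdd hGTm (fun x => hGM (T x)) 2).neg
    have := proj_contr ha hGm.neg hG2 (md_of_condExp hT.measurable
      ((ha.sub hG2).integrable (by norm_num)) hc2)
    refine lt_of_le_of_lt (le_trans (le_of_eq ?_) this) hM
    refine integral_congr_ae (Eventually.of_forall fun x => ?_)
    simp only [Pi.neg_apply]; ring

lemma clt_L2 {μ : Measure X} [IsProbabilityMeasure μ] {T : X → X}
    (herg : Ergodic T μ) {h : X → ℝ} (hhm : Measurable h) (hh : MemLp h 2 μ)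
    (hc : μ[h | MeasurableSpace.comap T inferInstance] =ᵐ[μ] 0) (t : ℝ) :
    Tendsto (fun n : ℕ => ∫ x, Complex.exp (Complex.I *
        ((t * (birkhoffSum T h n x / Real.sqrt n) : ℝ) : ℂ)) ∂μ) atTop
      (𝓝 ((Real.exp (-(t ^ 2 * (∫ x, h x ^ 2 ∂μ) / 2)) : ℝ) : ℂ)) := by
  have hT := herg.toMeasurePreserving
  have hhi : Integrable h μ := hh.integrable (by norm_num)
  set s := ∫ x, h x ^ 2 ∂μ with hs
  have hs0 : 0 ≤ s := integral_nonneg fun x => sq_nonneg _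
  rw [Metric.tendsto_atTop]
  intro ε hε
  obtain ⟨δ, hδ0, hδ⟩ : ∃ δ : ℝ, 0 < δ ∧ |t| * δ + t ^ 2 / 2 * (δ * s + δ + δ ^ 2) < ε / 2 := by
    have hcont : Tendsto (fun δ : ℝ => |t| * δ + t ^ 2 / 2 * (δ * s + δ + δ ^ 2)) (𝓝[>] 0) (𝓝 0) := by
      have : Continuous (fun δ : ℝ => |t| * δ + t ^ 2 / 2 * (δ * s + δ + δ ^ 2)) := by fun_prop
      have h0 := (this.tendsto 0).mono_left (nhdsWithin_le_nhds (s := Set.Ioi 0))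
      simpa using h0
    have h1 := hcont.eventually_lt_const (half_pos hε)
    obtain ⟨δ, h2, h3⟩ := (h1.and self_mem_nhdsWithin).exists
    exact ⟨δ, h3, h2⟩
  obtain ⟨φ, hφm, ⟨K, hK⟩, hφc, hφδ⟩ := approx_L2 hT hhm hh hc (pow_pos hδ0 2)
  have hφ2 := memLp_bdd (μ := μ) hφm hK 2
  have hφi : Integrable φ μ := hφ2.integrable (by norm_num)
  set r : X → ℝ := fun x => h x - φ x with hr
  have hrm : Measurable r := hhm.sub hφm
  have hr2 : MemLp r 2 μ := hh.sub hφ2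
  have hri : Integrable r μ := hr2.integrable (by norm_num)
  have hrc : μ[r | MeasurableSpace.comap T inferInstance] =ᵐ[μ] 0 := by
    refine (condExp_sub hhi hφi _).trans ?_
    filter_upwards [hc, hφc] with x h1 h2
    simp only [Pi.sub_apply, Pi.zero_apply] at *
    rw [h1, h2, sub_zero]
  have hrmd := md_of_condExp hT.measurable hri hrc
  have hclt := clt_bdd herg hφm hK (md_of_condExp hT.measurable hφi hφc) t
  set sφ := ∫ x, φ x ^ 2 ∂μ with hsφ
  have hsφ0 : 0 ≤ sφ := integral_nonneg fun x => sq_nonneg _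
  have hdiff : |sφ - s| ≤ δ * s + δ + δ ^ 2 := by
    rw [hsφ, hs, ← integral_sub hφ2.integrable_sq hh.integrable_sq]
    refine (abs_integral_le_integral_abs).trans ?_
    have hle : ∀ x, |φ x ^ 2 - h x ^ 2| ≤ δ * h x ^ 2 + (δ⁻¹ + 1) * r x ^ 2 := by
      intro x
      have e : φ x ^ 2 - h x ^ 2 = r x ^ 2 - 2 * (h x * r x) := by simp only [hr]; ring
      have e2 : 2 * |h x * r x| ≤ δ * h x ^ 2 + δ⁻¹ * r x ^ 2 := by
        have h1 : 0 ≤ δ⁻¹ * (δ * |h x| - |r x|) ^ 2 := by positivity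
        have h2 : δ⁻¹ * (δ * |h x| - |r x|) ^ 2 = δ * |h x| ^ 2 - 2 * (|h x| * |r x|) + δ⁻¹ * |r x| ^ 2 := by
          field_simp; ring
        rw [h2, sq_abs, sq_abs, ← abs_mul] at h1
        linarith
      have h3 := abs_sub (r x ^ 2) (2 * (h x * r x))
      rw [abs_of_nonneg (sq_nonneg (r x)), abs_mul 2, abs_two] at h3
      rw [e]; linarith
    have hi : Integrable (fun x => δ * h x ^ 2 + (δ⁻¹ + 1) * r x ^ 2) μ :=
      (hh.integrable_sq.const_mul δ).add (hr2.integrable_sq.const_mul (δ⁻¹ + 1))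
    refine (integral_mono (hφ2.integrable_sq.sub hh.integrable_sq).abs hi hle).trans ?_
    rw [integral_add (hh.integrable_sq.const_mul δ) (hr2.integrable_sq.const_mul (δ⁻¹ + 1)),
      integral_const_mul, integral_const_mul]
    have h1 : (δ⁻¹ + 1) * ∫ x, r x ^ 2 ∂μ ≤ (δ⁻¹ + 1) * δ ^ 2 :=
      mul_le_mul_of_nonneg_left hφδ.le (by positivity)
    have h2 : (δ⁻¹ + 1) * δ ^ 2 = δ + δ ^ 2 := by field_simp
    rw [← hs]; linarith
  rw [Metric.tendsto_atTop] at hclt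
  obtain ⟨N, hN⟩ := hclt (ε / 2) (half_pos hε)
  refine ⟨N + 1, fun n hn => ?_⟩
  have h1 := hN n (by omega)
  rw [dist_eq_norm] at h1 ⊢
  have hnR : (0 : ℝ) < n := by exact_mod_cast (by omega : 0 < n)
  have hsq : 0 < Real.sqrt n := Real.sqrt_pos.2 hnR
  have hsq2 : Real.sqrt n ^ 2 = n := Real.sq_sqrt hnR.le
  have mS := measurable_birkhoffSum hT.measurable hhm n
  have mSφ := measurable_birkhoffSum hT.measurable hφm n
  have mSr := measurable_birkhoffSum hT.measurable hrm n
  have ie : ∀ g : X → ℝ, Measurable g →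
      Integrable (fun x => Complex.exp (Complex.I * (g x : ℂ))) μ := fun g hg =>
    Integrable.of_bound (by fun_prop) 1 (Eventually.of_forall fun x => by
      rw [mul_comm, Complex.norm_exp_ofReal_mul_I])
  have hL1 : ∫ x, |birkhoffSum T r n x| ∂μ ≤ Real.sqrt n * δ := by
    have ha := sq_integral_abs_le (memLp_birkhoffSum hT hr2 n)
    rw [sq_birkhoffSum hT hrm hr2 hrmd n] at ha
    have hb : (∫ x, |birkhoffSum T r n x| ∂μ) ^ 2 ≤ (Real.sqrt n * δ) ^ 2 := by
      rw [mul_pow, hsq2]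
      exact ha.trans (mul_le_mul_of_nonneg_left hφδ.le hnR.le)
    exact (abs_le_of_sq_le_sq' hb (by positivity)).2
  have h2 : ‖∫ x, Complex.exp (Complex.I * ((t * (birkhoffSum T h n x / Real.sqrt n) : ℝ) : ℂ)) ∂μ
      - ∫ x, Complex.exp (Complex.I * ((t * (birkhoffSum T φ n x / Real.sqrt n) : ℝ) : ℂ)) ∂μ‖
      ≤ |t| * δ := by
    rw [← integral_sub (ie _ (by fun_prop)) (ie _ (by fun_prop))]
    have hi := (integrable_birkhoffSum hT hri n).abs.const_mul (|t| / Real.sqrt n)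
    refine (norm_integral_le_of_norm_le hi (Eventually.of_forall fun x => ?_)).trans ?_
    · refine (cexp_lip _ _).trans (le_of_eq ?_)
      have e : birkhoffSum T r n x = birkhoffSum T h n x - birkhoffSum T φ n x := by
        simp only [birkhoffSum, hr, Finset.sum_sub_distrib]
      rw [e, ← mul_sub, ← sub_div, abs_mul, abs_div, abs_of_pos hsq]; ring
    · rw [integral_const_mul]
      have := mul_le_mul_of_nonneg_left hL1 (show 0 ≤ |t| / Real.sqrt n by positivity)
      refine this.trans (le_of_eq ?_)
      field_simp
  have h3 : ‖((Real.exp (-(t ^ 2 * sφ / 2)) : ℝ) : ℂ) - ((Real.exp (-(t ^ 2 * s / 2)) : ℝ) : ℂ)‖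
      ≤ t ^ 2 / 2 * (δ * s + δ + δ ^ 2) := by
    rw [← Complex.ofReal_sub, Complex.norm_real, Real.norm_eq_abs]
    refine (exp_neg_lip _ _ (by positivity) (by positivity)).trans ?_
    have e : t ^ 2 * sφ / 2 - t ^ 2 * s / 2 = t ^ 2 / 2 * (sφ - s) := by ring
    rw [e, abs_mul, abs_of_nonneg (show (0 : ℝ) ≤ t ^ 2 / 2 by positivity)]
    exact mul_le_mul_of_nonneg_left hdiff (by positivity)
  have key := norm_add₃_le
    (a := ∫ x, Complex.exp (Complex.I * ((t * (birkhoffSum T h n x / Real.sqrt n) : ℝ) : ℂ)) ∂μ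
      - ∫ x, Complex.exp (Complex.I * ((t * (birkhoffSum T φ n x / Real.sqrt n) : ℝ) : ℂ)) ∂μ)
    (b := ∫ x, Complex.exp (Complex.I * ((t * (birkhoffSum T φ n x / Real.sqrt n) : ℝ) : ℂ)) ∂μ
      - ((Real.exp (-(t ^ 2 * sφ / 2)) : ℝ) : ℂ))
    (c := ((Real.exp (-(t ^ 2 * sφ / 2)) : ℝ) : ℂ) - ((Real.exp (-(t ^ 2 * s / 2)) : ℝ) : ℂ))
  rw [sub_add_sub_cancel, sub_add_sub_cancel] at key
  linarith

end Part6

section Part7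
variable {X : Type} [MeasurableSpace X]

lemma integral_abs_gaussian (v : NNReal) :
    ∫ y, |y| ∂(gaussianReal 0 v) = Real.sqrt (2 / Real.pi) * Real.sqrt v := by
  by_cases hv : v = 0
  · subst hv; simp
  have hv0 : (0 : ℝ) < v := by positivity
  rw [integral_gaussianReal_eq_integral_smul hv]
  have e : ∀ x : ℝ, gaussianPDFReal 0 v x • |x| =
      (fun z : ℝ => (Real.sqrt (2 * Real.pi * v))⁻¹ * (z ^ (1 : ℝ) * Real.exp (-(2 * (v : ℝ))⁻¹ * z ^ (2 : ℝ)))) |x| := by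
    intro x
    simp only [gaussianPDFReal, smul_eq_mul, Real.rpow_one, sub_zero, Real.rpow_two, sq_abs]
    rw [mul_assoc, mul_comm |x|]
    congr 3
    field_simp
  simp_rw [e]
  rw [integral_comp_abs (f := fun z : ℝ => (Real.sqrt (2 * Real.pi * v))⁻¹ * (z ^ (1 : ℝ) * Real.exp (-(2 * (v : ℝ))⁻¹ * z ^ (2 : ℝ)))), integral_const_mul, integral_rpow_mul_exp_neg_mul_rpow (by norm_num) (by norm_num) (by positivity)]
  have hg : Real.Gamma ((1 + 1) / 2) = 1 := by norm_num
  rw [hg, show (-(1 + 1) / 2 : ℝ) = -1 by norm_num, Real.rpow_neg_one, inv_inv]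
  have hp := Real.pi_pos
  rw [show 2 * Real.pi * v = (2 / Real.pi) * v * Real.pi ^ 2 by field_simp, Real.sqrt_mul (by positivity), Real.sqrt_sq hp.le, Real.sqrt_mul (by positivity)]
  have h1 : 0 < Real.sqrt (2 / Real.pi) := Real.sqrt_pos.2 (by positivity)
  have h2 : 0 < Real.sqrt (v : ℝ) := Real.sqrt_pos.2 (by positivity)
  have h3 := Real.sq_sqrt (show (0 : ℝ) ≤ 2 / Real.pi by positivity)
  have h4 := Real.sq_sqrt hv0.le
  field_simp
  rw [h4, h3]
  field_simp

lemma weak_of_cf {μ : Measure X} [IsProbabilityMeasure μ] {Y : ℕ → X → ℝ}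
    (hY : ∀ n, AEMeasurable (Y n) μ) (v : NNReal)
    (hcf : ∀ t : ℝ, Tendsto (fun n => ∫ x, Complex.exp (Complex.I * ((t * Y n x : ℝ) : ℂ)) ∂μ) atTop
      (𝓝 ((Real.exp (-(t ^ 2 * v / 2)) : ℝ) : ℂ))) (ψ : BoundedContinuousFunction ℝ ℝ) :
    Tendsto (fun n => ∫ x, ψ (Y n x) ∂μ) atTop (𝓝 (∫ y, ψ y ∂(gaussianReal 0 v))) := by
  let P : ℕ → ProbabilityMeasure ℝ := fun n => ⟨μ.map (Y n), Measure.isProbabilityMeasure_map (hY n)⟩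
  let P0 : ProbabilityMeasure ℝ := ⟨gaussianReal 0 v, inferInstance⟩
  have h : Tendsto P atTop (𝓝 P0) := by
    refine ProbabilityMeasure.tendsto_of_tendsto_charFun fun t => ?_
    have e1 : charFun (P0 : Measure ℝ) t = ((Real.exp (-(t ^ 2 * v / 2)) : ℝ) : ℂ) := by
      show charFun (gaussianReal 0 v) t = _
      rw [charFun_gaussianReal]
      push_cast; congr 1; ring
    rw [e1]
    refine (hcf t).congr fun n => ?_
    show _ = charFun (μ.map (Y n)) t
    rw [charFun_apply_real, integral_map (hY n) (by fun_prop)]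
    refine integral_congr_ae (Eventually.of_forall fun x => ?_)
    simp only
    push_cast; congr 1; ring
  rw [ProbabilityMeasure.tendsto_iff_forall_integral_tendsto] at h
  refine (h ψ).congr fun n => ?_
  show ∫ y, ψ y ∂(μ.map (Y n)) = _
  rw [integral_map (hY n) (by fun_prop)]

lemma abs_sub_min_le (y : ℝ) {L : ℝ} (hL : 0 < L) : |(|y|) - min |y| L| ≤ y ^ 2 / L := by
  rw [← sq_abs y]
  rcases le_total |y| L with h | h
  · rw [min_eq_left h]; simp; positivity
  · rw [min_eq_right h, abs_of_nonneg (by linarith), le_div_iff₀ hL]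
    nlinarith [abs_nonneg y]

lemma min_close {ν : Measure X} [IsProbabilityMeasure ν] {Y : X → ℝ} (hY : MemLp Y 2 ν) {C L : ℝ}
    (hL : 0 < L) (hC : ∫ x, Y x ^ 2 ∂ν ≤ C) :
    |∫ x, |Y x| ∂ν - ∫ x, min |Y x| L ∂ν| ≤ C / L := by
  have hi : Integrable Y ν := hY.integrable (by norm_num)
  have hm : Integrable (fun x => min |Y x| L) ν := hi.abs.inf (integrable_const L)
  rw [← integral_sub hi.abs hm]
  refine (abs_integral_le_integral_abs).trans ?_
  have hs : Integrable (fun x => Y x ^ 2 / L) ν := hY.integrable_sq.div_const L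
  refine (integral_mono (hi.abs.sub hm).abs hs (fun x => abs_sub_min_le (Y x) hL)).trans ?_
  rw [integral_div]
  gcongr

lemma final_limit {μ : Measure X} [IsProbabilityMeasure μ] {Y W : ℕ → X → ℝ}
    (hY : ∀ n, MemLp (Y n) 2 μ) (hW : ∀ n, Integrable (W n) μ) (v : NNReal) {C : ℝ}
    (hcf : ∀ t : ℝ, Tendsto (fun n => ∫ x, Complex.exp (Complex.I * ((t * Y n x : ℝ) : ℂ)) ∂μ) atTop
      (𝓝 ((Real.exp (-(t ^ 2 * v / 2)) : ℝ) : ℂ)))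
    (hC : ∀ n, ∫ x, Y n x ^ 2 ∂μ ≤ C)
    (hWY : Tendsto (fun n => ∫ x, |W n x - Y n x| ∂μ) atTop (𝓝 0)) :
    (∀ ψ : BoundedContinuousFunction ℝ ℝ,
      Tendsto (fun n => ∫ x, ψ (W n x) ∂μ) atTop (𝓝 (∫ y, ψ y ∂(gaussianReal 0 v)))) ∧
    Tendsto (fun n => ∫ x, |W n x| ∂μ) atTop (𝓝 (Real.sqrt (2 / Real.pi) * Real.sqrt v)) := by
  have hYi : ∀ n, Integrable (Y n) μ := fun n => (hY n).integrable (by norm_num)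
  have hYm : ∀ n, AEMeasurable (Y n) μ := fun n => (hYi n).aemeasurable
  have hcfi : ∀ (t : ℝ) (Z : X → ℝ), AEMeasurable Z μ →
      Integrable (fun x => Complex.exp (Complex.I * ((t * Z x : ℝ) : ℂ))) μ := by
    intro t Z hZ
    refine Integrable.of_bound (C := 1) ?_ (Eventually.of_forall fun x => ?_)
    · have : Measurable fun z : ℝ => Complex.exp (Complex.I * ((t * z : ℝ) : ℂ)) := by fun_prop
      exact (this.comp_aemeasurable hZ).aestronglyMeasurable
    · rw [mul_comm, Complex.norm_exp_ofReal_mul_I]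
  constructor
  · refine weak_of_cf (fun n => (hW n).aemeasurable) v fun t => ?_
    have h0 : Tendsto (fun n => ∫ x, Complex.exp (Complex.I * ((t * W n x : ℝ) : ℂ)) ∂μ
        - ∫ x, Complex.exp (Complex.I * ((t * Y n x : ℝ) : ℂ)) ∂μ) atTop (𝓝 0) := by
      refine squeeze_zero_norm (a := fun n => |t| * ∫ x, |W n x - Y n x| ∂μ) (fun n => ?_) ?_
      · rw [← integral_sub (hcfi t _ (hW n).aemeasurable) (hcfi t _ (hYm n)), ← integral_const_mul]
        refine norm_integral_le_of_norm_le (((hW n).sub (hYi n)).abs.const_mul |t|)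
          (Eventually.of_forall fun x => ?_)
        refine (cexp_lip _ _).trans ?_
        rw [← mul_sub, abs_mul]
      · simpa using hWY.const_mul |t|
    simpa using h0.add (hcf t)
  · have hlim : Tendsto (fun n => ∫ x, |Y n x| ∂μ) atTop (𝓝 (∫ y, |y| ∂(gaussianReal 0 v))) := by
      rw [Metric.tendsto_atTop]
      intro ε hε
      have hg2 : MemLp (fun y : ℝ => y) 2 (gaussianReal 0 v) := memLp_id_gaussianReal 2
      set C' := max (max C (∫ y, y ^ 2 ∂(gaussianReal 0 v))) 0 with hC'
      have hC'0 : 0 ≤ C' := le_max_right _ _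
      set L := 4 * (C' + 1) / ε with hL
      have hL0 : 0 < L := by positivity
      have hCL : C' / L < ε / 3 := by
        rw [hL, div_div_eq_mul_div, div_lt_iff₀ (by positivity)]
        nlinarith
      let ψ : BoundedContinuousFunction ℝ ℝ := BoundedContinuousFunction.ofNormedAddCommGroup
        (fun y => min |y| L) (by fun_prop) L (fun y => by
          rw [Real.norm_eq_abs, abs_of_nonneg (le_min (abs_nonneg _) hL0.le)]; exact min_le_right _ _)
      have hw := weak_of_cf hYm v hcf ψ
      rw [Metric.tendsto_atTop] at hw
      obtain ⟨N, hN⟩ := hw (ε / 3) (by positivity)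
      refine ⟨N, fun n hn => ?_⟩
      have h1 := hN n hn
      have h2 := min_close (hY n) hL0 ((hC n).trans ((le_max_left C (∫ y, y ^ 2 ∂(gaussianReal 0 v))).trans (le_max_left _ 0)))
      have h3 := min_close hg2 hL0 ((le_max_right C (∫ y, y ^ 2 ∂(gaussianReal 0 v))).trans (le_max_left _ 0))
      rw [Real.dist_eq] at h1 ⊢
      change |∫ x, min |Y n x| L ∂μ - ∫ y, min |y| L ∂(gaussianReal 0 v)| < ε / 3 at h1
      rw [← hC'] at h2 h3
      rw [abs_le] at h2 h3
      rw [abs_lt] at h1 ⊢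
      constructor <;> linarith [h1.1, h1.2, h2.1, h2.2, h3.1, h3.2]
    rw [integral_abs_gaussian] at hlim
    have h0 : Tendsto (fun n => ∫ x, |W n x| ∂μ - ∫ x, |Y n x| ∂μ) atTop (𝓝 0) := by
      refine squeeze_zero_norm (fun n => ?_) hWY
      rw [← integral_sub (hW n).abs (hYi n).abs]
      refine norm_integral_le_of_norm_le ((hW n).sub (hYi n)).abs (Eventually.of_forall fun x => ?_)
      exact abs_abs_sub_abs_le _ _
    simpa using h0.add hlim

end Part7

section Part8
variable {X : Type} [MeasurableSpace X]
variable {μ : Measure X} [IsProbabilityMeasure μ] {T : X → X}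

lemma Lp_integrable {p : ℝ≥0∞} [hp : Fact (1 ≤ p)] (f : Lp ℝ p μ) : Integrable (f : X → ℝ) μ :=
  (Lp.memLp f).integrable hp.out

lemma Koop_inj (hT : MeasurePreserving T μ μ) (p : ℝ≥0∞) [Fact (1 ≤ p)] :
    Function.Injective (Koop hT p) := by
  intro f g h
  have : ‖Koop hT p (f - g)‖ = 0 := by rw [map_sub, h, sub_self, norm_zero]
  rw [Koop_norm, norm_eq_zero, sub_eq_zero] at this
  exact this

lemma tr_exists (hT : MeasurePreserving T μ μ) (p : ℝ≥0∞) [hp : Fact (1 ≤ p)] (f : Lp ℝ p μ) :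
    ∃ g : Lp ℝ p μ, (Koop hT p g : X → ℝ) =ᵐ[μ] μ[(f : X → ℝ) | MeasurableSpace.comap T inferInstance]
      ∧ ‖g‖ ≤ ‖f‖ := by
  have hsm : StronglyMeasurable[MeasurableSpace.comap T inferInstance]
      (μ[(f : X → ℝ) | MeasurableSpace.comap T inferInstance]) := stronglyMeasurable_condExp
  obtain ⟨g, hg, hgT⟩ := hsm.exists_eq_measurable_comp
  have hn : eLpNorm g p μ ≤ eLpNorm f p μ := by
    rw [← eLpNorm_comp_measurePreserving hg.aestronglyMeasurable hT, ← hgT]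
    exact eLpNorm_condExp_le_eLpNorm _ hp.out
  have hgL : MemLp g p μ := ⟨hg.aestronglyMeasurable, hn.trans_lt (Lp.memLp f).2⟩
  refine ⟨hgL.toLp g, ?_, ?_⟩
  · refine (Koop_coe hT p _).trans ?_
    rw [hgT]
    exact hT.quasiMeasurePreserving.ae_eq_comp hgL.coeFn_toLp
  · rw [Lp.norm_toLp, Lp.norm_def]
    exact ENNReal.toReal_mono (Lp.memLp f).2.ne hn

def tr (hT : MeasurePreserving T μ μ) (p : ℝ≥0∞) [hp : Fact (1 ≤ p)] : Lp ℝ p μ →L[ℝ] Lp ℝ p μ :=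
  LinearMap.mkContinuous
    { toFun := fun f => (tr_exists hT p f).choose
      map_add' := fun f g => by
        apply Koop_inj hT p
        rw [map_add]
        refine Lp.ext ?_
        refine (tr_exists hT p (f + g)).choose_spec.1.trans ?_
        refine (condExp_congr_ae (Lp.coeFn_add f g)).trans ?_
        refine (condExp_add (Lp_integrable f) (Lp_integrable g) _).trans ?_
        refine EventuallyEq.trans ?_ (Lp.coeFn_add _ _).symm
        exact (tr_exists hT p f).choose_spec.1.symm.add (tr_exists hT p g).choose_spec.1.symm
      map_smul' := fun c f => by
        apply Koop_inj hT p
        rw [RingHom.id_apply, map_smul]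
        refine Lp.ext ?_
        refine (tr_exists hT p (c • f)).choose_spec.1.trans ?_
        refine (condExp_congr_ae (Lp.coeFn_smul c f)).trans ?_
        refine (condExp_smul c _ _).trans ?_
        refine EventuallyEq.trans ?_ (Lp.coeFn_smul _ _).symm
        exact (tr_exists hT p f).choose_spec.1.symm.const_smul c }
    1 (fun f => by rw [one_mul]; exact (tr_exists hT p f).choose_spec.2)

lemma tr_spec (hT : MeasurePreserving T μ μ) (p : ℝ≥0∞) [hp : Fact (1 ≤ p)] (f : Lp ℝ p μ) :
    (Koop hT p (tr hT p f) : X → ℝ) =ᵐ[μ] μ[(f : X → ℝ) | MeasurableSpace.comap T inferInstance] :=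
  (tr_exists hT p f).choose_spec.1

lemma tr_norm (hT : MeasurePreserving T μ μ) (p : ℝ≥0∞) [hp : Fact (1 ≤ p)] : ‖tr hT p‖ ≤ 1 :=
  LinearMap.mkContinuous_norm_le _ zero_le_one _

lemma tr_Koop (hT : MeasurePreserving T μ μ) (p : ℝ≥0∞) [hp : Fact (1 ≤ p)] (f : Lp ℝ p μ) :
    tr hT p (Koop hT p f) = f := by
  apply Koop_inj hT p
  refine Lp.ext ((tr_spec hT p _).trans ?_)
  refine (condExp_congr_ae (Koop_coe hT p f)).trans ?_
  refine EventuallyEq.trans ?_ (Koop_coe hT p f).symm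
  have hsm : StronglyMeasurable[MeasurableSpace.comap T inferInstance] (fun x => (f : X → ℝ) (T x)) :=
    (Lp.stronglyMeasurable f).comp_measurable (comap_measurable T)
  have hi : Integrable (fun x => (f : X → ℝ) (T x)) μ :=
    (Lp_integrable (Koop hT p f)).congr (Koop_coe hT p f)
  rw [condExp_of_stronglyMeasurable hT.measurable.comap_le hsm hi]

lemma tr_pow_Koop_pow (hT : MeasurePreserving T μ μ) (p : ℝ≥0∞) [hp : Fact (1 ≤ p)] (N : ℕ)
    (f : Lp ℝ p μ) : (tr hT p ^ N) ((Koop hT p ^ N) f) = f := by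
  induction N generalizing f with
  | zero => simp
  | succ N ih =>
    rw [pow_succ, pow_succ']
    simp only [ContinuousLinearMap.mul_apply]
    rw [tr_Koop, ih]

lemma tr_pow_norm (hT : MeasurePreserving T μ μ) (p : ℝ≥0∞) [hp : Fact (1 ≤ p)] (N : ℕ)
    (f : Lp ℝ p μ) : ‖(tr hT p ^ N) f‖ ≤ ‖f‖ := by
  induction N with
  | zero => simp
  | succ N ih =>
    rw [pow_succ']
    refine ((tr hT p).le_of_opNorm_le (tr_norm hT p) _).trans ?_
    rw [one_mul]; exact ih

lemma tr_setIntegral (hT : MeasurePreserving T μ μ) (p : ℝ≥0∞) [hp : Fact (1 ≤ p)] (f : Lp ℝ p μ)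
    (s : Set X) (hs : MeasurableSet s) :
    ∫ x in s, (tr hT p f : X → ℝ) x ∂μ = ∫ x in T ⁻¹' s, f x ∂μ := by
  have h1 : ∫ x in T ⁻¹' s, μ[(f : X → ℝ) | MeasurableSpace.comap T inferInstance] x ∂μ
      = ∫ x in T ⁻¹' s, f x ∂μ :=
    setIntegral_condExp hT.measurable.comap_le (Lp_integrable f) ⟨s, hs, rfl⟩
  rw [← h1, ← setIntegral_congr_ae (hT.measurable hs) ((tr_spec hT p f).mono fun x hx _ => hx),
    setIntegral_congr_ae (hT.measurable hs) ((Koop_coe hT p (tr hT p f)).mono fun x hx _ => hx)]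
  have e1 : ∫ x in s, (tr hT p f : X → ℝ) x ∂μ = ∫ x, s.indicator (tr hT p f : X → ℝ) x ∂μ :=
    (integral_indicator hs).symm
  rw [e1, ← integral_comp_pres hT, ← integral_indicator (hT.measurable hs)]
  · rfl
  · exact ((Lp.stronglyMeasurable (tr hT p f)).indicator hs).aestronglyMeasurable

lemma tr_isTransfer (hT : MeasurePreserving T μ μ) (p : ℝ≥0∞) [hp : Fact (1 ≤ p)] (k : ℕ)
    (f : Lp ℝ p μ) : IsTransfer μ T k f ((tr hT p ^ k) f) := by
  induction k with
  | zero => intro s hs; simp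
  | succ k ih =>
    intro s hs
    rw [pow_succ', ContinuousLinearMap.mul_apply, tr_setIntegral hT p _ s hs,
      ih _ (hT.measurable hs), Function.iterate_succ', Set.preimage_comp]

lemma ae_eq_of_comp (hT : MeasurePreserving T μ μ) {a b : X → ℝ} (ha : AEStronglyMeasurable a μ)
    (hb : AEStronglyMeasurable b μ) (h : (fun x => a (T x)) =ᵐ[μ] fun x => b (T x)) : a =ᵐ[μ] b := by
  have hn : NullMeasurableSet {x | a x = b x} μ := nullMeasurableSet_eq_fun ha.aemeasurable hb.aemeasurable
  have : μ (T ⁻¹' {x | a x = b x}ᶜ) = 0 := h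
  rw [hT.measure_preimage hn.compl] at this
  exact this

lemma tr_congr (hT : MeasurePreserving T μ μ) (p q : ℝ≥0∞) [hp : Fact (1 ≤ p)] [hq : Fact (1 ≤ q)]
    (f : Lp ℝ p μ) (g : Lp ℝ q μ) (h : (f : X → ℝ) =ᵐ[μ] g) :
    (tr hT p f : X → ℝ) =ᵐ[μ] tr hT q g := by
  refine ae_eq_of_comp hT (Lp.aestronglyMeasurable _) (Lp.aestronglyMeasurable _) ?_
  refine (Koop_coe hT p _).symm.trans (((tr_spec hT p f).trans ?_).trans (Koop_coe hT q _))
  exact (condExp_congr_ae h).trans (tr_spec hT q g).symm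

lemma tr_pow_congr (hT : MeasurePreserving T μ μ) (p q : ℝ≥0∞) [hp : Fact (1 ≤ p)] [hq : Fact (1 ≤ q)]
    (f : Lp ℝ p μ) (g : Lp ℝ q μ) (h : (f : X → ℝ) =ᵐ[μ] g) (N : ℕ) :
    ((tr hT p ^ N) f : X → ℝ) =ᵐ[μ] (tr hT q ^ N) g := by
  induction N with
  | zero => exact h
  | succ N ih => rw [pow_succ', pow_succ']; exact tr_congr hT p q _ _ ih

lemma tr_bdd (hT : MeasurePreserving T μ μ) (p : ℝ≥0∞) [hp : Fact (1 ≤ p)] (f : Lp ℝ p μ) (K : NNReal)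
    (h : ∀ᵐ x ∂μ, |(f : X → ℝ) x| ≤ K) : ∀ᵐ x ∂μ, |(tr hT p f : X → ℝ) x| ≤ K := by
  have h1 := ae_bdd_condExp_of_ae_bdd (m := MeasurableSpace.comap T inferInstance) h
  have h2 : ∀ᵐ x ∂μ, |(tr hT p f : X → ℝ) (T x)| ≤ K := by
    filter_upwards [h1, tr_spec hT p f, Koop_coe hT p (tr hT p f)] with x a b c
    rw [← c, b]; exact a
  have hn : MeasurableSet {x | |(tr hT p f : X → ℝ) x| ≤ K} :=
    measurableSet_le (by have := (Lp.stronglyMeasurable (tr hT p f)).measurable; fun_prop) measurable_const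
  have : μ (T ⁻¹' {x | |(tr hT p f : X → ℝ) x| ≤ K}ᶜ) = 0 := h2
  rw [hT.measure_preimage hn.compl.nullMeasurableSet] at this
  exact this

lemma tr_pow_bdd (hT : MeasurePreserving T μ μ) (p : ℝ≥0∞) [hp : Fact (1 ≤ p)] (f : Lp ℝ p μ) (K : NNReal)
    (h : ∀ᵐ x ∂μ, |(f : X → ℝ) x| ≤ K) (N : ℕ) : ∀ᵐ x ∂μ, |((tr hT p ^ N) f : X → ℝ) x| ≤ K := by
  induction N with
  | zero => exact h
  | succ N ih => rw [pow_succ']; exact tr_bdd hT p _ K ih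

lemma tr_adj (hT : MeasurePreserving T μ μ) (f g : Lp ℝ 2 μ) :
    inner ℝ (tr hT 2 f) g = inner ℝ f (Koop hT 2 g) := by
  rw [← (Lp.compMeasurePreservingₗᵢ ℝ T hT).inner_map_map (tr hT 2 f) g]
  change inner ℝ (Koop hT 2 (tr hT 2 f)) (Koop hT 2 g) = inner ℝ f (Koop hT 2 g)
  rw [L2.inner_def, L2.inner_def]
  have hsm : StronglyMeasurable[MeasurableSpace.comap T inferInstance] (fun x => (g : X → ℝ) (T x)) :=
    (Lp.stronglyMeasurable g).comp_measurable (comap_measurable T)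
  have hmem : MemLp (fun x => (g : X → ℝ) (T x)) 2 μ := (memLp_congr_ae (Koop_coe hT 2 g)).1 (Lp.memLp _)
  have hfg : Integrable ((f : X → ℝ) * fun x => (g : X → ℝ) (T x)) μ :=
    (Lp.memLp f).integrable_mul hmem
  have h1 := condExp_mul_of_stronglyMeasurable_right hsm hfg (Lp_integrable f)
  have h2 := integral_condExp (μ := μ) hT.measurable.comap_le (f := (f : X → ℝ) * fun x => (g : X → ℝ) (T x))
  calc _ = ∫ x, (μ[(f : X → ℝ) * (fun x => (g : X → ℝ) (T x)) | MeasurableSpace.comap T inferInstance]) x ∂μ := by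
        refine integral_congr_ae ?_
        filter_upwards [h1, Koop_coe hT 2 g, tr_spec hT 2 f] with x a b c
        rw [a, b, c]; simp [mul_comm]
    _ = _ := by
        rw [h2]
        refine integral_congr_ae ?_
        filter_upwards [Koop_coe hT 2 g] with x b
        rw [b]; simp [mul_comm]

lemma tr_pow_adj (hT : MeasurePreserving T μ μ) (N : ℕ) (f g : Lp ℝ 2 μ) :
    inner ℝ ((tr hT 2 ^ N) f) g = inner ℝ f ((Koop hT 2 ^ N) g) := by
  induction N generalizing g with
  | zero => simp
  | succ N ih =>
    rw [pow_succ', pow_succ, ContinuousLinearMap.mul_apply, tr_adj, ih, ContinuousLinearMap.mul_apply]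

end Part8

section Part9
variable {X : Type} [MeasurableSpace X]
variable {μ : Measure X} [IsProbabilityMeasure μ] {T : X → X}

lemma tail_const (hT : MeasurePreserving T μ μ) (hex : Exact μ T) (φ : X → ℝ)
    (h : ∀ N : ℕ, ∃ g : X → ℝ, Measurable g ∧ φ =ᵐ[μ] fun x => g (T^[N] x)) :
    ∃ c : ℝ, φ =ᵐ[μ] Function.const X c := by
  choose g hg hφ using h
  refine exists_eventuallyEq_const_of_forall_separating (p := MeasurableSet) fun U hU => ?_
  set s : Set X := {x | ∃ᶠ N in atTop, g N (T^[N] x) ∈ U} with hs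
  have hae : ∀ᵐ x ∂μ, (x ∈ s ↔ φ x ∈ U) := by
    filter_upwards [ae_all_iff.2 hφ] with x hx
    simp only [hs, Set.mem_ofPred_eq, ← hx, frequently_const]
  have ht : ∀ n : ℕ, ∃ t : Set X, MeasurableSet t ∧ s = T^[n] ⁻¹' t := by
    intro n
    refine ⟨{y | ∃ᶠ N in atTop, g (N + n) (T^[N] y) ∈ U}, ?_, ?_⟩
    · have e : {y | ∃ᶠ N in atTop, g (N + n) (T^[N] y) ∈ U}
        = limsup (fun N => {y | g (N + n) (T^[N] y) ∈ U}) atTop := by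
        ext y; simp [limsup_eq_iInf_iSup_of_nat, frequently_atTop]
      rw [e]
      exact MeasurableSet.measurableSet_limsup fun N =>
        ((hg (N + n)).comp (hT.measurable.iterate N)) hU
    · ext x
      simp only [hs, Set.mem_ofPred_eq, Set.mem_preimage]
      have e : ∀ N, T^[N] (T^[n] x) = T^[N + n] x := fun N => (Function.iterate_add_apply T N n x).symm
      simp only [e]
      conv_lhs => rw [← map_add_atTop_eq_nat n]
      rw [frequently_map]
  rcases hex s ht with h0 | h1
  · right
    have : ∀ᵐ x ∂μ, x ∉ s := by rw [ae_iff]; simpa using h0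
    filter_upwards [this, hae] with x a b
    rwa [← b]
  · left
    have hsm : MeasurableSet s := by
      obtain ⟨t, ht1, ht2⟩ := ht 0
      rw [ht2]; exact ht1
    have : ∀ᵐ x ∂μ, x ∈ s := (prob_compl_eq_zero_iff hsm).2 h1
    filter_upwards [this, hae] with x a b
    rwa [← b]

def intL (μ : Measure X) [IsProbabilityMeasure μ] (p : ℝ≥0∞) [hp : Fact (1 ≤ p)] : Lp ℝ p μ →L[ℝ] ℝ :=
  LinearMap.mkContinuous
    { toFun := fun f => ∫ x, (f : X → ℝ) x ∂μ
      map_add' := fun f g => by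
        rw [integral_congr_ae (Lp.coeFn_add f g)]
        exact integral_add (Lp_integrable f) (Lp_integrable g)
      map_smul' := fun c f => by
        rw [integral_congr_ae (Lp.coeFn_smul c f)]
        exact integral_smul c _ }
    1 (fun f => by
      rw [one_mul]
      refine (norm_integral_le_integral_norm _).trans ?_
      rw [Lp.norm_def, integral_norm_eq_lintegral_enorm (Lp.aestronglyMeasurable f),
        ← eLpNorm_one_eq_lintegral_enorm]
      exact ENNReal.toReal_mono (Lp.memLp f).2.ne
        (eLpNorm_le_eLpNorm_of_exponent_le hp.out (Lp.aestronglyMeasurable f)))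

lemma intL_apply (p : ℝ≥0∞) [hp : Fact (1 ≤ p)] (f : Lp ℝ p μ) : intL μ p f = ∫ x, f x ∂μ := rfl

lemma intL_norm (p : ℝ≥0∞) [hp : Fact (1 ≤ p)] : ‖intL μ p‖ ≤ 1 :=
  LinearMap.mkContinuous_norm_le _ zero_le_one _

def one (μ : Measure X) [IsProbabilityMeasure μ] (p : ℝ≥0∞) : Lp ℝ p μ := Lp.const p μ (1 : ℝ)

lemma one_coe (p : ℝ≥0∞) : (one μ p : X → ℝ) =ᵐ[μ] fun _ => 1 := Lp.coeFn_const p μ 1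

lemma one_norm (p : ℝ≥0∞) [hp : Fact (1 ≤ p)] : ‖one μ p‖ ≤ 1 := by
  refine (Lp.norm_const_le p μ (1 : ℝ)).trans ?_
  simp

def Pm (μ : Measure X) [IsProbabilityMeasure μ] (p : ℝ≥0∞) [hp : Fact (1 ≤ p)] :
    Lp ℝ p μ →L[ℝ] Lp ℝ p μ := (intL μ p).smulRight (one μ p)

lemma Pm_apply (p : ℝ≥0∞) [hp : Fact (1 ≤ p)] (f : Lp ℝ p μ) : Pm μ p f = intL μ p f • one μ p := rfl

lemma Pm_norm (p : ℝ≥0∞) [hp : Fact (1 ≤ p)] : ‖Pm μ p‖ ≤ 1 := by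
  rw [Pm, ContinuousLinearMap.norm_smulRight_apply]
  exact mul_le_one₀ (intL_norm p) (norm_nonneg _) (one_norm p)

lemma intL_one (p : ℝ≥0∞) [hp : Fact (1 ≤ p)] : intL μ p (one μ p) = 1 := by
  rw [intL_apply, integral_congr_ae (one_coe p)]; simp

lemma tr_one (hT : MeasurePreserving T μ μ) (p : ℝ≥0∞) [hp : Fact (1 ≤ p)] :
    tr hT p (one μ p) = one μ p := by
  have : Koop hT p (one μ p) = one μ p := by
    refine Lp.ext ((Koop_coe hT p _).trans ?_)
    exact (hT.quasiMeasurePreserving.ae_eq_comp (one_coe p)).trans (one_coe p).symm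
  conv_lhs => rw [← this]
  exact tr_Koop hT p _

lemma intL_tr (hT : MeasurePreserving T μ μ) (p : ℝ≥0∞) [hp : Fact (1 ≤ p)] (f : Lp ℝ p μ) :
    intL μ p (tr hT p f) = intL μ p f := by
  have := tr_setIntegral hT p f Set.univ MeasurableSet.univ
  simpa [intL_apply] using this

lemma Pm_tr (hT : MeasurePreserving T μ μ) (p : ℝ≥0∞) [hp : Fact (1 ≤ p)] : Pm μ p * tr hT p = Pm μ p := by
  ext1 f
  show Pm μ p (tr hT p f) = _
  rw [Pm_apply, intL_tr, ← Pm_apply]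

lemma Pm_tr_pow (hT : MeasurePreserving T μ μ) (p : ℝ≥0∞) [hp : Fact (1 ≤ p)] (N : ℕ) :
    Pm μ p * tr hT p ^ N = Pm μ p := by
  induction N with
  | zero => simp
  | succ N ih => rw [pow_succ, ← mul_assoc, ih, Pm_tr]

lemma tr_Pm (hT : MeasurePreserving T μ μ) (p : ℝ≥0∞) [hp : Fact (1 ≤ p)] : tr hT p * Pm μ p = Pm μ p := by
  ext1 f
  show tr hT p (Pm μ p f) = _
  rw [Pm_apply, map_smul, tr_one]

def GG (hT : MeasurePreserving T μ μ) (p : ℝ≥0∞) [hp : Fact (1 ≤ p)] : Submodule ℝ (Lp ℝ p μ) where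
  carrier := {f | Tendsto (fun N : ℕ => (tr hT p ^ N) f) atTop (𝓝 (Pm μ p f))}
  zero_mem' := by simp
  add_mem' := fun {a b} ha hb => by
    simp only [Set.mem_ofPred_eq, map_add] at *; exact ha.add hb
  smul_mem' := fun c f hf => by
    simp only [Set.mem_ofPred_eq, map_smul] at *; exact hf.const_smul c

lemma GG_closed (hT : MeasurePreserving T μ μ) (p : ℝ≥0∞) [hp : Fact (1 ≤ p)] :
    IsClosed (GG hT p : Set (Lp ℝ p μ)) := by
  refine isClosed_of_closure_subset fun f hf => ?_
  show Tendsto (fun N : ℕ => (tr hT p ^ N) f) atTop (𝓝 (Pm μ p f))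
  rw [Metric.tendsto_atTop]
  intro ε hε
  obtain ⟨g, hg, hfg⟩ := Metric.mem_closure_iff.1 hf (ε / 3) (by positivity)
  obtain ⟨N, hN⟩ := Metric.tendsto_atTop.1 (show Tendsto (fun N : ℕ => (tr hT p ^ N) g) atTop (𝓝 (Pm μ p g)) from hg) (ε / 3) (by positivity)
  refine ⟨N, fun n hn => ?_⟩
  have h1 := hN n hn
  have h2 := tr_pow_norm hT p n (f - g)
  have h3 := (Pm μ p).le_of_opNorm_le (Pm_norm p) (f - g)
  rw [dist_eq_norm] at *
  rw [map_sub] at h2 h3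
  have e : (tr hT p ^ n) f - Pm μ p f = ((tr hT p ^ n) f - (tr hT p ^ n) g) + ((tr hT p ^ n) g - Pm μ p g)
    - (Pm μ p f - Pm μ p g) := by abel
  rw [e]
  refine (norm_sub_le _ _).trans_lt ?_
  have := norm_add_le ((tr hT p ^ n) f - (tr hT p ^ n) g) ((tr hT p ^ n) g - Pm μ p g)
  linarith

lemma GG_two (hT : MeasurePreserving T μ μ) (hex : Exact μ T) : GG hT 2 = ⊤ := by
  have hone : one μ 2 ∈ GG hT 2 := by
    show Tendsto (fun N : ℕ => (tr hT 2 ^ N) (one μ 2)) atTop (𝓝 (Pm μ 2 (one μ 2)))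
    have : ∀ N : ℕ, (tr hT 2 ^ N) (one μ 2) = one μ 2 := by
      intro N
      induction N with
      | zero => rfl
      | succ N ih => rw [pow_succ, mul_apply_eq_comp, tr_one, ih]
    simp only [this, Pm_apply, intL_one, one_smul]
    exact tendsto_const_nhds
  have hker : ∀ (N : ℕ) (φ : Lp ℝ 2 μ), φ - (Koop hT 2 ^ N) ((tr hT 2 ^ N) φ) ∈ GG hT 2 := by
    intro N φ
    have h0 : (tr hT 2 ^ N) (φ - (Koop hT 2 ^ N) ((tr hT 2 ^ N) φ)) = 0 := by
      rw [map_sub, tr_pow_Koop_pow, sub_self]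
    have hP : Pm μ 2 (φ - (Koop hT 2 ^ N) ((tr hT 2 ^ N) φ)) = 0 := by
      rw [← Pm_tr_pow hT 2 N, mul_apply_eq_comp, h0, map_zero]
    show Tendsto _ _ _
    rw [hP]
    refine tendsto_const_nhds.congr' ?_
    filter_upwards [eventually_ge_atTop N] with n hn
    obtain ⟨k, rfl⟩ := Nat.exists_eq_add_of_le' hn
    rw [pow_add, mul_apply_eq_comp, h0, map_zero]
  have hbot : (GG hT 2)ᗮ = ⊥ := by
    rw [eq_bot_iff]
    intro φ hφ
    rw [Submodule.mem_orthogonal'] at hφ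
    have hN : ∀ N : ℕ, φ = (Koop hT 2 ^ N) ((tr hT 2 ^ N) φ) := by
      intro N
      have h1 := hφ _ (hker N φ)
      have h2 : inner ℝ ((Koop hT 2 ^ N) ((tr hT 2 ^ N) φ)) (φ - (Koop hT 2 ^ N) ((tr hT 2 ^ N) φ)) = (0 : ℝ) := by
        rw [real_inner_comm, ← tr_pow_adj, map_sub, tr_pow_Koop_pow, sub_self, inner_zero_left]
      have h3 : inner ℝ (φ - (Koop hT 2 ^ N) ((tr hT 2 ^ N) φ)) (φ - (Koop hT 2 ^ N) ((tr hT 2 ^ N) φ)) = (0 : ℝ) := by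
        rw [inner_sub_left, h1, h2, sub_zero]
      rw [inner_self_eq_zero, sub_eq_zero] at h3
      exact h3
    obtain ⟨c, hc⟩ := tail_const hT hex (φ : X → ℝ) (fun N => ⟨(((tr hT 2 ^ N) φ : Lp ℝ 2 μ) : X → ℝ),
      (Lp.stronglyMeasurable _).measurable, by
        conv_lhs => rw [hN N]
        exact Koop_pow_coe hT 2 _ N⟩)
    have h1 := hφ _ hone
    rw [L2.inner_def] at h1
    have h2 : ∫ x, inner ℝ ((φ : X → ℝ) x) ((one μ 2 : X → ℝ) x) ∂μ = c := by
      have : (fun x => inner ℝ ((φ : X → ℝ) x) ((one μ 2 : X → ℝ) x)) =ᵐ[μ] fun _ => c := by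
        filter_upwards [hc, one_coe (μ := μ) 2] with x a b
        rw [a, b]; simp
      rw [integral_congr_ae this]; simp
    rw [h2] at h1
    rw [Submodule.mem_bot, Lp.eq_zero_iff_ae_eq_zero]
    rw [h1] at hc
    exact hc
  have := Submodule.topologicalClosure_eq_top_iff.2 hbot
  rw [(GG_closed hT 2).submodule_topologicalClosure_eq] at this
  exact this

lemma norm_pow_eq (q : ℕ) [hq : Fact ((1 : ℝ≥0∞) ≤ q)] (f : Lp ℝ q μ) :
    ‖f‖ ^ q = ∫ x, |(f : X → ℝ) x| ^ q ∂μ := by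
  have hq0 : q ≠ 0 := by
    intro h; have := hq.out; rw [h] at this; simp at this
  rw [Lp.norm_def, (Lp.memLp f).eLpNorm_eq_integral_rpow_norm (by exact_mod_cast hq0) (by simp)]
  have h0 : 0 ≤ ∫ x, |(f : X → ℝ) x| ^ q ∂μ := integral_nonneg fun x => by positivity
  simp only [ENNReal.toReal_natCast, Real.norm_eq_abs, Real.rpow_natCast]
  rw [ENNReal.toReal_ofReal (by positivity), Real.rpow_inv_natCast_pow h0 hq0]

lemma integrable_abs_pow (q : ℕ) [hq : Fact ((1 : ℝ≥0∞) ≤ q)] (f : Lp ℝ q μ) :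
    Integrable (fun x => |(f : X → ℝ) x| ^ q) μ := by
  have hq0 : q ≠ 0 := by
    intro h; have := hq.out; rw [h] at this; simp at this
  simpa using (Lp.memLp f).integrable_norm_pow hq0

lemma GG_bdd (hT : MeasurePreserving T μ μ) (hex : Exact μ T) (q : ℕ) [hq : Fact ((1 : ℝ≥0∞) ≤ q)]
    (f : Lp ℝ q μ) (K : NNReal) (hK : ∀ᵐ x ∂μ, |(f : X → ℝ) x| ≤ K) : f ∈ GG hT q := by
  have hq0 : q ≠ 0 := by
    intro h; have := hq.out; rw [h] at this; simp at this
  have hm2 : MemLp (f : X → ℝ) 2 μ := MemLp.of_bound (Lp.aestronglyMeasurable f) K hK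
  set F := hm2.toLp f with hF
  have hFf : (f : X → ℝ) =ᵐ[μ] F := hm2.coeFn_toLp.symm
  have hlim : Tendsto (fun N : ℕ => (tr hT 2 ^ N) F) atTop (𝓝 (Pm μ 2 F)) := by
    have : F ∈ GG hT 2 := by rw [GG_two hT hex]; trivial
    exact this
  have hKc : |intL μ q f| ≤ K := by
    rw [intL_apply]
    refine (abs_integral_le_integral_abs).trans ?_
    refine (integral_mono_ae (Lp_integrable f).abs (integrable_const (K : ℝ)) hK).trans ?_
    simp
  show Tendsto _ _ _
  rw [tendsto_iff_norm_sub_tendsto_zero] at hlim ⊢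
  have key : ∀ N, ‖(tr hT q ^ N) f - Pm μ q f‖ ^ q ≤ (2 * K) ^ (q - 1) * ‖(tr hT 2 ^ N) F - Pm μ 2 F‖ := by
    intro N
    set g := (tr hT q ^ N) f - Pm μ q f with hg
    set G := (tr hT 2 ^ N) F - Pm μ 2 F with hG
    have hc : intL μ q f = intL μ 2 F := by rw [intL_apply, intL_apply]; exact integral_congr_ae hFf
    have hgG : (g : X → ℝ) =ᵐ[μ] G ∧ ∀ᵐ x ∂μ, |(g : X → ℝ) x| ≤ 2 * K := by
      have e1 := Lp.coeFn_sub ((tr hT q ^ N) f) (Pm μ q f)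
      have e2 := Lp.coeFn_sub ((tr hT 2 ^ N) F) (Pm μ 2 F)
      have e3 := Lp.coeFn_smul (intL μ q f) (one μ q)
      have e4 := Lp.coeFn_smul (intL μ 2 F) (one μ 2)
      have e5 := one_coe (μ := μ) q
      have e6 := one_coe (μ := μ) 2
      have e7 := tr_pow_congr hT q 2 f F hFf N
      constructor
      · filter_upwards [e1, e2, e3, e4, e5, e6, e7] with x a1 a2 a3 a4 a5 a6 a7
        rw [hg, hG, a1, a2]
        simp only [Pi.sub_apply, Pm_apply]
        rw [a3, a4, a7]
        simp only [Pi.smul_apply]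
        rw [a5, a6, hc]
      · filter_upwards [e1, e3, e5, tr_pow_bdd hT q f K hK N] with x a1 a3 a5 a7
        rw [hg, a1]
        simp only [Pi.sub_apply, Pm_apply]
        rw [a3]
        simp only [Pi.smul_apply]
        rw [a5, smul_eq_mul, mul_one]
        refine (abs_sub _ _).trans ?_
        linarith
    rw [norm_pow_eq]
    have h1 : ∫ x, |(g : X → ℝ) x| ^ q ∂μ ≤ ∫ x, (2 * K : ℝ) ^ (q - 1) * |(G : X → ℝ) x| ∂μ := by
      refine integral_mono_ae (integrable_abs_pow q g) ((Lp_integrable G).abs.const_mul _) ?_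
      filter_upwards [hgG.1, hgG.2] with x a b
      show |(g : X → ℝ) x| ^ q ≤ (2 * K : ℝ) ^ (q - 1) * |(G : X → ℝ) x|
      rw [← a]
      obtain ⟨r, rfl⟩ := Nat.exists_eq_succ_of_ne_zero hq0
      rw [pow_succ, Nat.succ_sub_one]
      gcongr
    refine h1.trans ?_
    rw [integral_const_mul]
    gcongr
    have h2 := sq_integral_abs_le (Lp.memLp G)
    rw [← L2_norm_sq] at h2
    exact le_of_sq_le_sq h2 (norm_nonneg _)
  have hlimq : Tendsto (fun N => ‖(tr hT q ^ N) f - Pm μ q f‖ ^ q) atTop (𝓝 0) := by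
    refine squeeze_zero (fun N => by positivity) key ?_
    simpa using hlim.const_mul ((2 * (K : ℝ)) ^ (q - 1))
  have h3 := hlimq.rpow_const (p := (q : ℝ)⁻¹) (Or.inr (by positivity))
  rw [Real.zero_rpow (by positivity)] at h3
  refine h3.congr fun N => ?_
  exact Real.pow_rpow_inv_natCast (norm_nonneg _) hq0

lemma GG_all (hT : MeasurePreserving T μ μ) (hex : Exact μ T) (q : ℕ) [hq : Fact ((1 : ℝ≥0∞) ≤ q)]
    (f : Lp ℝ q μ) : Tendsto (fun N : ℕ => (tr hT q ^ N) f) atTop (𝓝 (Pm μ q f)) := by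
  have hd := Lp.simpleFunc.denseRange (E := ℝ) (p := (q : ℝ≥0∞)) (μ := μ) (by simp)
  have : (GG hT q : Set (Lp ℝ q μ)) = Set.univ := by
    refine Set.eq_univ_of_univ_subset ?_
    rw [← hd.closure_range]
    refine closure_minimal ?_ (GG_closed hT q)
    rintro _ ⟨s, rfl⟩
    obtain ⟨K, hK⟩ := (Lp.simpleFunc.toSimpleFunc s).exists_forall_norm_le
    refine GG_bdd hT hex q _ (Real.toNNReal K) ?_
    filter_upwards [Lp.simpleFunc.toSimpleFunc_eq_toFun s] with x hx
    rw [← hx]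
    exact (hK x).trans (Real.le_coe_toNNReal K)
  have h : f ∈ (GG hT q : Set (Lp ℝ q μ)) := by rw [this]; trivial
  exact h

end Part9

section Part10
variable {X : Type} [MeasurableSpace X]
variable {μ : Measure X} [IsProbabilityMeasure μ] {T : X → X}

lemma elem1 (q : ℕ) (t : ℝ) (h1 : -1 ≤ t) (h2 : t ≤ 1) : (1 + t) ^ q ≤ 1 + q * t + 4 ^ q * t ^ 2 := by
  induction q with
  | zero => simp; positivity
  | succ q ih =>
    have hq : (q : ℝ) ≤ 4 ^ q := by
      have : q < 4 ^ q := Nat.lt_pow_self (by norm_num)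
      exact_mod_cast this.le
    have h4 : (0 : ℝ) < 4 ^ q := by positivity
    calc (1 + t) ^ (q + 1) = (1 + t) ^ q * (1 + t) := pow_succ _ _
      _ ≤ (1 + q * t + 4 ^ q * t ^ 2) * (1 + t) := by
        apply mul_le_mul_of_nonneg_right ih; linarith
      _ = 1 + (q + 1) * t + (q + 4 ^ q + 4 ^ q * t) * t ^ 2 := by ring
      _ ≤ 1 + (q + 1) * t + (4 ^ (q + 1)) * t ^ 2 := by
        have : (q + 4 ^ q + 4 ^ q * t : ℝ) ≤ 4 ^ (q + 1) := by
          rw [pow_succ]; nlinarith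
        gcongr
      _ = _ := by push_cast; ring

def cq (q : ℕ) : ℝ := 4 ^ q + q

lemma cq_one (q : ℕ) : 1 ≤ cq q := by
  have : (1 : ℝ) ≤ 4 ^ q := one_le_pow₀ (by norm_num)
  have : (0 : ℝ) ≤ q := Nat.cast_nonneg q
  unfold cq; linarith

lemma elem2 (q : ℕ) (hq : 1 ≤ q) (t : ℝ) : |1 + t| ^ q ≤ 1 + q * t + cq q * (t ^ 2 + |t| ^ q) := by
  have hq0 : (0 : ℝ) ≤ q := Nat.cast_nonneg q
  have h4 : (0 : ℝ) < 4 ^ q := by positivity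
  have htq : 0 ≤ |t| ^ q := by positivity
  rcases le_or_gt |t| 1 with h | h
  · rw [abs_le] at h
    rw [abs_of_nonneg (by linarith)]
    refine (elem1 q t h.1 h.2).trans ?_
    unfold cq
    nlinarith [sq_nonneg t, mul_nonneg hq0 (sq_nonneg t), mul_nonneg h4.le htq, mul_nonneg hq0 htq]
  · have h1 : |1 + t| ^ q ≤ 4 ^ q * |t| ^ q := by
      rw [← mul_pow]
      gcongr
      refine (abs_add_le _ _).trans ?_
      rw [abs_one]; linarith
    have h2 : |t| ≤ |t| ^ q := by
      calc |t| = |t| ^ 1 := (pow_one _).symm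
        _ ≤ |t| ^ q := pow_le_pow_right₀ h.le hq
    have h3 : -(q * t) ≤ q * |t| ^ q := by
      rw [← mul_neg]
      exact mul_le_mul_of_nonneg_left ((neg_le_abs t).trans h2) hq0
    have h5 : 0 ≤ cq q * t ^ 2 := mul_nonneg (zero_le_one.trans (cq_one q)) (sq_nonneg t)
    have : cq q * (t ^ 2 + |t| ^ q) = cq q * t ^ 2 + 4 ^ q * |t| ^ q + q * |t| ^ q := by unfold cq; ring
    rw [this]; linarith

lemma elem3 (r : ℕ) (x y : ℝ) : |x + y| ^ (r + 2) ≤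
    |x| ^ (r + 2) + (r + 2 : ℕ) * (x * |x| ^ r * y) + cq (r + 2) * (|x| ^ r * y ^ 2 + |y| ^ (r + 2)) := by
  by_cases hx : x = 0
  · subst hx
    have h1 : 0 ≤ |y| ^ (r + 2) := by positivity
    have h2 : 0 ≤ |(0 : ℝ)| ^ r * y ^ 2 := by positivity
    have := cq_one (r + 2)
    simp only [zero_add, zero_mul, mul_zero, abs_zero] at *
    rw [zero_pow (by omega)]
    nlinarith
  have h := elem2 (r + 2) (by omega) (y / x)
  have hx' : 0 < |x| := abs_pos.2 hx
  have h' := mul_le_mul_of_nonneg_left h (show 0 ≤ |x| ^ (r + 2) by positivity)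
  have e1 : |x| ^ (r + 2) * |1 + y / x| ^ (r + 2) = |x + y| ^ (r + 2) := by
    rw [← mul_pow, ← abs_mul, mul_add, mul_one, mul_div_cancel₀ _ hx]
  rw [e1] at h'
  refine h'.trans (le_of_eq ?_)
  have e2 : |x| ^ (r + 2) = |x| ^ r * x ^ 2 := by rw [pow_add, sq_abs]
  have e3 : |y / x| ^ (r + 2) * |x| ^ (r + 2) = |y| ^ (r + 2) := by
    rw [← mul_pow, ← abs_mul, div_mul_cancel₀ _ hx]
  have e4 : |x| ^ (r + 2) * (y / x) ^ 2 = |x| ^ r * y ^ 2 := by rw [e2]; field_simp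
  have e5 : |x| ^ (r + 2) * (y / x) = x * |x| ^ r * y := by rw [e2]; field_simp
  linear_combination ((r + 2 : ℕ) : ℝ) * e5 + cq (r + 2) * e4 + cq (r + 2) * e3

lemma elem4 (r : ℕ) (x y : ℝ) {l : ℝ} (hl : 0 < l) :
    |x| ^ r * y ^ 2 ≤ l ^ r * (|x| ^ (r + 2) / l ^ (r + 2) + |y| ^ (r + 2)) := by
  rw [← sq_abs y]
  have hx := abs_nonneg x
  have hy := abs_nonneg y
  rcases le_total |x| (l * |y|) with h | h
  · calc |x| ^ r * |y| ^ 2 ≤ (l * |y|) ^ r * |y| ^ 2 := by gcongr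
      _ = l ^ r * |y| ^ (r + 2) := by rw [mul_pow]; ring
      _ ≤ _ := by
        gcongr
        have : 0 ≤ |x| ^ (r + 2) / l ^ (r + 2) := by positivity
        linarith
  · have h' : |y| ≤ |x| / l := by rw [le_div_iff₀ hl]; linarith
    calc |x| ^ r * |y| ^ 2 ≤ |x| ^ r * (|x| / l) ^ 2 := by gcongr
      _ = l ^ r * (|x| ^ (r + 2) / l ^ (r + 2)) := by field_simp; ring
      _ ≤ _ := by
        gcongr
        have : 0 ≤ |y| ^ (r + 2) := by positivity
        linarith

lemma elem5 (r : ℕ) (x y : ℝ) : |x * |x| ^ r * y| ≤ |x| ^ (r + 2) + |y| ^ (r + 2) := by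
  have hx := abs_nonneg x
  have hy := abs_nonneg y
  rw [abs_mul, abs_mul, abs_pow, abs_abs]
  rcases le_total |x| |y| with h | h
  · have : |x| * |x| ^ r * |y| ≤ |y| * |y| ^ r * |y| := by gcongr
    have e : |y| * |y| ^ r * |y| = |y| ^ (r + 2) := by ring
    have : 0 ≤ |x| ^ (r + 2) := by positivity
    linarith
  · have : |x| * |x| ^ r * |y| ≤ |x| * |x| ^ r * |x| := by gcongr
    have e : |x| * |x| ^ r * |x| = |x| ^ (r + 2) := by ring
    have : 0 ≤ |y| ^ (r + 2) := by positivity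
    linarith

lemma step_bound (hT : MeasurePreserving T μ μ) (r : ℕ) [hq : Fact ((1 : ℝ≥0∞) ≤ (r + 2 : ℕ))]
    (D S : Lp ℝ (r + 2 : ℕ) μ) (hD : tr hT (r + 2 : ℕ) D = 0) {l : ℝ} (hl : 0 < l) :
    ‖D + Koop hT (r + 2 : ℕ) S‖ ^ (r + 2) ≤ ‖S‖ ^ (r + 2) +
      cq (r + 2) * (l ^ r * (‖S‖ ^ (r + 2) / l ^ (r + 2) + ‖D‖ ^ (r + 2)) + ‖D‖ ^ (r + 2)) := by
  set Z := Koop hT (r + 2 : ℕ) S with hZ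
  have hZn : ‖S‖ = ‖Z‖ := (Koop_norm hT _ S).symm
  have hDc : μ[(D : X → ℝ) | MeasurableSpace.comap T inferInstance] =ᵐ[μ] 0 := by
    have := tr_spec hT (r + 2 : ℕ) D
    rw [hD, map_zero] at this
    exact this.symm.trans (Lp.coeFn_zero _ _ _)
  have hiZ := integrable_abs_pow (r + 2) Z
  have hiD := integrable_abs_pow (r + 2) D
  have hmul : Integrable (fun x => Z x * |Z x| ^ r * D x) μ := by
    refine Integrable.mono' (hiZ.add hiD) ?_ (Eventually.of_forall fun x => elem5 r _ _)
    have h1 := (Lp.stronglyMeasurable Z).measurable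
    have h2 := (Lp.stronglyMeasurable D).measurable
    have : Measurable fun x => Z x * |Z x| ^ r * D x := by fun_prop
    exact this.aestronglyMeasurable
  have hzero : ∫ x, Z x * |Z x| ^ r * D x ∂μ = 0 := by
    have hae : (fun x => Z x * |Z x| ^ r * D x) =ᵐ[μ] (fun x => S (T x) * |S (T x)| ^ r) * (D : X → ℝ) := by
      filter_upwards [Koop_coe hT (r + 2 : ℕ) S] with x hx
      rw [hZ, hx]; rfl
    have hsm : StronglyMeasurable[MeasurableSpace.comap T inferInstance]
        (fun x => (S : X → ℝ) (T x) * |(S : X → ℝ) (T x)| ^ r) := by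
      have h1 : Measurable fun z : X => (S : X → ℝ) z * |(S : X → ℝ) z| ^ r := by
        have h1 := (Lp.stronglyMeasurable S).measurable
        fun_prop
      exact h1.stronglyMeasurable.comp_measurable (comap_measurable T)
    have h1 := condExp_mul_of_stronglyMeasurable_left hsm (hmul.congr hae) (Lp_integrable D)
    rw [integral_congr_ae hae, ← integral_condExp (μ := μ) hT.measurable.comap_le, integral_congr_ae h1]
    refine integral_eq_zero_of_ae ?_
    filter_upwards [hDc] with x hx
    simp [hx]
  rw [hZn, norm_pow_eq, norm_pow_eq, norm_pow_eq]
  have hpt : ∀ᵐ x ∂μ, |(D + Z : Lp ℝ (r + 2 : ℕ) μ) x| ^ (r + 2) ≤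
      (1 + cq (r + 2) * (l ^ r / l ^ (r + 2))) * |Z x| ^ (r + 2)
      + (r + 2 : ℕ) * (Z x * |Z x| ^ r * D x) + (cq (r + 2) * (l ^ r + 1)) * |D x| ^ (r + 2) := by
    filter_upwards [Lp.coeFn_add D Z] with x hx
    rw [hx, Pi.add_apply, add_comm]
    refine (elem3 r _ _).trans ?_
    have h1 := mul_le_mul_of_nonneg_left (elem4 r (Z x) (D x) hl) (zero_le_one.trans (cq_one (r + 2)))
    have e : cq (r + 2) * (l ^ r * (|Z x| ^ (r + 2) / l ^ (r + 2) + |D x| ^ (r + 2))) =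
      cq (r + 2) * (l ^ r / l ^ (r + 2)) * |Z x| ^ (r + 2) + cq (r + 2) * l ^ r * |D x| ^ (r + 2) := by ring
    rw [e] at h1
    linarith
  have i1 := hiZ.const_mul (1 + cq (r + 2) * (l ^ r / l ^ (r + 2)))
  have i2 := hmul.const_mul ((r + 2 : ℕ) : ℝ)
  have i3 := hiD.const_mul (cq (r + 2) * (l ^ r + 1))
  have i12 : Integrable (fun x => (1 + cq (r + 2) * (l ^ r / l ^ (r + 2))) * |Z x| ^ (r + 2)
      + (r + 2 : ℕ) * (Z x * |Z x| ^ r * D x)) μ := i1.add i2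
  have i123 : Integrable (fun x => (1 + cq (r + 2) * (l ^ r / l ^ (r + 2))) * |Z x| ^ (r + 2)
      + (r + 2 : ℕ) * (Z x * |Z x| ^ r * D x) + (cq (r + 2) * (l ^ r + 1)) * |D x| ^ (r + 2)) μ := i12.add i3
  refine (integral_mono_ae (integrable_abs_pow (r + 2) (D + Z)) i123 hpt).trans ?_
  rw [integral_add i12 i3, integral_add i1 i2, integral_const_mul, integral_const_mul, integral_const_mul, hzero]
  apply le_of_eq; ring

def A (hT : MeasurePreserving T μ μ) (p : ℝ≥0∞) [Fact (1 ≤ p)] (n : ℕ) : Lp ℝ p μ →L[ℝ] Lp ℝ p μ :=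
  ∑ k ∈ Finset.range n, Koop hT p ^ k

lemma A_succ (hT : MeasurePreserving T μ μ) (p : ℝ≥0∞) [Fact (1 ≤ p)] (n : ℕ) (f : Lp ℝ p μ) :
    A hT p (n + 1) f = f + Koop hT p (A hT p n f) := by
  unfold A
  rw [Finset.sum_range_succ', add_comm, pow_zero]
  simp only [pow_succ', ← Finset.mul_sum]
  rfl

lemma A_bound (hT : MeasurePreserving T μ μ) (r : ℕ) [hq : Fact ((1 : ℝ≥0∞) ≤ (r + 2 : ℕ))] :
    ∃ K : ℝ, 0 ≤ K ∧ ∀ (n : ℕ) (D : Lp ℝ (r + 2 : ℕ) μ), tr hT (r + 2 : ℕ) D = 0 →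
      ‖A hT (r + 2 : ℕ) (n + 1) D‖ ^ (r + 2) ≤ K * (n + 1 : ℝ) ^ (r + 1) * ‖D‖ ^ (r + 2) := by
  set C := cq (r + 2) with hC
  have hC1 : 1 ≤ C := cq_one _
  set l0 := 2 * C with hl0
  set K := 2 * (C * l0 ^ r + C) + 1 with hK
  have hl0' : 0 < l0 := by positivity
  have hK1 : 1 ≤ K := by have : 0 ≤ C * l0 ^ r + C := by positivity
                         linarith
  refine ⟨K, by linarith, fun n D hD => ?_⟩
  set b := ‖D‖ ^ (r + 2) with hb
  have hb0 : 0 ≤ b := by positivity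
  induction n with
  | zero =>
    rw [A_succ]
    simp only [A, Finset.range_zero, Finset.sum_empty, zero_apply, map_zero, add_zero]
    simp only [Nat.cast_zero, zero_add, one_pow, mul_one]
    nlinarith
  | succ n ih =>
    rw [A_succ]
    set N : ℝ := (n : ℝ) + 1 with hN
    have hN1 : 1 ≤ N := by have : (0 : ℝ) ≤ n := Nat.cast_nonneg n
                           linarith
    have hN0 : 0 < N := by linarith
    refine (step_bound hT r D (A hT (r + 2 : ℕ) (n + 1) D) hD (l := l0 * N) (by positivity)).trans ?_
    set a := ‖A hT (r + 2 : ℕ) (n + 1) D‖ ^ (r + 2) with ha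
    rw [← hC, ← hb]
    have hcast : ((n + 1 : ℕ) : ℝ) = N := by push_cast; rfl
    rw [hcast]
    have e1 : (l0 * N) ^ r * (a / (l0 * N) ^ (r + 2) + b) = a / (l0 * N) ^ 2 + l0 ^ r * N ^ r * b := by
      field_simp; ring
    rw [e1]
    have h1 : C * (a / (l0 * N) ^ 2) ≤ K / 2 * N ^ r * b := by
      have : C * (a / (l0 * N) ^ 2) ≤ C * ((K * N ^ (r + 1) * b) / (l0 * N) ^ 2) := by gcongr
      refine this.trans ?_
      have e : C * ((K * N ^ (r + 1) * b) / (l0 * N) ^ 2) = K * N ^ r * b * (1 / (4 * C * N)) := by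
        rw [hl0]; field_simp; ring
      rw [e]
      have h5 : 1 / (4 * C * N) ≤ 1 / 2 := by
        apply one_div_le_one_div_of_le (by norm_num); nlinarith
      have : K * N ^ r * b * (1 / (4 * C * N)) ≤ K * N ^ r * b * (1 / 2) := by gcongr
      linarith
    have hNr : 1 ≤ N ^ r := one_le_pow₀ hN1
    have h2 : C * (l0 ^ r * N ^ r * b) + C * b ≤ K / 2 * N ^ r * b := by
      have : C * b ≤ C * N ^ r * b := by
        have := mul_le_mul_of_nonneg_left hNr (mul_nonneg (zero_le_one.trans hC1) hb0)
        linarith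
      have e : K / 2 * N ^ r * b = C * (l0 ^ r * N ^ r * b) + C * N ^ r * b + N ^ r * b / 2 := by
        rw [hK]; ring
      have : 0 ≤ N ^ r * b / 2 := by positivity
      linarith
    have h3 : K * N ^ (r + 1) * b + K * N ^ r * b ≤ K * (N + 1) ^ (r + 1) * b := by
      have : N ^ (r + 1) + N ^ r ≤ (N + 1) ^ (r + 1) := by
        calc N ^ (r + 1) + N ^ r = N ^ r * (N + 1) := by ring
          _ ≤ (N + 1) ^ r * (N + 1) := by gcongr; linarith
          _ = _ := (pow_succ _ _).symm
      have := mul_le_mul_of_nonneg_left this (show 0 ≤ K * b by positivity)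
      linarith
    have e2 : C * (a / (l0 * N) ^ 2 + l0 ^ r * N ^ r * b + b) = C * (a / (l0 * N) ^ 2) + (C * (l0 ^ r * N ^ r * b) + C * b) := by ring
    rw [e2]
    linarith

/-- Telescoping of `A_n (V - 1)`. -/
lemma A_tel (hT : MeasurePreserving T μ μ) (p : ℝ≥0∞) [Fact (1 ≤ p)] (n : ℕ) :
    A hT p n * (Koop hT p - 1) = Koop hT p ^ n - 1 := geom_sum_mul _ _

lemma A_norm (hT : MeasurePreserving T μ μ) (r : ℕ) [hq : Fact ((1 : ℝ≥0∞) ≤ (r + 2 : ℕ))] :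
    ∃ K : ℝ, 0 ≤ K ∧ ∀ n : ℕ,
      ‖A hT (r + 2 : ℕ) (n + 1) * (1 - tr hT (r + 2 : ℕ))‖ ^ (r + 2) ≤ K * (n + 1 : ℝ) ^ (r + 1) := by
  obtain ⟨K, hK0, hK⟩ := A_bound (μ := μ) hT r
  refine ⟨(2 : ℝ) ^ (r + 2) * (K * 2 ^ (r + 2) + 2 ^ (r + 2)), by positivity, fun n => ?_⟩
  set N : ℝ := (n : ℝ) + 1 with hN
  have hN1 : 1 ≤ N := by have : (0 : ℝ) ≤ n := Nat.cast_nonneg n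
                         linarith
  have hN0 : 0 < N := by linarith
  set V := Koop hT (r + 2 : ℕ)
  set W := tr hT (r + 2 : ℕ)
  set M := (2 : ℝ) ^ (r + 2) * (K * 2 ^ (r + 2) + 2 ^ (r + 2)) * N ^ (r + 1) with hM
  have hM0 : 0 ≤ M := by positivity
  have hbd : ‖A hT (r + 2 : ℕ) (n + 1) * (1 - W)‖ ≤ M ^ (((r + 2 : ℕ) : ℝ)⁻¹) := by
    refine ContinuousLinearMap.opNorm_le_bound _ (by positivity) fun f => ?_
    have hp : ‖(A hT (r + 2 : ℕ) (n + 1) * (1 - W)) f‖ ^ (r + 2) ≤ M * ‖f‖ ^ (r + 2) := by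
      have e : A hT (r + 2 : ℕ) (n + 1) * (1 - W) = A hT (r + 2 : ℕ) (n + 1) * (1 - V * W) + (V ^ (n + 1) - 1) * W := by
        rw [← A_tel]; noncomm_ring
      rw [e, add_apply]
      have hWf : ‖W f‖ ≤ ‖f‖ := by simpa using W.le_of_opNorm_le (tr_norm hT _) f
      have hVW : ‖V (W f)‖ ≤ ‖f‖ := by rw [Koop_norm]; exact hWf
      have h1 := hK n (f - V (W f)) (by rw [map_sub, tr_Koop, sub_self])
      have h2 : ‖f - V (W f)‖ ≤ 2 * ‖f‖ := (norm_sub_le _ _).trans (by linarith)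
      have h3 : ‖((V ^ (n + 1) - 1) * W) f‖ ≤ 2 * ‖f‖ := by
        rw [mul_apply_eq_comp, sub_apply]
        have hVn : ∀ k (g : Lp ℝ (r + 2 : ℕ) μ), ‖(V ^ k) g‖ = ‖g‖ := by
          intro k g
          induction k with
          | zero => rfl
          | succ k ih => rw [pow_succ', mul_apply_eq_comp, Koop_norm, ih]
        refine (norm_sub_le _ _).trans ?_
        rw [hVn]
        change ‖W f‖ + ‖W f‖ ≤ _
        linarith
      have e2 : (A hT (r + 2 : ℕ) (n + 1) * (1 - V * W)) f = A hT (r + 2 : ℕ) (n + 1) (f - V (W f)) := rfl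
      rw [e2]
      set a := ‖A hT (r + 2 : ℕ) (n + 1) (f - V (W f))‖
      set c := ‖((V ^ (n + 1) - 1) * W) f‖
      have ha0 : 0 ≤ a := norm_nonneg _
      have hc0 : 0 ≤ c := norm_nonneg _
      have h4 : (a + c) ^ (r + 2) ≤ 2 ^ (r + 2) * (a ^ (r + 2) + c ^ (r + 2)) := by
        rcases le_total a c with h | h
        · have : (a + c) ^ (r + 2) ≤ (2 * c) ^ (r + 2) := by gcongr; linarith
          rw [mul_pow] at this
          have : 0 ≤ (2 : ℝ) ^ (r + 2) * a ^ (r + 2) := by positivity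
          linarith
        · have : (a + c) ^ (r + 2) ≤ (2 * a) ^ (r + 2) := by gcongr; linarith
          rw [mul_pow] at this
          have : 0 ≤ (2 : ℝ) ^ (r + 2) * c ^ (r + 2) := by positivity
          linarith
      have h5 : a ^ (r + 2) ≤ K * N ^ (r + 1) * (2 * ‖f‖) ^ (r + 2) := h1.trans (by gcongr)
      have h6 : c ^ (r + 2) ≤ (2 * ‖f‖) ^ (r + 2) := by gcongr
      have h7 : (2 * ‖f‖) ^ (r + 2) ≤ N ^ (r + 1) * (2 * ‖f‖) ^ (r + 2) :=
        le_mul_of_one_le_left (by positivity) (one_le_pow₀ hN1)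
      calc _ ≤ (a + c) ^ (r + 2) := by gcongr; exact norm_add_le _ _
        _ ≤ 2 ^ (r + 2) * (a ^ (r + 2) + c ^ (r + 2)) := h4
        _ ≤ 2 ^ (r + 2) * (K * N ^ (r + 1) * (2 * ‖f‖) ^ (r + 2) + N ^ (r + 1) * (2 * ‖f‖) ^ (r + 2)) := by
          gcongr; linarith
        _ = M * ‖f‖ ^ (r + 2) := by rw [hM, mul_pow 2 ‖f‖]; ring
    have h8 := Real.rpow_le_rpow (by positivity) hp (show (0 : ℝ) ≤ ((r + 2 : ℕ) : ℝ)⁻¹ by positivity)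
    rwa [Real.pow_rpow_inv_natCast (norm_nonneg _) (by omega), Real.mul_rpow hM0 (by positivity),
      Real.pow_rpow_inv_natCast (norm_nonneg _) (by omega)] at h8
  calc _ ≤ (M ^ (((r + 2 : ℕ) : ℝ)⁻¹)) ^ (r + 2) := by gcongr
    _ = M := Real.rpow_inv_natCast_pow hM0 (by omega)

end Part10

section Part11
variable {X : Type} [MeasurableSpace X]
variable {μ : Measure X} {T : X → X}
variable {d : ℕ} {p : ℝ≥0∞} [Fact (1 ≤ p)]
  {E : Type} [NormedAddCommGroup E] [NormedSpace ℝ E] [CompleteSpace E]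
  {tp : ContinuousMultilinearMap ℝ (fun _ : Fin d => Lp ℝ p μ) E}

lemma tp_norm (h : IsPTP μ (fun _ : Fin d => p) E tp) : ‖tp‖ ≤ 1 :=
  ContinuousMultilinearMap.opNorm_le_bound zero_le_one fun f => by rw [one_mul, h.crossNorm]

lemma tens_exists (h : IsPTP μ (fun _ : Fin d => p) E tp) (B : Fin d → Lp ℝ p μ →L[ℝ] Lp ℝ p μ) :
    ∃ L : E →L[ℝ] E, (∀ f, L (tp f) = tp fun i => B i (f i)) ∧ ‖L‖ ≤ ∏ i, ‖B i‖ := by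
  obtain ⟨L, hL, hn⟩ := h.lift E (tp.compContinuousLinearMap B)
  refine ⟨L, fun f => hL f, ?_⟩
  rw [hn]
  refine (ContinuousMultilinearMap.norm_compContinuousLinearMap_le tp B).trans ?_
  exact mul_le_of_le_one_left (Finset.prod_nonneg fun i _ => norm_nonneg _) (tp_norm h)

def tens (h : IsPTP μ (fun _ : Fin d => p) E tp) (B : Fin d → Lp ℝ p μ →L[ℝ] Lp ℝ p μ) : E →L[ℝ] E :=
  (tens_exists h B).choose

lemma tens_tp (h : IsPTP μ (fun _ : Fin d => p) E tp) (B : Fin d → Lp ℝ p μ →L[ℝ] Lp ℝ p μ)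
    (f : Fin d → Lp ℝ p μ) : tens h B (tp f) = tp fun i => B i (f i) :=
  (tens_exists h B).choose_spec.1 f

lemma tens_norm (h : IsPTP μ (fun _ : Fin d => p) E tp) (B : Fin d → Lp ℝ p μ →L[ℝ] Lp ℝ p μ) :
    ‖tens h B‖ ≤ ∏ i, ‖B i‖ := (tens_exists h B).choose_spec.2

lemma tens_ext {F : Type} [NormedAddCommGroup F] [NormedSpace ℝ F]
    (h : IsPTP μ (fun _ : Fin d => p) E tp) {L M : E →L[ℝ] F}
    (hLM : ∀ f : Fin d → Lp ℝ p μ, L (tp f) = M (tp f)) : L = M := by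
  refine ContinuousLinearMap.ext_on h.denseSpan ?_
  rintro _ ⟨f, rfl⟩
  exact hLM f

lemma tens_mul (h : IsPTP μ (fun _ : Fin d => p) E tp) (B C : Fin d → Lp ℝ p μ →L[ℝ] Lp ℝ p μ) :
    tens h B * tens h C = tens h fun i => B i * C i :=
  tens_ext h fun f => by
    rw [mul_apply_eq_comp, tens_tp, tens_tp, tens_tp]; rfl

lemma tens_one (h : IsPTP μ (fun _ : Fin d => p) E tp) : tens h (fun _ => 1) = 1 :=
  tens_ext h fun f => by rw [tens_tp]; rfl

lemma tens_sum (h : IsPTP μ (fun _ : Fin d => p) E tp) (B : ℕ → Lp ℝ p μ →L[ℝ] Lp ℝ p μ)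
    (s : Fin d → Finset ℕ) :
    tens h (fun i => ∑ k ∈ s i, B k) = ∑ k ∈ Fintype.piFinset s, tens h fun i => B (k i) := by
  refine tens_ext h fun f => ?_
  rw [tens_tp, sum_apply]
  simp only [tens_tp, sum_apply]
  exact tp.map_sum_finset (fun i k => B k (f i)) s

lemma tens_add (h : IsPTP μ (fun _ : Fin d => p) E tp) (B C : Fin d → Lp ℝ p μ →L[ℝ] Lp ℝ p μ) :
    tens h (fun i => B i + C i) = ∑ S : Finset (Fin d), tens h (S.piecewise B C) := by
  refine tens_ext h fun f => ?_
  rw [tens_tp, sum_apply]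
  have := tp.map_add_univ (fun i => B i (f i)) (fun i => C i (f i))
  refine Eq.trans this (Finset.sum_congr rfl fun S _ => ?_)
  rw [tens_tp]
  congr 1
  ext1 i
  by_cases hi : i ∈ S <;> simp [hi]

lemma tens_smul (h : IsPTP μ (fun _ : Fin d => p) E tp) (c : Fin d → ℝ) (B : Fin d → Lp ℝ p μ →L[ℝ] Lp ℝ p μ) :
    tens h (fun i => c i • B i) = (∏ i, c i) • tens h B := by
  refine tens_ext h fun f => ?_
  rw [tens_tp, smul_apply, tens_tp]
  exact tp.map_smul_univ c (fun i => B i (f i))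

lemma tendsto_dense (h : IsPTP μ (fun _ : Fin d => p) E tp) (L : ℕ → E →L[ℝ] E) (M : E →L[ℝ] E) {C : ℝ}
    (hC : ∀ n, ‖L n‖ ≤ C) (hM : ‖M‖ ≤ C)
    (hlim : ∀ f : Fin d → Lp ℝ p μ, Tendsto (fun n => L n (tp f)) atTop (𝓝 (M (tp f)))) (x : E) :
    Tendsto (fun n => L n x) atTop (𝓝 (M x)) := by
  have hspan : ∀ y ∈ Submodule.span ℝ (Set.range fun f : Fin d → Lp ℝ p μ => tp f),
      Tendsto (fun n => L n y) atTop (𝓝 (M y)) := by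
    intro y hy
    induction hy using Submodule.span_induction with
    | mem y hy => obtain ⟨f, rfl⟩ := hy; exact hlim f
    | zero => simp
    | add a b _ _ ha hb => simp only [map_add]; exact ha.add hb
    | smul c a _ ha => simp only [map_smul]; exact ha.const_smul c
  have hC0 : 0 ≤ C := (norm_nonneg _).trans hM
  rw [Metric.tendsto_atTop]
  intro ε hε
  obtain ⟨y, hy, hxy⟩ := Metric.mem_closure_iff.1 (h.denseSpan x) (ε / (3 * (C + 1))) (by positivity)
  obtain ⟨N, hN⟩ := Metric.tendsto_atTop.1 (hspan y hy) (ε / 3) (by positivity)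
  refine ⟨N, fun n hn => ?_⟩
  have h1 := hN n hn
  have h2 := (L n).le_of_opNorm_le (hC n) (x - y)
  have h3 := M.le_of_opNorm_le hM (x - y)
  rw [dist_eq_norm] at *
  rw [map_sub] at h2 h3
  have h4 : C * ‖x - y‖ ≤ ε / 3 := by
    rw [lt_div_iff₀ (by positivity)] at hxy
    nlinarith [norm_nonneg (x - y)]
  have e : L n x - M x = (L n x - L n y) + (L n y - M y) - (M x - M y) := by abel
  rw [e]
  refine (norm_sub_le _ _).trans_lt ?_
  have := norm_add_le (L n x - L n y) (L n y - M y)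
  linarith

variable [IsProbabilityMeasure μ]

lemma WK_eq (hT : MeasurePreserving T μ μ) (h : IsPTP μ (fun _ : Fin d => p) E tp) {k : Fin d → ℕ}
    {W : E →L[ℝ] E} (hW : IsTKoop μ (fun _ : Fin d => p) tp (fun _ => T) k W) :
    W = tens h fun i => Koop hT p ^ (k i) :=
  tens_ext h fun f => by
    rw [tens_tp]
    exact hW f _ fun i => Koop_pow_coe hT p (f i) (k i)

lemma WT_eq (hT : MeasurePreserving T μ μ) (h : IsPTP μ (fun _ : Fin d => p) E tp) {k : Fin d → ℕ}
    {W : E →L[ℝ] E} (hW : IsTTrans μ (fun _ : Fin d => p) tp (fun _ => T) k W) :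
    W = tens h fun i => tr hT p ^ (k i) :=
  tens_ext h fun f => by
    rw [tens_tp]
    exact hW f _ fun i => tr_isTransfer hT p (k i) (f i)

lemma diag_tendsto (d : ℕ) : Tendsto (fun N : ℕ => fun _ : Fin d => N) atTop atTop := by
  rw [tendsto_atTop_atTop]
  intro b
  exact ⟨Finset.univ.sup b, fun a ha i => (Finset.le_sup (Finset.mem_univ i)).trans ha⟩

lemma rho_eq (hT : MeasurePreserving T μ μ) (h : IsPTP μ (fun _ : Fin d => p) E tp)
    (hlim : ∀ f : Lp ℝ p μ, Tendsto (fun N : ℕ => (tr hT p ^ N) f) atTop (𝓝 (Pm μ p f)))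
    {ρ g : E} (hs : Tendsto (fun N : ℕ => tens h (fun _ => ∑ k ∈ Finset.range N, tr hT p ^ k) ρ) atTop (𝓝 g)) :
    ρ = tens h (fun _ => 1 - tr hT p) g := by
  set W := tr hT p with hW
  set P := Pm μ p with hP
  have hPQ : ∀ N : ℕ, P * (∑ k ∈ Finset.range N, W ^ k) = (N : ℝ) • P := by
    intro N
    rw [Finset.mul_sum]
    simp only [hW, hP, Pm_tr_pow]
    rw [Finset.sum_const, Finset.card_range, Nat.cast_smul_eq_nsmul]
  have hWQ : ∀ N : ℕ, (1 - W) * (∑ k ∈ Finset.range N, W ^ k) = 1 - W ^ N := fun N => mul_neg_geom_sum W N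
  have key : ∀ (S : Finset (Fin d)) (N : ℕ), tens h (S.piecewise (fun _ => P) (fun _ => 1 - W))
      (tens h (fun _ => ∑ k ∈ Finset.range N, W ^ k) ρ) =
      (N : ℝ) ^ S.card • tens h (S.piecewise (fun _ => P) (fun _ => 1 - W ^ N)) ρ := by
    intro S N
    rw [← mul_apply_eq_comp, tens_mul]
    have e : (fun i => (S.piecewise (fun _ => P) (fun _ => 1 - W) i : Lp ℝ p μ →L[ℝ] Lp ℝ p μ) * ∑ k ∈ Finset.range N, W ^ k)
        = fun i => (S.piecewise (fun _ => (N : ℝ)) (fun _ => 1) i : ℝ) • (S.piecewise (fun _ => P) (fun _ => 1 - W ^ N) i : Lp ℝ p μ →L[ℝ] Lp ℝ p μ) := by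
      ext1 i
      by_cases hi : i ∈ S
      · simp only [Finset.piecewise_eq_of_mem _ _ _ hi, hPQ]
      · simp only [Finset.piecewise_eq_of_notMem _ _ _ hi, hWQ, one_smul]
    rw [e, tens_smul, smul_apply]
    congr 1
    rw [Finset.prod_piecewise]
    simp
  have hW1 : ∀ N : ℕ, ‖W ^ N‖ ≤ 1 := fun N =>
    ContinuousLinearMap.opNorm_le_bound _ zero_le_one fun f => by
      rw [one_mul]; exact tr_pow_norm hT p N f
  have h1W : ∀ N : ℕ, ‖1 - W ^ N‖ ≤ 2 := fun N => by
    have h1 : ‖(1 : Lp ℝ p μ →L[ℝ] Lp ℝ p μ)‖ ≤ 1 := ContinuousLinearMap.norm_id_le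
    have := norm_sub_le 1 (W ^ N)
    linarith [hW1 N]
  have h1P : ‖1 - P‖ ≤ 2 := by
    have h1 : ‖(1 : Lp ℝ p μ →L[ℝ] Lp ℝ p μ)‖ ≤ 1 := ContinuousLinearMap.norm_id_le
    have := norm_sub_le 1 P
    linarith [Pm_norm (μ := μ) p]
  have hPn : ‖P‖ ≤ 2 := (Pm_norm (μ := μ) p).trans (by norm_num)
  have hbd : ∀ (S : Finset (Fin d)) (B C : Lp ℝ p μ →L[ℝ] Lp ℝ p μ), ‖B‖ ≤ 2 → ‖C‖ ≤ 2 →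
      ‖tens h (S.piecewise (fun _ => B) (fun _ => C))‖ ≤ 2 ^ d := by
    intro S B C hB hC
    refine (tens_norm h _).trans ?_
    calc _ ≤ ∏ _i : Fin d, (2 : ℝ) := Finset.prod_le_prod (fun i _ => norm_nonneg _) fun i _ => by
          by_cases hi : i ∈ S <;> simp [hi, hB, hC]
      _ = 2 ^ d := by simp
  have hconv : ∀ S : Finset (Fin d), Tendsto (fun N : ℕ =>
      tens h (S.piecewise (fun _ => P) (fun _ => 1 - W ^ N)) ρ) atTop
      (𝓝 (tens h (S.piecewise (fun _ => P) (fun _ => 1 - P)) ρ)) := by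
    intro S
    refine tendsto_dense h _ _ (C := 2 ^ d) (fun N => hbd S _ _ hPn (h1W N)) (hbd S _ _ hPn h1P) (fun f => ?_) ρ
    simp only [tens_tp]
    refine (tp.cont.tendsto _).comp (tendsto_pi_nhds.2 fun i => ?_)
    by_cases hi : i ∈ S
    · simp only [Finset.piecewise_eq_of_mem _ _ _ hi]; exact tendsto_const_nhds
    · simp only [Finset.piecewise_eq_of_notMem _ _ _ hi, sub_apply]
      exact tendsto_const_nhds.sub (hlim (f i))
  have hLHS : ∀ S : Finset (Fin d), Tendsto (fun N : ℕ =>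
      (N : ℝ) ^ S.card • tens h (S.piecewise (fun _ => P) (fun _ => 1 - W ^ N)) ρ) atTop
      (𝓝 (tens h (S.piecewise (fun _ => P) (fun _ => 1 - W)) g)) := by
    intro S
    refine Tendsto.congr (fun N => key S N) ?_
    exact ((tens h (S.piecewise (fun _ => P) (fun _ => 1 - W))).continuous.tendsto g).comp hs
  have hS : ∀ S : Finset (Fin d), S ≠ ∅ → tens h (S.piecewise (fun _ => P) (fun _ => 1 - P)) ρ = 0 := by
    intro S hS
    have hc : S.card ≠ 0 := by rwa [Ne, Finset.card_eq_zero]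
    have h0 : Tendsto (fun N : ℕ => ((N : ℝ) ^ S.card)⁻¹) atTop (𝓝 0) :=
      tendsto_inv_atTop_zero.comp ((tendsto_pow_atTop hc).comp tendsto_natCast_atTop_atTop)
    have h1 := h0.smul (hLHS S)
    rw [zero_smul] at h1
    refine tendsto_nhds_unique (hconv S) (h1.congr' ?_)
    filter_upwards [eventually_ge_atTop 1] with N hN
    have : (N : ℝ) ≠ 0 := by positivity
    rw [smul_smul, inv_mul_cancel₀ (pow_ne_zero _ this), one_smul]
  have h0 : tens h (fun _ => 1 - P) ρ = tens h (fun _ => 1 - W) g := by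
    have a := hconv ∅
    have b := hLHS ∅
    simp only [Finset.card_empty, pow_zero, one_smul, Finset.piecewise_empty] at a b
    exact tendsto_nhds_unique a b
  have h1 : tens h (fun _ => P + (1 - P)) ρ = ρ := by
    have : (fun _ : Fin d => P + (1 - P)) = fun _ => 1 := by ext1; abel
    rw [this, tens_one]; rfl
  rw [tens_add h (fun _ => P) (fun _ => 1 - P), sum_apply,
    Finset.sum_eq_single ∅ (fun S _ hS' => hS S hS') (by simp), Finset.piecewise_empty, h0] at h1
  exact h1.symm

end Part11

section Part12
variable {X : Type} [MeasurableSpace X]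
variable {μ : Measure X} [IsProbabilityMeasure μ] {T : X → X}

/-- The first order term: reduction of `L_{1,π}(μ)` to `L_1(μ)`. -/
lemma m0 (hT : MeasurePreserving T μ μ) {p : ℝ≥0∞} (hp : p = 1) [Fact (1 ≤ p)]
    {E : Type} [NormedAddCommGroup E] [NormedSpace ℝ E] [CompleteSpace E]
    {tp : ContinuousMultilinearMap ℝ (fun _ : Fin 1 => Lp ℝ p μ) E}
    (h : IsPTP μ (fun _ : Fin 1 => p) E tp)
    (J : E →L[ℝ] Lp ℝ p (pm μ 1)) (hJ : IsEmbed μ (fun _ : Fin 1 => p) p tp J)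
    (D : E →L[ℝ] Lp ℝ 1 μ) (hD : IsDiag μ (fun _ : Fin 1 => p) 1 tp D)
    {ρ g : E} (R1 : (Fin 1 → X) → ℝ) (hρ : (J ρ : (Fin 1 → X) → ℝ) =ᵐ[pm μ 1] R1)
    (r1 : Lp ℝ 1 μ) (hr1 : (r1 : X → ℝ) =ᵐ[μ] fun x => R1 fun _ => x)
    (hg : ρ = tens h (fun _ => 1 - tr hT p) g) :
    r1 = D g - tr hT 1 (D g) ∧ ∀ n, D (tens h (fun _ => A hT p n) ρ) = A hT 1 n r1 := by
  subst hp
  have hDt : ∀ f : Fin 1 → Lp ℝ 1 μ, D (tp f) = f 0 := fun f => by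
    refine Lp.ext ((hD.2 f).trans ?_)
    filter_upwards with x
    simp
  have hB : ∀ (B : Lp ℝ 1 μ →L[ℝ] Lp ℝ 1 μ) (e : E), D (tens h (fun _ => B) e) = B (D e) := by
    intro B e
    have : D.comp (tens h (fun _ => B)) = B.comp D := tens_ext h fun f => by
      simp only [ContinuousLinearMap.comp_apply, tens_tp, hDt]
    exact congrArg (fun L : E →L[ℝ] Lp ℝ 1 μ => L e) this
  have hev : MeasurePreserving (fun x : Fin 1 → X => x 0) (pm μ 1) μ :=
    measurePreserving_eval (fun _ : Fin 1 => μ) 0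
  have hJD : ∀ e, J e = (Lp.compMeasurePreservingₗᵢ ℝ (fun x : Fin 1 → X => x 0) hev) (D e) := by
    intro e
    have : J = (Lp.compMeasurePreservingₗᵢ ℝ (fun x : Fin 1 → X => x 0) hev).toContinuousLinearMap.comp D := by
      refine tens_ext h fun f => ?_
      rw [ContinuousLinearMap.comp_apply, hDt]
      refine Lp.ext ((hJ f).trans ?_)
      refine EventuallyEq.trans ?_ (Lp.coeFn_compMeasurePreserving (f 0) hev).symm
      filter_upwards with x
      simp
    exact congrArg (fun L : E →L[ℝ] Lp ℝ 1 (pm μ 1) => L e) this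
  have hDρ : D ρ = r1 := by
    have h1 : (fun x : Fin 1 → X => (D ρ : X → ℝ) (x 0)) =ᵐ[pm μ 1] R1 := by
      rw [hJD] at hρ
      exact (Lp.coeFn_compMeasurePreserving (D ρ) hev).symm.trans hρ
    have hc : MeasurePreserving (fun x : X => fun _ : Fin 1 => x) μ (pm μ 1) := by
      have := (measurePreserving_funUnique μ (Fin 1)).symm
      exact this
    refine Lp.ext (EventuallyEq.trans ?_ hr1.symm)
    exact hc.quasiMeasurePreserving.ae_eq_comp h1
  constructor
  · rw [← hDρ, hg, hB]; rfl
  · intro n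
    rw [hB, hDρ]

lemma comb {M : Type*} [AddCommMonoid M] {m d : ℕ} (e : Fin m → Fin d) (he : Function.Injective e)
    (s : Finset ℕ) (G : (Fin m → ℕ) → M) :
    ∑ k ∈ Fintype.piFinset (fun _ : Fin d => s), G (fun j => k (e j)) =
      s.card ^ (d - m) • ∑ l ∈ Fintype.piFinset (fun _ : Fin m => s), G l := by
  classical
  have hmaps : ∀ k ∈ Fintype.piFinset (fun _ : Fin d => s),
      (fun j => k (e j)) ∈ Fintype.piFinset (fun _ : Fin m => s) := by
    intro k hk
    rw [Fintype.mem_piFinset] at *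
    exact fun j => hk _
  rw [← Finset.sum_fiberwise_of_maps_to hmaps, Finset.smul_sum]
  refine Finset.sum_congr rfl fun l hl => ?_
  rw [Finset.sum_congr rfl (g := fun _ => G l) (by
    intro k hk
    rw [Finset.mem_filter] at hk
    rw [hk.2]), Finset.sum_const]
  congr 1
  have hf : (Fintype.piFinset (fun _ : Fin d => s)).filter (fun k => (fun j => k (e j)) = l) =
      Fintype.piFinset (fun i : Fin d => if h : ∃ j, e j = i then {l h.choose} else s) := by
    ext k
    rw [Finset.mem_filter, Fintype.mem_piFinset, Fintype.mem_piFinset]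
    rw [Fintype.mem_piFinset] at hl
    constructor
    · rintro ⟨h1, rfl⟩ i
      split_ifs with h
      · rw [Finset.mem_singleton]
        exact (congrArg k h.choose_spec).symm
      · exact h1 i
    · intro h1
      have h2 : ∀ j, k (e j) = l j := by
        intro j
        have := h1 (e j)
        have hx : ∃ j', e j' = e j := ⟨j, rfl⟩
        rw [dif_pos hx, Finset.mem_singleton] at this
        rw [this, he hx.choose_spec]
      refine ⟨fun i => ?_, funext h2⟩
      by_cases h : ∃ j, e j = i
      · obtain ⟨j, rfl⟩ := h
        rw [h2]; exact hl j
      · have := h1 i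
        rwa [dif_neg h] at this
  rw [hf, Fintype.card_piFinset]
  have : ∀ i : Fin d, (if h : ∃ j, e j = i then ({l h.choose} : Finset ℕ) else s).card =
      if i ∈ Finset.univ.image e then 1 else s.card := by
    intro i
    by_cases h : ∃ j, e j = i
    · rw [dif_pos h, if_pos (by simpa using h), Finset.card_singleton]
    · rw [dif_neg h, if_neg (by simpa using h)]
  simp only [this]
  rw [Finset.prod_ite, Finset.prod_const_one, one_mul, Finset.prod_const]
  congr 1
  have : Finset.univ.filter (fun i : Fin d => i ∉ Finset.univ.image e) = (Finset.univ.image e)ᶜ := by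
    ext; simp
  rw [this, Finset.card_compl, Finset.card_image_of_injective _ he]
  simp

lemma decay (hT : MeasurePreserving T μ μ) (m : ℕ) [Fact ((1 : ℝ≥0∞) ≤ (m + 2 : ℕ))]
    {E : Type} [NormedAddCommGroup E] [NormedSpace ℝ E] [CompleteSpace E]
    {tp : ContinuousMultilinearMap ℝ (fun _ : Fin (m + 2) => Lp ℝ (m + 2 : ℕ) μ) E}
    (h : IsPTP μ (fun _ : Fin (m + 2) => ((m + 2 : ℕ) : ℝ≥0∞)) E tp)
    (D : E →L[ℝ] Lp ℝ 1 μ) (hD : ‖D‖ = 1) {ρ g : E}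
    (hg : ρ = tens h (fun _ => 1 - tr hT (m + 2 : ℕ)) g) :
    ∃ K : ℝ, 0 ≤ K ∧ ∀ n : ℕ, ‖D (tens h (fun _ => A hT (m + 2 : ℕ) (n + 1)) ρ)‖ ≤ K * ((n + 1 : ℕ) : ℝ) ^ (m + 1) := by
  obtain ⟨K, hK0, hK⟩ := A_norm (μ := μ) hT m
  refine ⟨K * ‖g‖, by positivity, fun n => ?_⟩
  have h1 := D.le_opNorm (tens h (fun _ => A hT (m + 2 : ℕ) (n + 1)) ρ)
  rw [hD, one_mul] at h1
  refine h1.trans ?_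
  rw [hg, ← mul_apply_eq_comp, tens_mul]
  refine (ContinuousLinearMap.le_opNorm _ _).trans ?_
  have h2 := tens_norm h (fun _ => A hT (m + 2 : ℕ) (n + 1) * (1 - tr hT (m + 2 : ℕ)))
  rw [Finset.prod_const, Finset.card_univ, Fintype.card_fin] at h2
  have h3 := h2.trans (hK n)
  push_cast
  calc _ ≤ (K * (n + 1 : ℝ) ^ (m + 1)) * ‖g‖ := by gcongr
    _ = _ := by ring

end Part12

section Part13
variable {X : Type} [MeasurableSpace X]
variable {μ : Measure X} [IsProbabilityMeasure μ] {T : X → X}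

lemma A_coe (hT : MeasurePreserving T μ μ) (n : ℕ) (f : Lp ℝ 1 μ) :
    (A hT 1 n f : X → ℝ) =ᵐ[μ] birkhoffSum T (f : X → ℝ) n := by
  induction n with
  | zero =>
    have : A hT 1 0 f = 0 := by simp [A]
    rw [this]
    filter_upwards [Lp.coeFn_zero ℝ 1 μ] with x hx
    rw [hx]; simp
  | succ n ih =>
    have : A hT 1 (n + 1) f = A hT 1 n f + (Koop hT 1 ^ n) f := by
      simp only [A, Finset.sum_range_succ]; rfl
    rw [this]
    filter_upwards [Lp.coeFn_add (A hT 1 n f) ((Koop hT 1 ^ n) f), ih, Koop_pow_coe hT 1 f n] with x a b c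
    rw [a, Pi.add_apply, b, c, birkhoffSum_succ]

lemma core (hT : MeasurePreserving T μ μ) (hex : Exact μ T) (r1 g0 : Lp ℝ 1 μ)
    (hr : r1 = g0 - tr hT 1 g0)
    (hO : ∃ B : ℝ, ∀ n : ℕ,
      (eLpNorm (fun x => ∑ k ∈ Finset.range n, (r1 : X → ℝ) (T^[k] x)) 1 μ).toReal ≤
        B * Real.sqrt n) :
    ∃ h : Lp ℝ 1 μ, Measurable (h : X → ℝ) ∧ MemLp (h : X → ℝ) 2 μ ∧
      μ[(h : X → ℝ) | MeasurableSpace.comap T inferInstance] =ᵐ[μ] 0 ∧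
      ∃ C : ℝ, 0 ≤ C ∧ ∀ n, ‖A hT 1 n r1 - A hT 1 n h‖ ≤ C := by
  obtain ⟨B, hB⟩ := hO
  set u := tr hT 1 g0 with hu
  set h : Lp ℝ 1 μ := g0 - Koop hT 1 u with hh
  have hhm : Measurable (h : X → ℝ) := (Lp.stronglyMeasurable h).measurable
  have hrh : r1 = h + (Koop hT 1 - 1) u := by
    rw [hr, hh, sub_apply]
    simp
  have hA : ∀ n, A hT 1 n r1 - A hT 1 n h = (Koop hT 1 ^ n) u - u := by
    intro n
    rw [hrh, map_add, add_sub_cancel_left, ← mul_apply_eq_comp, A_tel, sub_apply]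
    rfl
  have hKn : ∀ n : ℕ, ‖(Koop hT 1 ^ n) u‖ = ‖u‖ := by
    intro n
    induction n with
    | zero => simp
    | succ n ih => rw [pow_succ', mul_apply_eq_comp, Koop_norm, ih]
  have hC : ∀ n, ‖A hT 1 n r1 - A hT 1 n h‖ ≤ 2 * ‖u‖ := by
    intro n
    rw [hA]
    have := norm_sub_le ((Koop hT 1 ^ n) u) u
    rw [hKn] at this
    linarith
  have htr : tr hT 1 h = 0 := by
    rw [hh, map_sub, tr_Koop, hu, sub_self]
  have hc : μ[(h : X → ℝ) | MeasurableSpace.comap T inferInstance] =ᵐ[μ] 0 := by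
    have := tr_spec hT 1 h
    rw [htr, map_zero] at this
    exact this.symm.trans (Lp.coeFn_zero ℝ 1 μ)
  have hAn : ∀ (f : Lp ℝ 1 μ) (n : ℕ), ‖A hT 1 n f‖ = ∫ x, |birkhoffSum T (f : X → ℝ) n x| ∂μ := by
    intro f n
    rw [L1.norm_eq_integral_norm]
    refine integral_congr_ae ?_
    filter_upwards [A_coe hT n f] with x hx
    rw [hx, Real.norm_eq_abs]
  have hBr : ∀ n : ℕ, ‖A hT 1 n r1‖ ≤ B * Real.sqrt n := by
    intro n
    refine le_trans (le_of_eq ?_) (hB n)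
    rw [Lp.norm_def]
    congr 1
    exact eLpNorm_congr_ae (A_coe hT n r1)
  refine ⟨h, hhm, ?_, hc, 2 * ‖u‖, by positivity, hC⟩
  refine md_memL2 (exact_ergodic hT hex) hhm (Lp_integrable h) hc (B := B + 2 * ‖u‖) fun n => ?_
  rw [← hAn]
  rcases Nat.eq_zero_or_pos n with rfl | hn
  · simp [A]
  have h1 : (1 : ℝ) ≤ Real.sqrt n := by
    rw [Real.one_le_sqrt]; exact_mod_cast hn
  have h2 : ‖A hT 1 n h‖ ≤ ‖A hT 1 n r1‖ + ‖A hT 1 n r1 - A hT 1 n h‖ := by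
    calc ‖A hT 1 n h‖ = ‖A hT 1 n r1 - (A hT 1 n r1 - A hT 1 n h)‖ :=
          congrArg norm (sub_sub_cancel (A hT 1 n r1) (A hT 1 n h)).symm
      _ ≤ _ := norm_sub_le _ _
  have h3 := hBr n
  have h4 := hC n
  nlinarith [norm_nonneg u]

/-- The limit theorem for a sequence in `L_1` close to multiples of ergodic sums. -/
lemma limit_L1 (hT : MeasurePreserving T μ μ) (hex : Exact μ T) (r1 g0 : Lp ℝ 1 μ)
    (hr : r1 = g0 - tr hT 1 g0)
    (hO : ∃ B : ℝ, ∀ n : ℕ,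
      (eLpNorm (fun x => ∑ k ∈ Finset.range n, (r1 : X → ℝ) (T^[k] x)) 1 μ).toReal ≤
        B * Real.sqrt n) (d : ℕ) (F : ℕ → Lp ℝ 1 μ) (W : ℕ → X → ℝ)
    (hW : ∀ n, W n =ᵐ[μ] F n)
    (hF : Tendsto (fun n : ℕ => ‖F n - ((d : ℝ) / Real.sqrt n) • A hT 1 n r1‖) atTop (𝓝 0)) :
    ∃ σ2 : ℝ, 0 ≤ σ2 ∧
      (∀ ψ : BoundedContinuousFunction ℝ ℝ,
        Tendsto (fun n : ℕ => ∫ x, ψ (W n x) ∂μ)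
          atTop (𝓝 (∫ y, ψ y ∂ gaussianReal 0 (Real.toNNReal ((d : ℝ) ^ 2 * σ2))))) ∧
      Tendsto (fun n : ℕ => ∫ x, |W n x| ∂μ)
        atTop (𝓝 ((d : ℝ) * Real.sqrt (2 / Real.pi) * Real.sqrt σ2)) := by
  obtain ⟨h, hhm, hh2, hc, C, hC0, hC⟩ := core hT hex r1 g0 hr hO
  have herg := exact_ergodic hT hex
  set σ2 := ∫ x, h x ^ 2 ∂μ with hσ
  have hσ0 : 0 ≤ σ2 := integral_nonneg fun x => sq_nonneg _
  refine ⟨σ2, hσ0, ?_⟩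
  have hv : ((Real.toNNReal ((d : ℝ) ^ 2 * σ2) : NNReal) : ℝ) = (d : ℝ) ^ 2 * σ2 :=
    Real.coe_toNNReal _ (by positivity)
  have key := final_limit (μ := μ) (Y := fun n x => (d : ℝ) * (birkhoffSum T (h : X → ℝ) n x / Real.sqrt n))
    (W := W) (fun n => ?_) (fun n => ?_) (Real.toNNReal ((d : ℝ) ^ 2 * σ2)) (C := (d : ℝ) ^ 2 * σ2) (fun t => ?_)
    (fun n => ?_) ?_
  · refine ⟨key.1, ?_⟩
    have := key.2
    rwa [hv, Real.sqrt_mul (by positivity), Real.sqrt_sq (by positivity), ← mul_assoc,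
      mul_comm (Real.sqrt (2 / Real.pi)) (d : ℝ)] at this
  · have := ((memLp_birkhoffSum hT hh2 n).mul_const (Real.sqrt n)⁻¹).const_mul (d : ℝ)
    simpa only [div_eq_mul_inv] using this
  · exact (Lp_integrable (F n)).congr (hW n).symm
  · have := clt_L2 herg hhm hh2 hc (t * d)
    rw [hv]
    have e : (t * d) ^ 2 * (∫ x, h x ^ 2 ∂μ) / 2 = t ^ 2 * ((d : ℝ) ^ 2 * σ2) / 2 := by rw [hσ]; ring
    rw [e] at this
    refine this.congr fun n => ?_
    simp only [mul_assoc]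
  · have h1 := sq_birkhoffSum hT hhm hh2 (md_of_condExp hT.measurable (Lp_integrable h) hc) n
    have e : ∀ x, ((d : ℝ) * (birkhoffSum T (h : X → ℝ) n x / Real.sqrt n)) ^ 2 =
        ((d : ℝ) ^ 2 / n) * birkhoffSum T (h : X → ℝ) n x ^ 2 := by
      intro x
      rw [mul_pow, div_pow, Real.sq_sqrt (Nat.cast_nonneg n)]; ring
    simp only [e]
    rw [integral_const_mul, h1]
    rcases Nat.eq_zero_or_pos n with rfl | hn
    · simp; positivity
    · have : (n : ℝ) ≠ 0 := by positivity
      rw [← hσ]; field_simp; rfl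
  · have e : ∀ n : ℕ, ∫ x, |W n x - (d : ℝ) * (birkhoffSum T (h : X → ℝ) n x / Real.sqrt n)| ∂μ =
        ‖F n - ((d : ℝ) / Real.sqrt n) • A hT 1 n h‖ := by
      intro n
      rw [L1.norm_eq_integral_norm]
      refine integral_congr_ae ?_
      filter_upwards [A_coe hT n h, hW n, Lp.coeFn_sub (F n) (((d : ℝ) / Real.sqrt n) • A hT 1 n h),
        Lp.coeFn_smul ((d : ℝ) / Real.sqrt n) (A hT 1 n h)] with x a b c e
      rw [c, Pi.sub_apply, e, Pi.smul_apply, a, b, Real.norm_eq_abs, smul_eq_mul]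
      congr 2; ring
    simp only [e]
    have h2 : Tendsto (fun n : ℕ => ‖F n - ((d : ℝ) / Real.sqrt n) • A hT 1 n r1‖ + (d : ℝ) / Real.sqrt n * C) atTop (𝓝 0) := by
      have h3 : Tendsto (fun n : ℕ => (d : ℝ) / Real.sqrt n) atTop (𝓝 0) :=
        tendsto_const_nhds.div_atTop (Real.tendsto_sqrt_atTop.comp tendsto_natCast_atTop_atTop)
      simpa using hF.add (h3.mul_const C)
    refine squeeze_zero (fun n => norm_nonneg _) (fun n => ?_) h2
    have e1 : F n - ((d : ℝ) / Real.sqrt n) • A hT 1 n h =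
        (F n - ((d : ℝ) / Real.sqrt n) • A hT 1 n r1) + ((d : ℝ) / Real.sqrt n) • (A hT 1 n r1 - A hT 1 n h) := by
      rw [smul_sub]; abel
    rw [e1]
    refine (norm_add_le _ _).trans ?_
    rw [norm_smul, Real.norm_of_nonneg (by positivity)]
    gcongr
    exact hC n

end Part13

lemma coe_sum {X : Type} [MeasurableSpace X] {μ : Measure X} {ι : Type} (s : Finset ι) (G : ι → Lp ℝ 1 μ) :
    ((∑ i ∈ s, G i : Lp ℝ 1 μ) : X → ℝ) =ᵐ[μ] fun x => ∑ i ∈ s, (G i : X → ℝ) x := by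
  classical
  induction s using Finset.induction_on with
  | empty =>
    simp only [Finset.sum_empty]
    exact Lp.coeFn_zero ℝ 1 μ
  | insert a s ha ih =>
    rw [Finset.sum_insert ha]
    filter_upwards [Lp.coeFn_add (G a) (∑ i ∈ s, G i), ih] with x h1 h2
    rw [h1, Pi.add_apply, h2, Finset.sum_insert ha]

/-- Theorem 3, CLT with convergence of first absolute moments: for an
exact `T` and a symmetric kernel `f ∈ L₁^{sym}(μ^d)` whose Hoeffding components `R_m f`
lie in `L_{m,π}^{sym}(μ^m)` with convergent transfer series, and with
`|Σ_{k<n} V^k R_1 f|₁ = O(√n)`, the normalized von Mises statistics `V_n^{(d)}f` converge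
in distribution to `N(0,d²σ²(f))` for some `σ²(f) ≥ 0`, and
`E|V_n^{(d)}f| → d√(2/π)σ(f)`.  (The family `E m` realizes `L_{m+1,π}(μ^{m+1})`.) -/
theorem statement16
    {X : Type} [MeasurableSpace X] [StandardBorelSpace X]
    (μ : Measure X) [IsProbabilityMeasure μ]
    (T : X → X) (hT : MeasurePreserving T μ μ) (hexact : Exact μ T)
    (d : ℕ) (hd : 1 ≤ d)
    -- the kernel and its symmetric Hoeffding decomposition
    (f : Lp ℝ 1 (pm μ d)) (hfsym : Symm μ d (f : (Fin d → X) → ℝ))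
    (R : (m : ℕ) → Lp ℝ 1 (pm μ m))
    (hRsym : ∀ m, m ≤ d → Symm μ m (R m : (Fin m → X) → ℝ))
    (hRcanon : ∀ m, 1 ≤ m → m ≤ d → Canonical μ m (R m : (Fin m → X) → ℝ))
    (hHoef : ∀ᵐ x ∂ pm μ d, (f : (Fin d → X) → ℝ) x =
      ∑ m ∈ Finset.range (d + 1),
        ∑ S ∈ (Finset.powersetCard m (Finset.univ : Finset (Fin d))).attach,
          (R m : (Fin m → X) → ℝ)
            (fun j => x (S.1.orderEmbOfFin (Finset.mem_powersetCard_univ.mp S.2) j)))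
    -- realizations of the projective tensor powers `L_{m+1,π}(μ^{m+1})`
    (E : ℕ → Type) [∀ m, NormedAddCommGroup (E m)] [∀ m, NormedSpace ℝ (E m)]
    [∀ m, CompleteSpace (E m)]
    (tp : ∀ m : ℕ,
      ContinuousMultilinearMap ℝ (fun _ : Fin (m + 1) => Lp ℝ (m + 1 : ℕ) μ) (E m))
    (hPTP : ∀ m, IsPTP μ (fun _ : Fin (m + 1) => ((m + 1 : ℕ) : ℝ≥0∞)) (E m) (tp m))
    (Jm : ∀ m : ℕ, E m →L[ℝ] Lp ℝ (m + 1 : ℕ) (pm μ (m + 1)))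
    (hJ : ∀ m, IsEmbed μ (fun _ : Fin (m + 1) => ((m + 1 : ℕ) : ℝ≥0∞))
      ((m + 1 : ℕ) : ℝ≥0∞) (tp m) (Jm m))
    (Dm : ∀ m : ℕ, E m →L[ℝ] Lp ℝ 1 μ)
    (hD : ∀ m, IsDiag μ (fun _ : Fin (m + 1) => ((m + 1 : ℕ) : ℝ≥0∞)) 1 (tp m) (Dm m))
    (WK : ∀ m : ℕ, (Fin (m + 1) → ℕ) → E m →L[ℝ] E m)
    (hWK : ∀ m k, IsTKoop μ (fun _ : Fin (m + 1) => ((m + 1 : ℕ) : ℝ≥0∞)) (tp m)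
      (fun _ => T) k (WK m k))
    (WT : ∀ m : ℕ, (Fin (m + 1) → ℕ) → E m →L[ℝ] E m)
    (hWT : ∀ m k, IsTTrans μ (fun _ : Fin (m + 1) => ((m + 1 : ℕ) : ℝ≥0∞)) (tp m)
      (fun _ => T) k (WT m k))
    -- `R_{m+1} f ∈ L_{m+1,π}^{sym}(μ^{m+1})`, realized by `ρ m`
    (ρ : ∀ m : ℕ, E m)
    (hρ : ∀ m, m < d →
      (Jm m (ρ m) : (Fin (m + 1) → X) → ℝ) =ᵐ[pm μ (m + 1)] (R (m + 1) : (Fin (m + 1) → X) → ℝ))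
    -- convergence of the transfer series `Σ_𝐤 V^{*𝐤} R_m f` in `L_{m,π}(μ^m)`
    (hconv : ∀ m, m < d → ∃ gm : E m,
      Tendsto (fun n : Fin (m + 1) → ℕ =>
          ∑ k ∈ Fintype.piFinset (fun i => Finset.range (n i)), WT m k (ρ m))
        atTop (𝓝 gm))
    -- `R_1 f`, viewed on `X`, satisfies `|Σ_{k=0}^{n-1} V^k R_1 f|₁ = O(√n)`
    (r1 : Lp ℝ 1 μ)
    (hr1 : (r1 : X → ℝ) =ᵐ[μ] fun x => (R 1 : (Fin 1 → X) → ℝ) fun _ => x)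
    (hO : ∃ B : ℝ, ∀ n : ℕ,
      (eLpNorm (fun x => ∑ k ∈ Finset.range n, (r1 : X → ℝ) (T^[k] x)) 1 μ).toReal ≤
        B * Real.sqrt n) :
    ∃ σ2 : ℝ, 0 ≤ σ2 ∧
      (∀ ψ : BoundedContinuousFunction ℝ ℝ,
        Tendsto (fun n : ℕ => ∫ x, ψ (((n : ℝ) ^ ((d : ℝ) - 1 / 2))⁻¹ *
            ∑ k ∈ Fintype.piFinset (fun _ : Fin d => Finset.range n),
              ∑ m ∈ Finset.range d,
                ∑ S ∈ (Finset.powersetCard (m + 1) (Finset.univ : Finset (Fin d))).attach,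
                  (Dm m (WK m
                      (fun j => k (S.1.orderEmbOfFin (Finset.mem_powersetCard_univ.mp S.2) j))
                      (ρ m)) : X → ℝ) x) ∂μ)
          atTop (𝓝 (∫ y, ψ y ∂ gaussianReal 0 (Real.toNNReal ((d : ℝ) ^ 2 * σ2))))) ∧
      Tendsto (fun n : ℕ => ∫ x, |((n : ℝ) ^ ((d : ℝ) - 1 / 2))⁻¹ *
          ∑ k ∈ Fintype.piFinset (fun _ : Fin d => Finset.range n),
            ∑ m ∈ Finset.range d,
              ∑ S ∈ (Finset.powersetCard (m + 1) (Finset.univ : Finset (Fin d))).attach,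
                (Dm m (WK m
                    (fun j => k (S.1.orderEmbOfFin (Finset.mem_powersetCard_univ.mp S.2) j))
                    (ρ m)) : X → ℝ) x| ∂μ)
        atTop (𝓝 ((d : ℝ) * Real.sqrt (2 / Real.pi) * Real.sqrt σ2)) := by
  have hρg : ∀ m, m < d → ∃ g : E m, ρ m = tens (hPTP m) (fun _ => 1 - tr hT (m + 1 : ℕ)) g := by
    intro m hm
    obtain ⟨g, hg⟩ := hconv m hm
    refine ⟨g, rho_eq hT (hPTP m) (GG_all hT hexact (m + 1)) ((hg.comp (diag_tendsto (m + 1))).congr fun N => ?_)⟩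
    rw [tens_sum, sum_apply]
    refine Finset.sum_congr rfl fun k _ => ?_
    rw [WT_eq hT (hPTP m) (hWT m k)]
  have hsumK : ∀ m n, ∑ l ∈ Fintype.piFinset (fun _ : Fin (m + 1) => Finset.range n), Dm m (WK m l (ρ m)) =
      Dm m (tens (hPTP m) (fun _ => A hT (m + 1 : ℕ) n) (ρ m)) := by
    intro m n
    unfold A
    rw [tens_sum, sum_apply, map_sum]
    refine Finset.sum_congr rfl fun k _ => ?_
    rw [WK_eq hT (hPTP m) (hWK m k)]
  obtain ⟨g0, hg0⟩ := hρg 0 hd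
  obtain ⟨hr, hm0⟩ := m0 hT (by simp) (hPTP 0) (Jm 0) (hJ 0) (Dm 0) (hD 0) (R 1) (hρ 0 hd) r1 hr1 hg0
  have hdec : ∀ m, ∃ K : ℝ, m < d → ∀ n : ℕ,
      ‖Dm m (tens (hPTP m) (fun _ => A hT (m + 1 : ℕ) (n + 1)) (ρ m)) -
        (if m = 0 then A hT 1 (n + 1) r1 else 0)‖ ≤ K * ((n + 1 : ℕ) : ℝ) ^ m := by
    intro m
    by_cases hm : m < d
    · rcases m with _ | m
      · refine ⟨0, fun _ n => ?_⟩
        rw [if_pos rfl, hm0, sub_self, norm_zero, zero_mul]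
      · obtain ⟨g, hg⟩ := hρg (m + 1) hm
        obtain ⟨K, _, hK⟩ := decay hT m (hPTP (m + 1)) (Dm (m + 1)) (hD (m + 1)).1 hg
        refine ⟨K, fun _ n => ?_⟩
        rw [if_neg (Nat.succ_ne_zero m), sub_zero]
        exact hK n
    · exact ⟨0, fun h => absurd h hm⟩
  choose K hK using hdec
  set F : ℕ → Lp ℝ 1 μ := fun n => ((n : ℝ) ^ ((d : ℝ) - 1 / 2))⁻¹ •
            ∑ k ∈ Fintype.piFinset (fun _ : Fin d => Finset.range n),
              ∑ m ∈ Finset.range d,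
                ∑ S ∈ (Finset.powersetCard (m + 1) (Finset.univ : Finset (Fin d))).attach,
                  Dm m (WK m
                      (fun j => k (S.1.orderEmbOfFin (Finset.mem_powersetCard_univ.mp S.2) j))
                      (ρ m)) with hF
  have hFeq : ∀ n, F n = ∑ m ∈ Finset.range d,
      (((n : ℝ) ^ ((d : ℝ) - 1 / 2))⁻¹ * ((d.choose (m + 1) : ℝ) * (n : ℝ) ^ (d - (m + 1)))) •
        Dm m (tens (hPTP m) (fun _ => A hT (m + 1 : ℕ) n) (ρ m)) := by
    intro n
    rw [hF]
    dsimp only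
    rw [Finset.sum_comm, Finset.smul_sum]
    refine Finset.sum_congr rfl fun m _ => ?_
    rw [Finset.sum_comm, mul_smul]
    congr 1
    have e : ∀ S ∈ (Finset.powersetCard (m + 1) (Finset.univ : Finset (Fin d))).attach,
        ∑ k ∈ Fintype.piFinset (fun _ : Fin d => Finset.range n), Dm m (WK m
                      (fun j => k (S.1.orderEmbOfFin (Finset.mem_powersetCard_univ.mp S.2) j))
                      (ρ m)) = n ^ (d - (m + 1)) • Dm m (tens (hPTP m) (fun _ => A hT (m + 1 : ℕ) n) (ρ m)) := by
      intro S _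
      rw [← hsumK]
      have := comb (fun j => S.1.orderEmbOfFin (Finset.mem_powersetCard_univ.mp S.2) j)
        (S.1.orderEmbOfFin (Finset.mem_powersetCard_univ.mp S.2)).injective (Finset.range n)
        (fun l => Dm m (WK m l (ρ m)))
      rwa [Finset.card_range] at this
    rw [Finset.sum_congr rfl e, Finset.sum_const, Finset.card_attach, Finset.card_powersetCard,
      Finset.card_univ, Fintype.card_fin, ← Nat.cast_smul_eq_nsmul ℝ, ← Nat.cast_smul_eq_nsmul ℝ, smul_smul]
    push_cast
    rfl
  have hpow : ∀ n : ℕ, ((n + 1 : ℕ) : ℝ) ^ ((d : ℝ) - 1 / 2) =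
      ((n + 1 : ℕ) : ℝ) ^ (d - 1) * Real.sqrt ((n + 1 : ℕ) : ℝ) := by
    intro n
    have h0 : (0 : ℝ) < ((n + 1 : ℕ) : ℝ) := by positivity
    rw [Real.sqrt_eq_rpow, ← Real.rpow_natCast, ← Real.rpow_add h0]
    congr 1
    rw [Nat.cast_sub hd]
    push_cast
    ring
  have hcm : ∀ n m : ℕ, m < d → (((n + 1 : ℕ) : ℝ) ^ ((d : ℝ) - 1 / 2))⁻¹ *
      ((d.choose (m + 1) : ℝ) * ((n + 1 : ℕ) : ℝ) ^ (d - (m + 1))) * ((n + 1 : ℕ) : ℝ) ^ m =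
      (d.choose (m + 1) : ℝ) / Real.sqrt ((n + 1 : ℕ) : ℝ) := by
    intro n m hm
    have h0 : (0 : ℝ) < ((n + 1 : ℕ) : ℝ) := by positivity
    have h1 : 0 < Real.sqrt ((n + 1 : ℕ) : ℝ) := Real.sqrt_pos.2 h0
    have h2 : ((n + 1 : ℕ) : ℝ) ^ (d - 1) = ((n + 1 : ℕ) : ℝ) ^ (d - (m + 1)) * ((n + 1 : ℕ) : ℝ) ^ m := by
      rw [← pow_add]; congr 1; omega
    rw [hpow, h2]
    generalize Real.sqrt ((n + 1 : ℕ) : ℝ) = s at *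
    generalize ((n + 1 : ℕ) : ℝ) = N at *
    field_simp
  refine limit_L1 hT hexact r1 (Dm 0 g0) hr hO d F _ (fun n => ?_) ?_
  · have hco : ∀ {ι : Type} (s : Finset ι) (G : ι → Lp ℝ 1 μ),
        ((∑ i ∈ s, G i : Lp ℝ 1 μ) : X → ℝ) =ᵐ[μ] fun x => ∑ i ∈ s, (G i : X → ℝ) x := by
      intro ι s G
      exact coe_sum s G
    have h3 : ∀ k : Fin d → ℕ, ∀ m, _ := fun k m => hco
      (Finset.powersetCard (m + 1) (Finset.univ : Finset (Fin d))).attach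
      (fun S => Dm m (WK m (fun j => k (S.1.orderEmbOfFin (Finset.mem_powersetCard_univ.mp S.2) j)) (ρ m)))
    have h2 : ∀ k : Fin d → ℕ, _ := fun k => (hco (Finset.range d) (fun m =>
      ∑ S ∈ (Finset.powersetCard (m + 1) (Finset.univ : Finset (Fin d))).attach,
        Dm m (WK m (fun j => k (S.1.orderEmbOfFin (Finset.mem_powersetCard_univ.mp S.2) j)) (ρ m))))
    have h1 := hco (Fintype.piFinset (fun _ : Fin d => Finset.range n)) (fun k => ∑ m ∈ Finset.range d,
      ∑ S ∈ (Finset.powersetCard (m + 1) (Finset.univ : Finset (Fin d))).attach,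
        Dm m (WK m (fun j => k (S.1.orderEmbOfFin (Finset.mem_powersetCard_univ.mp S.2) j)) (ρ m)))
    have h0 := Lp.coeFn_smul (((n : ℝ) ^ ((d : ℝ) - 1 / 2))⁻¹) (∑ k ∈ Fintype.piFinset (fun _ : Fin d => Finset.range n),
      ∑ m ∈ Finset.range d, ∑ S ∈ (Finset.powersetCard (m + 1) (Finset.univ : Finset (Fin d))).attach,
        Dm m (WK m (fun j => k (S.1.orderEmbOfFin (Finset.mem_powersetCard_univ.mp S.2) j)) (ρ m)))
    have h2' := ae_all_iff.2 h2
    have h3' := ae_all_iff.2 fun k => ae_all_iff.2 (h3 k)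
    filter_upwards [h0, h1, h2', h3'] with x a b c e
    rw [hF]
    dsimp only
    rw [a, Pi.smul_apply, b, smul_eq_mul]
    congr 1
    refine Finset.sum_congr rfl fun k _ => ?_
    rw [c k]
    exact Finset.sum_congr rfl fun m _ => (e k m).symm
  · rw [← tendsto_add_atTop_iff_nat 1]
    have hlim : Tendsto (fun n : ℕ => ∑ m ∈ Finset.range d,
        (d.choose (m + 1) : ℝ) / Real.sqrt ((n + 1 : ℕ) : ℝ) * K m) atTop (𝓝 0) := by
      rw [← Finset.sum_const_zero (s := Finset.range d)]
      refine tendsto_finsetSum _ fun m _ => ?_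
      have h3 : Tendsto (fun n : ℕ => (d.choose (m + 1) : ℝ) / Real.sqrt ((n + 1 : ℕ) : ℝ)) atTop (𝓝 0) :=
        tendsto_const_nhds.div_atTop (Real.tendsto_sqrt_atTop.comp
          (tendsto_natCast_atTop_atTop.comp (tendsto_add_atTop_nat 1)))
      simpa using h3.mul_const (K m)
    refine squeeze_zero (fun n => norm_nonneg _) (fun n => ?_) hlim
    have e : F (n + 1) - ((d : ℝ) / Real.sqrt ((n + 1 : ℕ) : ℝ)) • A hT 1 (n + 1) r1 = ∑ m ∈ Finset.range d,
      ((((n + 1 : ℕ) : ℝ) ^ ((d : ℝ) - 1 / 2))⁻¹ * ((d.choose (m + 1) : ℝ) * ((n + 1 : ℕ) : ℝ) ^ (d - (m + 1)))) •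
        (Dm m (tens (hPTP m) (fun _ => A hT (m + 1 : ℕ) (n + 1)) (ρ m)) -
          (if m = 0 then A hT 1 (n + 1) r1 else 0)) := by
      simp only [smul_sub]
      rw [Finset.sum_sub_distrib, ← hFeq]
      congr 1
      rw [Finset.sum_eq_single 0]
      · rw [if_pos rfl]
        congr 1
        have := hcm n 0 hd
        rw [pow_zero, mul_one, zero_add, Nat.choose_one_right] at this
        rw [zero_add, Nat.choose_one_right, this]
      · intro m _ hm
        rw [if_neg hm, smul_zero]
      · intro h
        exact absurd (Finset.mem_range.2 hd) h
    rw [e]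
    refine (norm_sum_le _ _).trans (Finset.sum_le_sum fun m hm => ?_)
    rw [Finset.mem_range] at hm
    rw [norm_smul, Real.norm_of_nonneg (by positivity)]
    refine (mul_le_mul_of_nonneg_left (hK m hm n) (by positivity)).trans (le_of_eq ?_)
    rw [← hcm n m hm]
    ring

end VonMises
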